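/- Let Γ be a lattice in ℝ^m × ℝ^n such that the projection p_1 restricted to Γ is injective and the image p_2(Γ) is dense in ℝ^n. Let W, W' ⊆ ℝ^n be two bounded Riemann measurable sets of positive Lebesgue measure. If the model sets Λ(Γ, W) and Λ(Γ, W') are bounded distance equivalent, then W and W' are equidecomposable up to measure zero with Lebesgue measurable pieces, using only translations by vectors from p_2(Γ). -/

import Mathlib

open Pointwise MeasureTheory

/-- `P` is a partition of `A` into finitely many (possibly empty) pieces. -/
def IsPartitionOf {X : Type*} {n : ℕ} (P : Fin n → Set X) (A : Set X) : Prop :=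
  (⋃ i, P i) = A ∧ Pairwise (Function.onFun Disjoint P)

/-- A lattice in a real normed space: a discrete subgroup whose real span is everything. -/
def IsLattice {E : Type*} [NormedAddCommGroup E] [NormedSpace ℝ E]
    (Γ : AddSubgroup E) : Prop :=
  DiscreteTopology Γ ∧ Submodule.span ℝ (Γ : Set E) = ⊤

/-- The cut-and-project set (model set) `Λ(Γ, W) = { p₁(γ) : γ ∈ Γ, p₂(γ) ∈ W }`. -/
def modelSet {m n : ℕ} (Γ : AddSubgroup ((Fin m → ℝ) × (Fin n → ℝ)))
    (W : Set (Fin n → ℝ)) : Set (Fin m → ℝ) :=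
  {x | ∃ γ ∈ Γ, γ.2 ∈ W ∧ γ.1 = x}

/-- Two point sets are bounded distance equivalent: there is a bijection
moving every point a distance at most `K` for some `K > 0`. -/
def BDEquiv {E : Type*} [MetricSpace E] (Λ Λ' : Set E) : Prop :=
  ∃ K : ℝ, 0 < K ∧ ∃ χ : Λ → Λ', Function.Bijective χ ∧ ∀ p : Λ, dist (χ p : E) (p : E) ≤ K

/-- `W, W'` are equidecomposable up to measure zero with Lebesgue measurable pieces,
using only translations by vectors in the set `H`. -/
def EquidecompUpToNullMeasPieces {n : ℕ} (W W' : Set (Fin n → ℝ)) (H : Set (Fin n → ℝ)) :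
    Prop :=
  ∃ (k : ℕ) (P : Fin k → Set (Fin n → ℝ)) (h : Fin k → (Fin n → ℝ)) (X' : Set (Fin n → ℝ)),
    volume X'ᶜ = 0 ∧
    (∀ j, MeasurableSet (P j)) ∧ (∀ j, h j ∈ H) ∧
    IsPartitionOf (fun j => P j ∩ X') (W ∩ X') ∧
    IsPartitionOf (fun j => (h j +ᵥ P j) ∩ X') (W' ∩ X')

namespace BDE

/-- The cube of radius `ρ` in `ℤ^J`. -/
noncomputable def Q (J : Type) [Fintype J] [DecidableEq J] (ρ : ℤ) : Finset (J → ℤ) :=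
  Fintype.piFinset (fun _ => Finset.Icc (-ρ) ρ)

section Qsec
variable {J : Type} [Fintype J] [DecidableEq J]

theorem mem_Q {ρ : ℤ} {g : J → ℤ} : g ∈ Q J ρ ↔ ∀ i, -ρ ≤ g i ∧ g i ≤ ρ := by
  simp [Q, Fintype.mem_piFinset]

theorem Q_zero_mem {ρ : ℤ} (h : 0 ≤ ρ) : (0 : J → ℤ) ∈ Q J ρ := by
  rw [mem_Q]; intro i; simp; omega

theorem Q_neg_mem {ρ : ℤ} {g : J → ℤ} (h : g ∈ Q J ρ) : -g ∈ Q J ρ := by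
  rw [mem_Q] at *; intro i; have := h i; simp only [Pi.neg_apply]; omega

theorem Q_neg_mem_iff {ρ : ℤ} {g : J → ℤ} : -g ∈ Q J ρ ↔ g ∈ Q J ρ :=
  ⟨fun h => by simpa using Q_neg_mem h, Q_neg_mem⟩

theorem Q_add_mem {a b : ℤ} {g h : J → ℤ} (hg : g ∈ Q J a) (hh : h ∈ Q J b) :
    g + h ∈ Q J (a + b) := by
  rw [mem_Q] at *; intro i; have := hg i; have := hh i; simp only [Pi.add_apply]; omega

theorem Q_sub_mem {a b : ℤ} {g h : J → ℤ} (hg : g ∈ Q J a) (hh : h ∈ Q J b) :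
    g - h ∈ Q J (a + b) := by
  rw [sub_eq_add_neg]; exact Q_add_mem hg (Q_neg_mem hh)

theorem Q_mono {a b : ℤ} (h : a ≤ b) : Q J a ⊆ Q J b := by
  intro g hg; rw [mem_Q] at *; intro i; have := hg i; omega

theorem card_Q {ρ : ℤ} (h : 0 ≤ ρ) : ((Q J ρ).card : ℤ) = (2 * ρ + 1) ^ Fintype.card J := by
  rw [Q, Fintype.card_piFinset]
  simp only [Int.card_Icc, Finset.prod_const, Finset.card_univ]
  push_cast
  rw [Int.toNat_of_nonneg (by omega)]
  congr 1; ring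

theorem card_Q_pos {ρ : ℤ} (h : 0 ≤ ρ) : 0 < (Q J ρ).card :=
  Finset.card_pos.2 ⟨0, Q_zero_mem h⟩

/-- packing bound -/
theorem packing {P : Finset (J → ℤ)} {a b : ℤ} (hP : P ⊆ Q J b)
    (hsep : ∀ p ∈ P, ∀ q ∈ P, q - p ∈ Q J (2 * a) → p = q) :
    P.card * (Q J a).card ≤ (Q J (a + b)).card := by
  rw [← Finset.card_product]
  refine Finset.card_le_card_of_injOn (fun x => x.2 + x.1) ?_ ?_
  · intro x hx
    simp only [Finset.coe_product, Set.mem_prod, Finset.mem_coe] at hx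
    exact Q_add_mem hx.2 (hP hx.1)
  · rintro ⟨p, g⟩ hx ⟨q, h⟩ hy e
    simp only [Finset.coe_product, Set.mem_prod, Finset.mem_coe] at hx hy e
    have hpq : p = q := by
      refine hsep p hx.1 q hy.1 ?_
      have : q - p = g - h := by
        have : g + p = h + q := e
        rw [sub_eq_sub_iff_add_eq_add, add_comm q h, ← this]
      rw [this, two_mul]
      exact Q_sub_mem hx.2 hy.2
    subst hpq
    have := add_right_cancel e
    simp [this]

/-- the shell -/
noncomputable def S (J : Type) [Fintype J] [DecidableEq J] (ρ w : ℤ) : Finset (J → ℤ) :=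
  Q J (ρ + w) \ Q J (ρ - w - 1)

theorem mem_S {ρ w : ℤ} {g : J → ℤ} : g ∈ S J ρ w ↔ g ∈ Q J (ρ + w) ∧ g ∉ Q J (ρ - w - 1) := by
  simp [S]

theorem S_neg_mem {ρ w : ℤ} {g : J → ℤ} (h : g ∈ S J ρ w) : -g ∈ S J ρ w := by
  rw [mem_S] at *; rwa [Q_neg_mem_iff, Q_neg_mem_iff]

theorem S_add_mem {ρ w a : ℤ} {g h : J → ℤ} (hg : g ∈ S J ρ w) (hh : h ∈ Q J a) :
    g + h ∈ S J ρ (w + a) := by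
  rw [mem_S] at *
  refine ⟨by have := Q_add_mem hg.1 hh; rwa [add_assoc] at this, fun hc => hg.2 ?_⟩
  have := Q_sub_mem hc hh
  rw [add_sub_cancel_right] at this
  rwa [show ρ - (w + a) - 1 + a = ρ - w - 1 by ring] at this

theorem S_mono {ρ w w' : ℤ} (h : w ≤ w') : S J ρ w ⊆ S J ρ w' := by
  intro g hg; rw [mem_S] at *
  exact ⟨Q_mono (by omega) hg.1, fun hc => hg.2 (Q_mono (by omega) hc)⟩

theorem S_subset {ρ w : ℤ} : S J ρ w ⊆ Q J (ρ + w) := Finset.sdiff_subset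

open Filter Topology in
/-- shells are small -/
theorem shell_small (w : ℤ) (hw : 0 ≤ w) (C : ℝ) :
    ∃ ρ₀ : ℤ, ∀ ρ ≥ ρ₀, C * ((S J ρ w).card : ℝ) ≤ (Q J ρ).card := by
  have key : ∀ ρ : ℤ, w + 1 ≤ ρ → ((S J ρ w).card : ℝ) =
      (2 * (ρ + w) + 1 : ℝ) ^ Fintype.card J - (2 * (ρ - w - 1) + 1 : ℝ) ^ Fintype.card J := by
    intro ρ hρ
    have h1 : (Q J (ρ - w - 1)) ⊆ Q J (ρ + w) := Q_mono (by omega)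
    rw [S, Finset.card_sdiff_of_subset h1, Nat.cast_sub (Finset.card_le_card h1)]
    have e1 := card_Q (J := J) (ρ := ρ + w) (by omega)
    have e2 := card_Q (J := J) (ρ := ρ - w - 1) (by omega)
    have e1' : ((Q J (ρ + w)).card : ℝ) = (((2 * (ρ + w) + 1) ^ Fintype.card J : ℤ) : ℝ) := by
      rw [← e1]; simp
    have e2' : ((Q J (ρ - w - 1)).card : ℝ) = (((2 * (ρ - w - 1) + 1) ^ Fintype.card J : ℤ) : ℝ) := by
      rw [← e2]; simp
    rw [e1', e2']; push_cast; ring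
  have hlim : Tendsto (fun t : ℝ => C * ((2 * (1 + w * t) + t) ^ Fintype.card J
      - (2 * (1 - w * t - t) + t) ^ Fintype.card J) - (2 + t) ^ Fintype.card J) (𝓝 0)
      (𝓝 (C * ((2 * (1 + w * 0) + 0) ^ Fintype.card J
      - (2 * (1 - w * 0 - 0) + 0) ^ Fintype.card J) - (2 + 0) ^ Fintype.card J)) := by
    apply Continuous.tendsto; fun_prop
  have hneg : (C * ((2 * (1 + (w : ℝ) * 0) + 0) ^ Fintype.card J
      - (2 * (1 - w * 0 - 0) + 0) ^ Fintype.card J) - (2 + 0 : ℝ) ^ Fintype.card J) < 0 := by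
    have : (0 : ℝ) < 2 ^ Fintype.card J := by positivity
    simp
  have hev := hlim.eventually (eventually_lt_nhds hneg)
  have hinv : Tendsto (fun ρ : ℤ => ((ρ : ℝ))⁻¹) atTop (𝓝 0) :=
    tendsto_inv_atTop_zero.comp tendsto_intCast_atTop_atTop
  have hev2 := hinv.eventually hev
  obtain ⟨ρ₀, h0⟩ := eventually_atTop.1 hev2
  refine ⟨max ρ₀ (w + 1), fun ρ hρ => ?_⟩
  have h1 := h0 ρ (le_trans (le_max_left _ _) hρ)
  have h2 : w + 1 ≤ ρ := le_trans (le_max_right _ _) hρ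
  have hpos : (0 : ℝ) < ρ := by have : 0 < ρ := by omega
                                exact_mod_cast this
  rw [key ρ h2]
  have e3 := card_Q (J := J) (ρ := ρ) (by omega)
  have e3' : ((Q J ρ).card : ℝ) = (2 * ρ + 1 : ℝ) ^ Fintype.card J := by
    have : ((Q J ρ).card : ℝ) = (((2 * ρ + 1) ^ Fintype.card J : ℤ) : ℝ) := by rw [← e3]; simp
    rw [this]; push_cast; ring
  rw [e3']
  have f1 : (2 * (ρ + w) + 1 : ℝ) = ρ * (2 * (1 + w * (ρ : ℝ)⁻¹) + (ρ : ℝ)⁻¹) := by field_simp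
  have f2 : (2 * (ρ - w - 1) + 1 : ℝ) = ρ * (2 * (1 - w * (ρ : ℝ)⁻¹ - (ρ : ℝ)⁻¹) + (ρ : ℝ)⁻¹) := by
    field_simp
  have f3 : (2 * ρ + 1 : ℝ) = ρ * (2 + (ρ : ℝ)⁻¹) := by field_simp
  rw [f1, f2, f3, mul_pow, mul_pow, mul_pow]
  have hp : (0 : ℝ) < ρ ^ Fintype.card J := by positivity
  nlinarith [mul_pos hp (sub_pos.2 h1)]

end Qsec

section markers
variable {J : Type} [Fintype J] [DecidableEq J] {Ω : Type} [MeasurableSpace Ω]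
  [AddAction (J → ℤ) Ω]

/-- greedy approximations to a marker set -/
def greedy (s : ℤ) (c : Ω → ℕ) : ℕ → Set Ω
  | 0 => ∅
  | i + 1 => greedy s c i ∪ {x | c x = i ∧ ∀ g ∈ Q J s, g +ᵥ x ∉ greedy s c i}

theorem markers (hm : ∀ g : J → ℤ, Measurable (fun x : Ω => g +ᵥ x)) (s : ℤ) (hs : 0 ≤ s)
    (c : Ω → ℕ) (hc : Measurable c)
    (hcol : ∀ x, ∀ g ∈ Q J s, g ≠ 0 → c (g +ᵥ x) ≠ c x) :
    ∃ V : Set Ω, MeasurableSet V ∧ (∀ x ∈ V, ∀ g ∈ Q J s, g +ᵥ x ∈ V → g = 0) ∧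
      ∀ x, ∃ g ∈ Q J s, g +ᵥ x ∈ V := by
  have hmeas : ∀ i, MeasurableSet (greedy (J := J) s c i) := by
    intro i
    induction i with
    | zero => exact MeasurableSet.empty
    | succ i ih =>
      refine ih.union ?_
      have : {x | c x = i ∧ ∀ g ∈ Q J s, g +ᵥ x ∉ greedy (J := J) s c i} =
        (c ⁻¹' {i}) ∩ ⋂ g ∈ Q J s, (fun x => g +ᵥ x) ⁻¹' (greedy (J := J) s c i)ᶜ := by
        ext x; simp
      rw [this]
      exact (hc (measurableSet_singleton i)).inter
        (Finset.measurableSet_biInter _ fun g _ => (hm g) ih.compl)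
  have hmono : Monotone (greedy (J := J) s c) := monotone_nat_of_le_succ fun i => by
    rw [greedy]; exact Set.subset_union_left
  have hstep : ∀ i x, x ∈ greedy (J := J) s c i → c x < i ∧ ∀ g ∈ Q J s, g +ᵥ x ∉ greedy (J := J) s c (c x) := by
    intro i
    induction i with
    | zero => intro x hx; exact absurd hx (Set.notMem_empty x)
    | succ i ih =>
      intro x hx
      rcases hx with hx | hx
      · exact ⟨(ih x hx).1.trans (Nat.lt_succ_self i), (ih x hx).2⟩
      · obtain ⟨h1, h2⟩ := hx
        rw [h1]; exact ⟨Nat.lt_succ_self i, h2⟩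
  have hmem : ∀ i x, x ∈ greedy (J := J) s c i → x ∈ greedy (J := J) s c (c x + 1) := by
    intro i x hx
    right
    exact ⟨rfl, (hstep i x hx).2⟩
  refine ⟨⋃ i, greedy (J := J) s c i, MeasurableSet.iUnion hmeas, ?_, ?_⟩
  · intro x hx g hg hgx
    by_contra hne
    obtain ⟨i, hi⟩ := Set.mem_iUnion.1 hx
    obtain ⟨j, hj⟩ := Set.mem_iUnion.1 hgx
    have hcc := hcol x g hg hne
    rcases lt_or_gt_of_ne hcc with h | h
    · exact (hstep i x hi).2 g hg (hmono h (hmem j _ hj))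
    · refine (hstep j _ hj).2 (-g) (Q_neg_mem hg) ?_
      rw [neg_vadd_vadd]
      exact hmono h (hmem i _ hi)
  · intro x
    by_cases h : ∃ g ∈ Q J s, g +ᵥ x ∈ greedy (J := J) s c (c x)
    · obtain ⟨g, hg, hgx⟩ := h
      exact ⟨g, hg, Set.mem_iUnion.2 ⟨_, hgx⟩⟩
    · push Not at h
      refine ⟨0, Q_zero_mem hs, Set.mem_iUnion.2 ⟨c x + 1, ?_⟩⟩
      rw [zero_vadd]
      right; exact ⟨rfl, h⟩

end markers
end BDE

namespace BDE

section rounding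
variable {V E : Type} [Fintype V] [Fintype E] [DecidableEq V] [DecidableEq E]

/-- incidence number -/
def inc (src tgt : E → V) (v : V) (e : E) : ℤ :=
  (if src e = v then 1 else 0) - (if tgt e = v then 1 else 0)

theorem exists_kernel (src tgt : E → V) (φ : E → ℝ) (D : V → ℤ)
    (hdiv : ∀ v, ∑ e, (inc src tgt v e : ℝ) * φ e = D v)
    (hN : ∃ e, Int.fract (φ e) ≠ 0) :
    ∃ p : E → ℝ, p ≠ 0 ∧ (∀ e, Int.fract (φ e) = 0 → p e = 0) ∧
      ∀ v, ∑ e, (inc src tgt v e : ℝ) * p e = 0 := by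
  classical
  set N : Finset E := Finset.univ.filter (fun e => Int.fract (φ e) ≠ 0) with hNdef
  set d : V → ℕ := fun v => (N.filter (fun e => src e = v)).card + (N.filter (fun e => tgt e = v)).card
    with hd
  set V' : Finset V := Finset.univ.filter (fun v => d v ≠ 0) with hV'
  have hd1 : ∀ v, d v ≠ 1 := by
    intro v h1
    -- a unique edge
    have : ∃ e0 ∈ N, (inc src tgt v e0 = 1 ∨ inc src tgt v e0 = -1) ∧
        ∀ e ∈ N, e ≠ e0 → inc src tgt v e = 0 := by
      have hcases : ((N.filter (fun e => src e = v)).card = 1 ∧ (N.filter (fun e => tgt e = v)).card = 0) ∨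
        ((N.filter (fun e => src e = v)).card = 0 ∧ (N.filter (fun e => tgt e = v)).card = 1) := by
        simp only [hd] at h1; omega
      rcases hcases with ⟨ha, hb⟩ | ⟨ha, hb⟩
      · obtain ⟨e0, he0⟩ := Finset.card_eq_one.1 ha
        rw [Finset.card_eq_zero] at hb
        have hm : e0 ∈ N.filter (fun e => src e = v) := by rw [he0]; simp
        rw [Finset.mem_filter] at hm
        have hnt : ∀ e ∈ N, tgt e ≠ v := fun e he h => by
          have : e ∈ N.filter (fun e => tgt e = v) := Finset.mem_filter.2 ⟨he, h⟩
          rw [hb] at this; exact absurd this (Finset.notMem_empty e)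
        refine ⟨e0, hm.1, Or.inl ?_, ?_⟩
        · simp [inc, hm.2, hnt e0 hm.1]
        · intro e he hne
          have : src e ≠ v := fun h => hne (by
            have : e ∈ N.filter (fun e => src e = v) := Finset.mem_filter.2 ⟨he, h⟩
            rw [he0] at this; simpa using this)
          simp [inc, this, hnt e he]
      · obtain ⟨e0, he0⟩ := Finset.card_eq_one.1 hb
        rw [Finset.card_eq_zero] at ha
        have hm : e0 ∈ N.filter (fun e => tgt e = v) := by rw [he0]; simp
        rw [Finset.mem_filter] at hm
        have hnt : ∀ e ∈ N, src e ≠ v := fun e he h => by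
          have : e ∈ N.filter (fun e => src e = v) := Finset.mem_filter.2 ⟨he, h⟩
          rw [ha] at this; exact absurd this (Finset.notMem_empty e)
        refine ⟨e0, hm.1, Or.inr ?_, ?_⟩
        · simp [inc, hm.2, hnt e0 hm.1]
        · intro e he hne
          have : tgt e ≠ v := fun h => hne (by
            have : e ∈ N.filter (fun e => tgt e = v) := Finset.mem_filter.2 ⟨he, h⟩
            rw [he0] at this; simpa using this)
          simp [inc, this, hnt e he]
    obtain ⟨e0, he0, hinc, hz⟩ := this
    have h := hdiv v
    rw [← Finset.add_sum_erase _ _ (Finset.mem_univ e0)] at h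
    have h2 : ∑ e ∈ Finset.univ.erase e0, (inc src tgt v e : ℝ) * φ e =
        ((∑ e ∈ Finset.univ.erase e0, inc src tgt v e * ⌊φ e⌋ : ℤ) : ℝ) := by
      push_cast
      refine Finset.sum_congr rfl fun e he => ?_
      by_cases heN : e ∈ N
      · rw [hz e heN (Finset.ne_of_mem_erase he)]; simp
      · have : Int.fract (φ e) = 0 := by simpa [hNdef] using heN
        have h3 := Int.floor_add_fract (φ e)
        rw [this, add_zero] at h3
        rw [h3]
    rw [h2] at h
    have hfr : Int.fract (φ e0) ≠ 0 := by simpa [hNdef] using he0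
    apply hfr
    rcases hinc with h1 | h1
    · rw [h1] at h
      have : φ e0 = ((D v - ∑ e ∈ Finset.univ.erase e0, inc src tgt v e * ⌊φ e⌋ : ℤ) : ℝ) := by
        rw [Int.cast_sub, ← h]; push_cast; ring
      rw [this, Int.fract_intCast]
    · rw [h1] at h
      have : φ e0 = ((-D v + ∑ e ∈ Finset.univ.erase e0, inc src tgt v e * ⌊φ e⌋ : ℤ) : ℝ) := by
        rw [Int.cast_add, Int.cast_neg, ← h]; push_cast; ring
      rw [this, Int.fract_intCast]
  have hsum : ∑ v, d v = 2 * N.card := by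
    simp only [hd]
    rw [Finset.sum_add_distrib, ← Finset.card_eq_sum_card_fiberwise (fun _ _ => Finset.mem_univ _),
      ← Finset.card_eq_sum_card_fiberwise (fun _ _ => Finset.mem_univ _)]
    ring
  have hle : V'.card ≤ N.card := by
    have : ∑ v ∈ V', 2 ≤ ∑ v, d v := by
      refine (Finset.sum_le_sum (f := fun _ => 2) (g := d) fun v hv => ?_).trans
        (Finset.sum_le_sum_of_subset (Finset.subset_univ _))
      have : d v ≠ 0 := (Finset.mem_filter.1 hv).2
      have := hd1 v
      omega
    rw [hsum] at this
    simp at this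
    omega
  obtain ⟨e1, he1⟩ := hN
  have he1N : e1 ∈ N := by simpa [hNdef] using he1
  have hv0 : src e1 ∈ V' := by
    simp only [hV', Finset.mem_filter, Finset.mem_univ, true_and, hd]
    have : 0 < (N.filter (fun e => src e = src e1)).card :=
      Finset.card_pos.2 ⟨e1, Finset.mem_filter.2 ⟨he1N, rfl⟩⟩
    omega
  let ext : (N → ℝ) → E → ℝ := fun q e => if h : e ∈ N then q ⟨e, h⟩ else 0
  let L : (N → ℝ) →ₗ[ℝ] ((V'.erase (src e1) : Finset V) → ℝ) :=
    { toFun := fun q v => ∑ e : N, (inc src tgt v.1 e.1 : ℝ) * q e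
      map_add' := by
        intro q q'; ext v; simp [mul_add, Finset.sum_add_distrib]
      map_smul' := by
        intro c q; ext v
        simp only [Pi.smul_apply, smul_eq_mul, RingHom.id_apply, Finset.mul_sum]
        refine Finset.sum_congr rfl fun e _ => by ring }
  have hker : LinearMap.ker L ≠ ⊥ := by
    apply LinearMap.ker_ne_bot_of_finrank_lt
    simp only [Module.finrank_fintype_fun_eq_card, Fintype.card_coe]
    rw [Finset.card_erase_of_mem hv0]
    have : 0 < V'.card := Finset.card_pos.2 ⟨_, hv0⟩
    omega
  obtain ⟨q, hq, hq0⟩ := Submodule.exists_mem_ne_zero_of_ne_bot hker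
  have hsumext : ∀ v, ∑ e, (inc src tgt v e : ℝ) * ext q e = ∑ e : N, (inc src tgt v e.1 : ℝ) * q e := by
    intro v
    rw [← Finset.sum_subset (Finset.subset_univ N) (f := fun e => (inc src tgt v e : ℝ) * ext q e)]
    · rw [← Finset.sum_coe_sort N]
      refine Finset.sum_congr rfl fun e _ => ?_
      simp [ext]
    · intro e _ he; simp [ext, he]
  have hz : ∀ v, v ≠ src e1 → ∑ e, (inc src tgt v e : ℝ) * ext q e = 0 := by
    intro v hv
    rw [hsumext]
    by_cases hvV : v ∈ V'
    · have := congrFun (LinearMap.mem_ker.1 hq) ⟨v, Finset.mem_erase.2 ⟨hv, hvV⟩⟩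
      exact this
    · have h0 : d v = 0 := by simpa [hV'] using hvV
      simp only [hd, Nat.add_eq_zero_iff, Finset.card_eq_zero, Finset.filter_eq_empty_iff] at h0
      refine Finset.sum_eq_zero fun e _ => ?_
      simp [inc, h0.1 e.2, h0.2 e.2]
  have htot : ∑ v, ∑ e, (inc src tgt v e : ℝ) * ext q e = 0 := by
    rw [Finset.sum_comm]
    refine Finset.sum_eq_zero fun e _ => ?_
    rw [← Finset.sum_mul]
    simp [inc]
  refine ⟨ext q, ?_, ?_, ?_⟩
  · intro h
    apply hq0
    ext e
    have := congrFun h e.1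
    simpa [ext] using this
  · intro e he
    have : e ∉ N := by simp [hNdef, he]
    simp [ext, this]
  · intro v
    by_cases hv : v = src e1
    · rw [hv]
      rw [← htot, Finset.sum_eq_single (src e1)]
      · intro b _ hb; exact hz b hb
      · simp
    · exact hz v hv

theorem move_step (φ p : E → ℝ) (hp : p ≠ 0) (hsupp : ∀ e, Int.fract (φ e) = 0 → p e = 0) :
    ∃ t : ℝ, (∀ e, (⌊φ e⌋ : ℝ) ≤ φ e + t * p e ∧ φ e + t * p e ≤ ⌈φ e⌉) ∧
      ∃ e, Int.fract (φ e) ≠ 0 ∧ Int.fract (φ e + t * p e) = 0 := by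
  classical
  set P : Finset E := Finset.univ.filter (fun e => p e ≠ 0) with hP
  have hPne : P.Nonempty := by
    obtain ⟨e, he⟩ := Function.ne_iff.1 hp
    exact ⟨e, by simpa [hP] using he⟩
  let T : E → ℝ := fun e => if 0 < p e then (⌊φ e⌋ + 1 - φ e) / p e else (⌊φ e⌋ - φ e) / p e
  obtain ⟨e0, he0, hmin⟩ := Finset.exists_min_image P T hPne
  have hTpos : ∀ e ∈ P, 0 ≤ T e := by
    intro e he
    have h1 := Int.floor_le (φ e)
    have h2 := Int.lt_floor_add_one (φ e)
    simp only [T]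
    split_ifs with h
    · apply div_nonneg <;> linarith
    · apply div_nonneg_of_nonpos <;> linarith
  have hne : ∀ e, p e ≠ 0 → Int.fract (φ e) ≠ 0 := fun e h h' => h (hsupp e h')
  refine ⟨T e0, ?_, e0, ?_, ?_⟩
  · intro e
    by_cases hpe : p e = 0
    · rw [hpe, mul_zero, add_zero]; exact ⟨Int.floor_le _, Int.le_ceil _⟩
    · have hle := hmin e (by simpa [hP] using hpe)
      have h0 := hTpos e0 he0
      have h1 := Int.floor_le (φ e)
      have h2 := Int.lt_floor_add_one (φ e)
      have h3 : (⌈φ e⌉ : ℝ) = ⌊φ e⌋ + 1 := by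
        have hlt : (⌊φ e⌋ : ℝ) < φ e := lt_of_le_of_ne h1 (fun h => hne e hpe (by
          rw [Int.fract]; linarith))
        have : ⌈φ e⌉ = ⌊φ e⌋ + 1 := by
          rw [Int.ceil_eq_iff]; push_cast; constructor <;> linarith
        rw [this]; push_cast; ring
      rw [h3]
      rcases lt_or_gt_of_ne hpe with hneg | hpos
      · have : T e = (⌊φ e⌋ - φ e) / p e := by simp [T, not_lt.2 hneg.le]
        have h5 : T e * p e = ⌊φ e⌋ - φ e := by rw [this]; field_simp
        have h6 : T e * p e ≤ T e0 * p e := mul_le_mul_of_nonpos_right hle hneg.le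
        have h7 : T e0 * p e ≤ 0 := mul_nonpos_of_nonneg_of_nonpos h0 hneg.le
        constructor <;> linarith
      · have : T e = (⌊φ e⌋ + 1 - φ e) / p e := by simp [T, hpos]
        have h5 : T e * p e = ⌊φ e⌋ + 1 - φ e := by rw [this]; field_simp
        have h6 : T e0 * p e ≤ T e * p e := mul_le_mul_of_nonneg_right hle hpos.le
        have h7 : 0 ≤ T e0 * p e := mul_nonneg h0 hpos.le
        constructor <;> linarith
  · exact hne e0 (by simpa [hP] using he0)
  · have hpe : p e0 ≠ 0 := by simpa [hP] using he0
    have : ∃ z : ℤ, φ e0 + T e0 * p e0 = z := by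
      simp only [T]
      split_ifs with h
      · exact ⟨⌊φ e0⌋ + 1, by field_simp; push_cast; ring⟩
      · exact ⟨⌊φ e0⌋, by field_simp; ring⟩
    obtain ⟨z, hz⟩ := this
    rw [hz, Int.fract_intCast]

theorem finite_round (src tgt : E → V) (D : V → ℤ) (k : ℕ) : ∀ (φ : E → ℝ)
    (_ : (Finset.univ.filter (fun e => Int.fract (φ e) ≠ 0)).card = k)
    (_ : ∀ v, ∑ e, (inc src tgt v e : ℝ) * φ e = D v),
    ∃ z : E → ℤ, (∀ e, ⌊φ e⌋ ≤ z e ∧ z e ≤ ⌈φ e⌉) ∧ ∀ v, ∑ e, inc src tgt v e * z e = D v := by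
  classical
  induction k using Nat.strong_induction_on with
  | _ k ih =>
  intro φ hk hdiv
  by_cases hN : ∃ e, Int.fract (φ e) ≠ 0
  · obtain ⟨p, hp0, hsupp, hpdiv⟩ := exists_kernel src tgt φ D hdiv hN
    obtain ⟨t, hb, e0, he0, he0'⟩ := move_step φ p hp0 hsupp
    obtain ⟨z, hz, hzd⟩ := ih _ (by
        rw [← hk]
        apply Finset.card_lt_card
        rw [Finset.ssubset_iff_of_subset]
        · exact ⟨e0, by simpa using he0, by simpa using he0'⟩
        · intro e he
          simp only [Finset.mem_filter, Finset.mem_univ, true_and] at he ⊢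
          intro h
          rw [hsupp e h, mul_zero, add_zero] at he
          exact he h) (fun e => φ e + t * p e) rfl (by
        intro v
        have : ∑ e, (inc src tgt v e : ℝ) * (φ e + t * p e) =
          ∑ e, (inc src tgt v e : ℝ) * φ e + t * ∑ e, (inc src tgt v e : ℝ) * p e := by
          rw [Finset.mul_sum, ← Finset.sum_add_distrib]
          exact Finset.sum_congr rfl fun e _ => by ring
        rw [this, hdiv, hpdiv]; simp)
    refine ⟨z, fun e => ⟨?_, ?_⟩, hzd⟩
    · exact le_trans (Int.le_floor.2 (hb e).1) (hz e).1
    · exact le_trans (hz e).2 (Int.ceil_le.2 (hb e).2)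
  · push Not at hN
    have hfl : ∀ e, (⌊φ e⌋ : ℝ) = φ e := fun e => by
      have := Int.floor_add_fract (φ e); rw [hN e, add_zero] at this; exact this
    refine ⟨fun e => ⌊φ e⌋, fun e => ⟨le_rfl, Int.floor_le_ceil _⟩, fun v => ?_⟩
    have h2 : ∑ e, (inc src tgt v e : ℝ) * (⌊φ e⌋ : ℝ) = D v := by
      rw [← hdiv v]
      exact Finset.sum_congr rfl fun e _ => by rw [hfl]
    exact_mod_cast h2

end rounding
end BDE

namespace BDE

section toast

theorem sum_measure_ge {Ω ι : Type} [MeasurableSpace Ω] (m : Measure Ω) [IsFiniteMeasure m]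
    (T : Finset ι) (A : ι → Set Ω) (hA : ∀ t, MeasurableSet (A t)) (k : ℕ) [∀ x, DecidablePred (fun t => x ∈ A t)]
    (h : ∀ x, k ≤ (T.filter (fun t => x ∈ A t)).card) :
    (k : ℝ) * m.real Set.univ ≤ ∑ t ∈ T, m.real (A t) := by
  have e : ∀ t, m.real (A t) = ∫ x, (A t).indicator (fun _ => (1 : ℝ)) x ∂m := by
    intro t; rw [integral_indicator (hA t)]; simp
  have hintg : ∀ t, Integrable ((A t).indicator (fun _ => (1 : ℝ))) m := fun t =>
    (integrable_const 1).indicator (hA t)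
  simp_rw [e]
  rw [← integral_finsetSum _ (fun t _ => hintg t)]
  have : (k : ℝ) * m.real Set.univ = ∫ _, (k : ℝ) ∂m := by simp [mul_comm]
  rw [this]
  refine integral_mono (integrable_const _) (integrable_finsetSum _ fun t _ => hintg t) fun x => ?_
  have : ∑ t ∈ T, (A t).indicator (fun _ => (1 : ℝ)) x = (T.filter (fun t => x ∈ A t)).card := by
    rw [Finset.card_filter]; push_cast
    refine Finset.sum_congr rfl fun t _ => ?_
    by_cases hx : x ∈ A t <;> simp [hx]
  simp only [this]
  exact_mod_cast h x

theorem sum_measure_le {Ω ι : Type} [MeasurableSpace Ω] (m : Measure Ω) [IsFiniteMeasure m]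
    (T : Finset ι) (A : ι → Set Ω) (hA : ∀ t, MeasurableSet (A t)) (k : ℝ) [∀ x, DecidablePred (fun t => x ∈ A t)]
    (h : ∀ x, ((T.filter (fun t => x ∈ A t)).card : ℝ) ≤ k) :
    ∑ t ∈ T, m.real (A t) ≤ k * m.real Set.univ := by
  have e : ∀ t, m.real (A t) = ∫ x, (A t).indicator (fun _ => (1 : ℝ)) x ∂m := by
    intro t; rw [integral_indicator (hA t)]; simp
  have hintg : ∀ t, Integrable ((A t).indicator (fun _ => (1 : ℝ))) m := fun t =>
    (integrable_const 1).indicator (hA t)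
  simp_rw [e]
  rw [← integral_finsetSum _ (fun t _ => hintg t)]
  have : (k : ℝ) * m.real Set.univ = ∫ _, (k : ℝ) ∂m := by simp [mul_comm]
  rw [this]
  refine integral_mono (integrable_finsetSum _ fun t _ => hintg t) (integrable_const _) fun x => ?_
  have : ∑ t ∈ T, (A t).indicator (fun _ => (1 : ℝ)) x = (T.filter (fun t => x ∈ A t)).card := by
    rw [Finset.card_filter]; push_cast
    refine Finset.sum_congr rfl fun t _ => ?_
    by_cases hx : x ∈ A t <;> simp [hx]
  simp only [this]
  exact h x

theorem pick {ι : Type} (T : Finset ι) (hT : T.Nonempty) (a b : ι → ℝ) (M c ε : ℝ) (hM : 0 ≤ M)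
    (hc : 0 < c) (hc1 : c ≤ 1) (hε : 0 < ε) (ha0 : ∀ t, 0 ≤ a t) (ha : ∀ t, a t ≤ M) (hb : ∀ t, 0 ≤ b t)
    (hA : c * M * T.card ≤ ∑ t ∈ T, a t) (hB : ∑ t ∈ T, b t ≤ ε * c / 2 * T.card) :
    ∃ t ∈ T, c * M / 2 ≤ a t ∧ b t ≤ ε := by
  have hTc : (0 : ℝ) < T.card := by exact_mod_cast Finset.card_pos.2 hT
  rcases hM.eq_or_lt with h0 | hpos
  · have : ∃ t ∈ T, b t ≤ ε * c / 2 := by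
      apply Finset.exists_le_of_sum_le hT
      simpa [mul_comm] using hB
    obtain ⟨t, ht, hbt⟩ := this
    refine ⟨t, ht, ?_, ?_⟩
    · rw [← h0]; simpa using ha0 t
    · nlinarith
  · have : ∃ t ∈ T, c * M / 2 ≤ a t - M / ε * b t := by
      apply Finset.exists_le_of_sum_le hT
      rw [Finset.sum_sub_distrib, ← Finset.mul_sum]
      have h1 : M / ε * ∑ t ∈ T, b t ≤ M / ε * (ε * c / 2 * T.card) :=
        mul_le_mul_of_nonneg_left hB (by positivity)
      have h2 : M / ε * (ε * c / 2 * T.card) = c * M / 2 * T.card := by field_simp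
      simp only [Finset.sum_const, nsmul_eq_mul]
      linarith
    obtain ⟨t, ht, h⟩ := this
    have h3 : 0 ≤ M / ε * b t := mul_nonneg (by positivity) (hb t)
    refine ⟨t, ht, by linarith, ?_⟩
    have h4 : M / ε * b t ≤ M := by
      have := ha t
      have : 0 ≤ c * M / 2 := by positivity
      linarith
    rw [div_mul_eq_mul_div, div_le_iff₀ hε] at h4
    exact le_of_mul_le_mul_left h4 hpos

variable {J : Type} [Fintype J] [DecidableEq J] {Ω : Type} [MeasurableSpace Ω]
  [AddAction (J → ℤ) Ω]

/-- points having a point of `V` at an offset from `F` -/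
def near (F : Finset (J → ℤ)) (V : Set Ω) : Set Ω := {x | ∃ g ∈ F, g +ᵥ x ∈ V}

theorem measurable_near (hm : ∀ g : J → ℤ, Measurable (fun x : Ω => g +ᵥ x)) (F : Finset (J → ℤ))
    {V : Set Ω} (hV : MeasurableSet V) : MeasurableSet (near F V) := by
  have : near F V = ⋃ g ∈ F, (fun x => g +ᵥ x) ⁻¹' V := by ext x; simp [near]
  rw [this]
  exact Finset.measurableSet_biUnion _ fun g _ => hm g hV

/-- colouring hypothesis -/
def HasCol (J Ω : Type) [Fintype J] [DecidableEq J] [MeasurableSpace Ω] [AddAction (J → ℤ) Ω] : Prop :=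
  ∀ s : ℤ, ∃ c : Ω → ℕ, Measurable c ∧ ∀ x, ∀ g ∈ Q J s, g ≠ 0 → c (g +ᵥ x) ≠ c x

theorem step_lemma (hm : ∀ g : J → ℤ, Measurable (fun x : Ω => g +ᵥ x)) (hcol : HasCol J Ω)
    (m ν : Measure Ω) [IsFiniteMeasure m] [IsFiniteMeasure ν] (w : ℤ) (hw : 0 ≤ w) (ε : ℝ) (hε : 0 < ε) :
    ∃ ρ : ℤ, w + 5 ≤ ρ ∧ ∃ V : Set Ω, MeasurableSet V ∧
      (∀ x ∈ V, ∀ g ∈ Q J (2 * (ρ + w)), g +ᵥ x ∈ V → g = 0) ∧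
      ((1 / 17 : ℝ) ^ Fintype.card J / 2 * m.real Set.univ ≤ m.real (near (Q J (ρ - 1)) V)) ∧
      ν.real (near (S J ρ w) V) ≤ ε := by
  classical
  set r := Fintype.card J with hr
  set c : ℝ := (1 / 17 : ℝ) ^ r with hc
  have hcpos : 0 < c := by positivity
  have hc1 : c ≤ 1 := pow_le_one₀ (by norm_num) (by norm_num)
  -- choose ρ
  obtain ⟨ρ₀, hρ₀⟩ := shell_small (J := J) w hw (7 ^ r * ν.real Set.univ / (ε * c / 2))
  set ρ := max ρ₀ (w + 5) with hρ
  have hρw : w + 5 ≤ ρ := le_max_right _ _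
  have hsh := hρ₀ ρ (le_max_left _ _)
  set s := 2 * (ρ + w) with hs
  obtain ⟨col, hcolm, hcol⟩ := hcol s
  obtain ⟨V0, hV0, hsep, hdense⟩ := markers hm s (by omega) col hcolm hcol
  let Vt : (J → ℤ) → Set Ω := fun t => {x | t +ᵥ x ∈ V0}
  have hVt : ∀ t, MeasurableSet (Vt t) := fun t => hm t hV0
  have hsepx : ∀ x : Ω, ∀ p q : J → ℤ, p +ᵥ x ∈ V0 → q +ᵥ x ∈ V0 → q - p ∈ Q J s → p = q := by
    intro x p q hp hq hpq
    have := hsep (p +ᵥ x) hp (q - p) hpq (by rwa [vadd_vadd, sub_add_cancel])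
    exact (sub_eq_zero.1 this).symm
  set T := Q J (2 * s) with hT
  have hTne : T.Nonempty := ⟨0, Q_zero_mem (by omega)⟩
  have hpick := pick T hTne (fun t => m.real (near (Q J (ρ - 1)) (Vt t)))
    (fun t => ν.real (near (S J ρ w) (Vt t))) (m.real Set.univ) c ε measureReal_nonneg hcpos hc1 hε
    (fun t => measureReal_nonneg) (fun t => measureReal_mono (Set.subset_univ _))
    (fun t => measureReal_nonneg) ?_ ?_
  · obtain ⟨t, ht, h1, h2⟩ := hpick
    refine ⟨ρ, hρw, Vt t, hVt t, ?_, by convert h1 using 1; ring, h2⟩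
    intro x hx g hg hgx
    have := hsep (t +ᵥ x) hx g hg (by
      have hgx' : t +ᵥ (g +ᵥ x) ∈ V0 := hgx
      rwa [vadd_comm] at hgx')
    exact this
  · -- cover
    have hcount : ∀ x, (Q J (ρ - 1)).card ≤ (T.filter (fun t => x ∈ near (Q J (ρ - 1)) (Vt t))).card := by
      intro x
      obtain ⟨p, hp, hpx⟩ := hdense x
      refine Finset.card_le_card_of_injOn (fun g => p - g) ?_ ?_
      · intro g hg
        simp only [Finset.mem_coe, Finset.mem_filter] at hg ⊢
        refine ⟨Q_mono (by omega) (Q_sub_mem hp hg), g, hg, ?_⟩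
        change (p - g) +ᵥ (g +ᵥ x) ∈ V0
        rwa [vadd_vadd, sub_add_cancel]
      · intro g _ h _ e
        exact sub_right_injective e
    refine le_trans ?_ (sum_measure_ge m T _ (fun t => measurable_near hm _ (hVt t)) _ hcount)
    have h1 : c * T.card ≤ (Q J (ρ - 1)).card := by
      have e1 : ((Q J (ρ - 1)).card : ℝ) = (2 * (ρ - 1) + 1 : ℝ) ^ r := by
        have := card_Q (J := J) (ρ := ρ - 1) (by omega)
        exact_mod_cast this
      have e2 : (T.card : ℝ) = (2 * (2 * s) + 1 : ℝ) ^ r := by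
        have := card_Q (J := J) (ρ := 2 * s) (by omega)
        exact_mod_cast this
      rw [e1, e2, hc, ← mul_pow]
      have hρR : (w : ℝ) + 5 ≤ ρ := by exact_mod_cast hρw
      have hwR : (0 : ℝ) ≤ w := by exact_mod_cast hw
      have hsR : (s : ℝ) = 2 * (ρ + w) := by rw [hs]; push_cast; ring
      apply pow_le_pow_left₀
      · rw [hsR]; linarith
      · rw [hsR]; linarith
    have := measureReal_nonneg (μ := m) (s := Set.univ)
    nlinarith
  · -- shell
    have hcount : ∀ x, ((T.filter (fun t => x ∈ near (S J ρ w) (Vt t))).card : ℝ) ≤ 7 ^ r * (S J ρ w).card := by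
      intro x
      set P := (Q J (2 * s + (ρ + w))).filter (fun p => p +ᵥ x ∈ V0) with hP
      have hPcard := packing (P := P) (a := ρ + w) (b := 2 * s + (ρ + w)) (Finset.filter_subset _ _) (by
        intro p hp q hq hpq
        exact hsepx x p q (Finset.mem_filter.1 hp).2 (Finset.mem_filter.1 hq).2 hpq)
      have hsub : T.filter (fun t => x ∈ near (S J ρ w) (Vt t)) ⊆
          (P ×ˢ S J ρ w).image (fun y => y.1 - y.2) := by
        intro t ht
        obtain ⟨htT, h, hh, hx⟩ := Finset.mem_filter.1 ht
        have hx' : t +ᵥ (h +ᵥ x) ∈ V0 := hx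
        rw [vadd_vadd] at hx'
        refine Finset.mem_image.2 ⟨(t + h, h), ?_, by simp⟩
        refine Finset.mem_product.2 ⟨Finset.mem_filter.2 ⟨?_, hx'⟩, hh⟩
        exact Q_add_mem htT (S_subset hh)
      have h1 := (Finset.card_le_card hsub).trans Finset.card_image_le
      rw [Finset.card_product] at h1
      have h2 : (P.card : ℝ) ≤ 7 ^ r := by
        have e1 : ((Q J (ρ + w)).card : ℝ) = (2 * (ρ + w) + 1 : ℝ) ^ r := by
          have := card_Q (J := J) (ρ := ρ + w) (by omega)
          exact_mod_cast this
        have e2 : ((Q J (ρ + w + (2 * s + (ρ + w)))).card : ℝ) = (2 * (ρ + w + (2 * s + (ρ + w))) + 1 : ℝ) ^ r := by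
          have := card_Q (J := J) (ρ := ρ + w + (2 * s + (ρ + w))) (by omega)
          exact_mod_cast this
        have e3 : (P.card : ℝ) * (Q J (ρ + w)).card ≤ (Q J (ρ + w + (2 * s + (ρ + w)))).card := by
          exact_mod_cast hPcard
        rw [e1, e2] at e3
        have hρR : (w : ℝ) + 5 ≤ ρ := by exact_mod_cast hρw
        have hwR : (0 : ℝ) ≤ w := by exact_mod_cast hw
        have hsR : (s : ℝ) = 2 * (ρ + w) := by rw [hs]; push_cast; ring
        have e4 : (2 * (ρ + w + (2 * s + (ρ + w))) + 1 : ℝ) ^ r ≤ (7 * (2 * (ρ + w) + 1)) ^ r := by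
          apply pow_le_pow_left₀
          · rw [hsR]; linarith
          · rw [hsR]; linarith
        rw [mul_pow] at e4
        have e5 : (0 : ℝ) < (2 * (ρ + w) + 1 : ℝ) ^ r := by
          apply pow_pos; linarith
        exact le_of_mul_le_mul_right (e3.trans e4) e5
      calc ((T.filter (fun t => x ∈ near (S J ρ w) (Vt t))).card : ℝ) ≤ P.card * (S J ρ w).card := by
            exact_mod_cast h1
        _ ≤ _ := by gcongr
    refine (sum_measure_le ν T _ (fun t => measurable_near hm _ (hVt t)) _ hcount).trans ?_
    have h1 : ((Q J ρ).card : ℝ) ≤ T.card := by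
      exact_mod_cast Finset.card_le_card (Q_mono (by omega))
    have hpos : 0 < ε * c / 2 := by positivity
    have h2 := hsh.trans h1
    rw [div_mul_eq_mul_div, div_le_iff₀ hpos] at h2
    linarith

end toast
end BDE

namespace BDE

section toast2
variable {J : Type} [Fintype J] [DecidableEq J] {Ω : Type} [MeasurableSpace Ω]
  [AddAction (J → ℤ) Ω]

theorem half_measure_props (m : Measure Ω) [IsFiniteMeasure m] (C : Set Ω) (hC : MeasurableSet C) (c : ℝ)
    (h : c * m.real Set.univ ≤ m.real C) :
    (m.restrict Cᶜ + (2⁻¹ : NNReal) • m.restrict C).real Set.univ ≤ (1 - c / 2) * m.real Set.univ := by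
  rw [measureReal_add_apply]
  have e : ((2⁻¹ : NNReal) • m.restrict C).real Set.univ = 2⁻¹ * m.real C := by
    rw [measureReal_nnreal_smul_apply]; simp
  rw [e]
  simp only [measureReal_restrict_apply MeasurableSet.univ, Set.univ_inter]
  have := measureReal_add_measureReal_compl (μ := m) hC
  nlinarith

theorem toast_raw (hm : ∀ g : J → ℤ, Measurable (fun x : Ω => g +ᵥ x)) (hcol : HasCol J Ω)
    (ν : Measure Ω) [IsFiniteMeasure ν] :
    ∃ (ρ w : ℕ → ℤ) (V : ℕ → Set Ω), (∀ k, 0 ≤ w k ∧ w k + 5 ≤ ρ k) ∧ (∀ k, 10 ≤ w k) ∧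
      (∀ j k, j < k → 2 * ρ j + 10 ≤ w k) ∧
      (∀ k, MeasurableSet (V k)) ∧
      (∀ k, ∀ x ∈ V k, ∀ g ∈ Q J (2 * (ρ k + w k)), g +ᵥ x ∈ V k → g = 0) ∧
      (∀ k0, ν (⋂ j ∈ Set.Ici k0, (near (Q J (ρ j - 1)) (V j))ᶜ) = 0) ∧
      (∀ k, ν.real (near (S J (ρ k) (w k)) (V k)) ≤ (1 / 2) ^ k) := by
  classical
  set c : ℝ := (1 / 17 : ℝ) ^ Fintype.card J / 2 with hc
  have hcpos : 0 < c := by positivity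
  have hc1 : c ≤ 1 := by
    have : (1 / 17 : ℝ) ^ Fintype.card J ≤ 1 := pow_le_one₀ (by norm_num) (by norm_num)
    linarith
  have hstep : ∀ (k : ℕ) (w : ℤ) (m : Measure Ω), ∃ (ρ : ℤ) (V : Set Ω), 0 ≤ w → IsFiniteMeasure m →
      w + 5 ≤ ρ ∧ MeasurableSet V ∧
      (∀ x ∈ V, ∀ g ∈ Q J (2 * (ρ + w)), g +ᵥ x ∈ V → g = 0) ∧
      (c * m.real Set.univ ≤ m.real (near (Q J (ρ - 1)) V)) ∧
      ν.real (near (S J ρ w) V) ≤ (1 / 2) ^ k := by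
    intro k w m
    by_cases h : 0 ≤ w ∧ IsFiniteMeasure m
    · obtain ⟨h1, h2⟩ := h
      obtain ⟨ρ, a, V, b⟩ := step_lemma hm hcol m ν w h1 ((1 / 2) ^ k) (by positivity)
      exact ⟨ρ, V, fun _ _ => ⟨a, b⟩⟩
    · exact ⟨0, ∅, fun h1 h2 => absurd ⟨h1, h2⟩ h⟩
  choose fρ fV hf using hstep
  let nxt : ℕ → ℤ × Measure Ω → ℤ × Measure Ω := fun k st =>
    let w := 2 * st.1 + 10
    let C := near (Q J (fρ k w st.2 - 1)) (fV k w st.2)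
    (fρ k w st.2, st.2.restrict Cᶜ + (2⁻¹ : NNReal) • st.2.restrict C)
  let st : ℕ → ℤ × Measure Ω := fun k => Nat.rec (0, ν) nxt k
  have hst : ∀ k, st (k + 1) = nxt k (st k) := fun k => rfl
  set w : ℕ → ℤ := fun k => 2 * (st k).1 + 10 with hw
  set ρ : ℕ → ℤ := fun k => fρ k (w k) (st k).2 with hρ
  set V : ℕ → Set Ω := fun k => fV k (w k) (st k).2 with hV
  set C : ℕ → Set Ω := fun k => near (Q J (ρ k - 1)) (V k) with hC
  have hst1 : ∀ k, (st (k + 1)).1 = ρ k := fun k => rfl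
  have hst2 : ∀ k, (st (k + 1)).2 = (st k).2.restrict (C k)ᶜ + (2⁻¹ : NNReal) • (st k).2.restrict (C k) :=
    fun k => rfl
  have inv : ∀ k, 0 ≤ (st k).1 ∧ IsFiniteMeasure (st k).2 := by
    intro k
    induction k with
    | zero => exact ⟨le_rfl, by change IsFiniteMeasure ν; infer_instance⟩
    | succ k ih =>
      obtain ⟨h1, h2⟩ := ih
      have h3 : 0 ≤ w k := by simp only [hw]; omega
      have := (hf k (w k) (st k).2 h3 h2).1
      refine ⟨by rw [hst1]; simp only [hρ]; omega, ?_⟩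
      rw [hst2]; infer_instance
  have hprop := fun k => hf k (w k) (st k).2 (by have := (inv k).1; simp only [hw]; omega) (inv k).2
  have hρw : ∀ k, w k + 5 ≤ ρ k := fun k => (hprop k).1
  have hw10 : ∀ k, 10 ≤ w k := fun k => by have := (inv k).1; simp only [hw]; omega
  have hwρ : ∀ k, w (k + 1) = 2 * ρ k + 10 := fun k => rfl
  have hwmono : Monotone w := monotone_nat_of_le_succ fun k => by
    have := hρw k; have := hw10 k; rw [hwρ]; omega
  have hVm : ∀ k, MeasurableSet (V k) := fun k => (hprop k).2.1
  have hCm : ∀ k, MeasurableSet (C k) := fun k => measurable_near hm _ (hVm k)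
  refine ⟨ρ, w, V, fun k => ⟨by have := hw10 k; omega, hρw k⟩, hw10, ?_, hVm,
    fun k => (hprop k).2.2.1, ?_, fun k => (hprop k).2.2.2.2⟩
  · intro j k hjk
    have := hwmono (show j + 1 ≤ k from hjk)
    rw [hwρ] at this; exact this
  · intro k0
    set A := ⋂ j ∈ Set.Ici k0, (C j)ᶜ with hA
    have hAm : MeasurableSet A := MeasurableSet.biInter (Set.to_countable _) fun j _ => (hCm j).compl
    have hdec : ∀ k, (st k).2.real Set.univ ≤ (1 - c / 2) ^ k * ν.real Set.univ := by
      intro k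
      induction k with
      | zero => simp [st]
      | succ k ih =>
        haveI := (inv k).2
        rw [hst2]
        refine (half_measure_props _ _ (hCm k) c (hprop k).2.2.2.1).trans ?_
        rw [pow_succ', mul_assoc]
        exact mul_le_mul_of_nonneg_left ih (by linarith)
    have hconst : ∀ n, (st (k0 + n)).2 A = (st k0).2 A := by
      intro n
      induction n with
      | zero => rfl
      | succ n ih =>
        rw [← add_assoc, hst2, ← ih]
        have hsub : A ⊆ (C (k0 + n))ᶜ := Set.biInter_subset_of_mem (show k0 + n ∈ Set.Ici k0 by simp)
        rw [Measure.add_apply, Measure.smul_apply, Measure.restrict_apply hAm, Measure.restrict_apply hAm,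
          Set.inter_eq_left.2 hsub]
        have : A ∩ C (k0 + n) = ∅ := by
          ext x; constructor
          · rintro ⟨h1, h2⟩; exact (hsub h1 h2).elim
          · simp
        simp [this]
    have hlim : Filter.Tendsto (fun n : ℕ => (1 - c / 2) ^ (k0 + n) * ν.real Set.univ) Filter.atTop (nhds 0) := by
      have h1 : Filter.Tendsto (fun n : ℕ => (1 - c / 2) ^ n * ν.real Set.univ) Filter.atTop (nhds (0 * ν.real Set.univ)) :=
        (tendsto_pow_atTop_nhds_zero_of_lt_one (by linarith) (by linarith)).mul_const _
      rw [zero_mul] at h1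
      have h2 := h1.comp (Filter.tendsto_add_atTop_nat k0)
      refine h2.congr fun n => ?_
      simp [add_comm]
    have hzero : (st k0).2.real A ≤ 0 := by
      refine ge_of_tendsto' hlim fun n => ?_
      have h1 : (st k0).2.real A = (st (k0 + n)).2.real A := by
        rw [Measure.real, Measure.real, hconst]
      rw [h1]
      haveI := (inv (k0 + n)).2
      exact (measureReal_mono (Set.subset_univ _)).trans (hdec _)
    have hzero' : (st k0).2 A = 0 := by
      haveI := (inv k0).2
      have := le_antisymm hzero measureReal_nonneg
      rwa [measureReal_eq_zero_iff] at this
    have hback : ∀ k, (st k).2 A = 0 → ν A = 0 := by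
      intro k
      induction k with
      | zero => exact id
      | succ k ih =>
        intro h
        apply ih
        rw [hst2, Measure.add_apply, Measure.smul_apply, Measure.restrict_apply hAm, Measure.restrict_apply hAm] at h
        have h1 := (add_eq_zero.1 h).1
        have h2 := (add_eq_zero.1 h).2
        have h3 : (st k).2 (A ∩ C k) = 0 := by
          rw [ENNReal.smul_def, smul_eq_mul, mul_eq_zero] at h2
          rcases h2 with h2 | h2
          · simp at h2
          · exact h2
        rw [← Set.inter_union_compl A (C k)]
        exact measure_union_null h3 h1
    exact hback k0 hzero'

theorem toast (hm : ∀ g : J → ℤ, Measurable (fun x : Ω => g +ᵥ x)) (hcol : HasCol J Ω)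
    (ν : Measure Ω) [IsFiniteMeasure ν] :
    ∃ (ρ : ℕ → ℤ) (V : ℕ → Set Ω), (∀ k, 5 ≤ ρ k) ∧ (∀ k, MeasurableSet (V k)) ∧
      (∀ k, ∀ x ∈ V k, ∀ g ∈ Q J (2 * (ρ k + 3)), g +ᵥ x ∈ V k → g = 0) ∧
      (∀ j k, ∀ x ∈ V j, ∀ z ∈ V k, ∀ g ∈ S J (ρ j) 3, ∀ h ∈ S J (ρ k) 3, g +ᵥ x = h +ᵥ z → j = k ∧ g = h) ∧
      (∀ᵐ x ∂ν, ∃ k, ∃ g ∈ Q J (ρ k - 1), g +ᵥ x ∈ V k) := by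
  obtain ⟨ρ, w, V, hρw, hw10, hww, hVm, hsep, hcov, hsh⟩ := toast_raw hm hcol ν
  let bad : ℕ → Set Ω := fun k => ⋃ j ∈ Set.Ioi k, ⋃ g ∈ Q J (ρ k + 3),
    (fun x => g +ᵥ x) ⁻¹' (near (S J (ρ j) 3) (V j))
  have hbadm : ∀ k, MeasurableSet (bad k) := fun k =>
    MeasurableSet.biUnion (Set.to_countable _) fun j _ =>
      Finset.measurableSet_biUnion _ fun g _ => hm g (measurable_near hm _ (hVm j))
  have hmembad : ∀ k x j, k < j → ∀ g ∈ Q J (ρ k + 3), ∀ h ∈ S J (ρ j) 3, h +ᵥ (g +ᵥ x) ∈ V j → x ∈ bad k := by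
    intro k x j hkj g hg h hh hx
    simp only [bad, Set.mem_iUnion]
    exact ⟨j, hkj, g, hg, h, hh, hx⟩
  have hlt : ∀ j k, j < k → ∀ x ∈ V j \ bad j, ∀ z ∈ V k, ∀ g ∈ S J (ρ j) 3, ∀ h ∈ S J (ρ k) 3,
      g +ᵥ x = h +ᵥ z → False := by
    intro j k hjk x hx z hz g hg h hh e
    refine hx.2 (hmembad j x k hjk g (S_subset hg) (-h) (S_neg_mem hh) ?_)
    rw [e, neg_vadd_vadd]; exact hz
  refine ⟨ρ, fun k => V k \ bad k, fun k => by have := (hρw k); omega, fun k => (hVm k).diff (hbadm k),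
    ?_, ?_, ?_⟩
  · intro k x hx g hg hgx
    exact hsep k x hx.1 g (Q_mono (by have := hw10 k; omega) hg) hgx.1
  · intro j k x hx z hz g hg h hh e
    have hjk : j = k := by
      rcases lt_trichotomy j k with h1 | h1 | h1
      · exact (hlt j k h1 x hx z hz.1 g hg h hh e).elim
      · exact h1
      · exact (hlt k j h1 z hz x hx.1 h hh g hg e.symm).elim
    subst hjk
    refine ⟨rfl, ?_⟩
    have := hsep j x hx.1 (-h + g) (by
      have := Q_add_mem (Q_neg_mem (S_subset hh)) (S_subset hg)
      exact Q_mono (by have := hw10 j; omega) this) (by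
      rw [← vadd_vadd, e, neg_vadd_vadd]; exact hz.1)
    exact (neg_add_eq_zero.1 this).symm
  · have hBC : ∀ᵐ x ∂ν, ∀ᶠ k in Filter.atTop, x ∉ near (S J (ρ k) (w k)) (V k) := by
      apply ae_eventually_notMem
      have : ∀ k, ν (near (S J (ρ k) (w k)) (V k)) ≤ ENNReal.ofReal ((1 / 2) ^ k) := by
        intro k
        rw [← ofReal_measureReal]
        exact ENNReal.ofReal_le_ofReal (hsh k)
      refine ne_top_of_le_ne_top ?_ (ENNReal.tsum_le_tsum this)
      rw [← ENNReal.ofReal_tsum_of_nonneg (fun k => by positivity) summable_geometric_two]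
      exact ENNReal.ofReal_ne_top
    have hInOut : ∀ᵐ x ∂ν, ∀ k0, ∃ j ≥ k0, x ∈ near (Q J (ρ j - 1)) (V j) := by
      rw [ae_all_iff]
      intro k0
      have := hcov k0
      rw [measure_eq_zero_iff_ae_notMem] at this
      filter_upwards [this] with x hx
      simp only [Set.mem_iInter, Set.mem_compl_iff] at hx
      push Not at hx
      obtain ⟨j, hj, hjx⟩ := hx
      exact ⟨j, hj, hjx⟩
    filter_upwards [hBC, hInOut] with x h1 h2
    obtain ⟨k0, hk0⟩ := Filter.eventually_atTop.1 h1
    obtain ⟨k, hk, g, hg, hgx⟩ := h2 k0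
    refine ⟨k, g, hg, hgx, ?_⟩
    intro hb
    simp only [bad, Set.mem_iUnion] at hb
    obtain ⟨j, hj, g', hg', h, hh, hx⟩ := hb
    have hjk : k < j := hj
    refine hk0 j (by omega) ⟨h + (g' + g), ?_, ?_⟩
    · have := S_add_mem hh (Q_add_mem hg' hg)
      exact S_mono (by have := hww k j hjk; omega) this
    · rwa [← vadd_vadd, ← vadd_vadd]

end toast2
end BDE

namespace BDE

section phaseA
variable {J : Type} [Fintype J] [DecidableEq J]

/-- unit vector -/
def ev (i : J) : J → ℤ := Pi.single i 1

theorem ev_self (i : J) : ev i i = 1 := by simp [ev]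
theorem ev_ne {i j : J} (h : j ≠ i) : ev i j = 0 := by simp [ev, h]
theorem ev_ne_zero (i : J) : ev i ≠ 0 := fun h => by
  have := congrFun h i; simp [ev_self] at this

theorem ev_inj {i j : J} (h : ev i = ev j) : i = j := by
  by_contra hne
  have := congrFun h i
  rw [ev_self, ev_ne hne] at this
  exact one_ne_zero this

/-- outward sign of the edge from `g` to `g + ev i` relative to the cube -/
noncomputable def sg (ρ : ℤ) (g : J → ℤ) (i : J) : ℤ :=
  (if g ∈ Q J ρ then 1 else 0) - (if g + ev i ∈ Q J ρ then 1 else 0)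

/-- discrete curl of square corrections -/
def curl {R : Type} [AddCommGroup R] (n : J → J → (J → ℤ) → R) (i : J) (g : J → ℤ) : R :=
  ∑ j, ((n i j g - n i j (g - ev j)) - (n j i g - n j i (g - ev j)))

theorem sg_cases (ρ : ℤ) (g : J → ℤ) (i : J) : sg ρ g i = 0 ∨ sg ρ g i = 1 ∨ sg ρ g i = -1 := by
  unfold sg; split_ifs <;> simp

theorem ev_mem_Q (i : J) : ev i ∈ Q J 1 := by
  rw [mem_Q]; intro k
  by_cases h : k = i
  · subst h; rw [ev_self]; omega
  · rw [ev_ne h]; omega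

theorem cut_mem_S {ρ : ℤ} {g : J → ℤ} {i : J} (h : sg ρ g i ≠ 0) : g ∈ S J ρ 1 := by
  rw [mem_S]
  unfold sg at h
  constructor
  · by_contra hc
    apply h
    have h1 : g ∉ Q J ρ := fun hh => hc (Q_mono (by omega) hh)
    have h2 : g + ev i ∉ Q J ρ := fun hh => hc (by
      have := Q_sub_mem hh (ev_mem_Q i); rwa [add_sub_cancel_right] at this)
    simp [h1, h2]
  · intro hc
    apply h
    have h1 : g ∈ Q J ρ := Q_mono (by omega) hc
    have h2 : g + ev i ∈ Q J ρ := Q_mono (by omega) (Q_add_mem hc (ev_mem_Q i))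
    simp [h1, h2]

/-- the two cut edges are connected by squares near the boundary -/
def Rel (ρ : ℤ) (e e' : (J → ℤ) × J) : Prop :=
  ∃ n : J → J → (J → ℤ) → ℤ, (∀ i j g, n i j g ≠ 0 → g ∈ S J ρ 1) ∧
    ∀ g i, sg ρ g i ≠ 0 →
      curl n i g = sg ρ g i * ((if (g, i) = e' then 1 else 0) - (if (g, i) = e then 1 else 0))

theorem Rel.refl (ρ : ℤ) (e : (J → ℤ) × J) : Rel ρ e e :=
  ⟨fun _ _ _ => 0, fun _ _ _ h => absurd rfl h, fun g i _ => by simp [curl]⟩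

theorem Rel.trans {ρ : ℤ} {e e' e'' : (J → ℤ) × J} (h : Rel ρ e e') (h' : Rel ρ e' e'') : Rel ρ e e'' := by
  obtain ⟨n, h1, h2⟩ := h
  obtain ⟨n', h1', h2'⟩ := h'
  refine ⟨fun i j g => n i j g + n' i j g, fun i j g hne => ?_, fun g i hs => ?_⟩
  · by_cases hn : n i j g = 0
    · exact h1' i j g (fun h0 => hne (by simp [hn, h0]))
    · exact h1 i j g hn
  · have : curl (fun i j g => n i j g + n' i j g) i g = curl n i g + curl n' i g := by
      unfold curl; rw [← Finset.sum_add_distrib]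
      exact Finset.sum_congr rfl fun j _ => by ring
    rw [this, h2 g i hs, h2' g i hs]; ring

theorem curl_single (a : J → ℤ) (i j : J) (hij : i ≠ j) (c : ℤ) (k : J) (g : J → ℤ) :
    curl (fun k l g => if k = i ∧ l = j ∧ g = a then c else 0) k g =
      c * ((if (g, k) = (a, i) then 1 else 0) - (if (g, k) = (a + ev j, i) then 1 else 0)
        - (if (g, k) = (a, j) then 1 else 0) + (if (g, k) = (a + ev i, j) then 1 else 0)) := by
  unfold curl
  simp only [Finset.sum_sub_distrib]
  have e1 : ∀ x : J → ℤ, ∀ l, (g - ev l = a) = (g = a + ev l) := fun _ l => by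
    rw [sub_eq_iff_eq_add]
  have s1 : ∑ l, (if k = i ∧ l = j ∧ g = a then c else 0) = if k = i ∧ g = a then c else 0 := by
    rw [Finset.sum_eq_single j] <;> simp +contextual
  have s2 : ∑ l, (if k = i ∧ l = j ∧ g - ev l = a then c else 0) = if k = i ∧ g = a + ev j then c else 0 := by
    rw [Finset.sum_eq_single j] <;> simp +contextual [sub_eq_iff_eq_add]
  have s3 : ∑ l, (if l = i ∧ k = j ∧ g = a then c else 0) = if k = j ∧ g = a then c else 0 := by
    rw [Finset.sum_eq_single i] <;> simp +contextual
  have s4 : ∑ l, (if l = i ∧ k = j ∧ g - ev l = a then c else 0) = if k = j ∧ g = a + ev i then c else 0 := by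
    rw [Finset.sum_eq_single i] <;> simp +contextual [sub_eq_iff_eq_add]
  rw [s1, s2, s3, s4]
  simp only [Prod.mk.injEq]
  have c1 : ∀ (p q : Prop) [Decidable p] [Decidable q], (if q ∧ p then c else 0) = c * (if p ∧ q then 1 else 0) := by
    intro p q _ _; by_cases hp : p <;> by_cases hq : q <;> simp [hp, hq]
  rw [c1, c1, c1, c1]; ring

theorem Rel_sq {ρ : ℤ} (a : J → ℤ) (i j : J) (hij : i ≠ j) (e' : (J → ℤ) × J)
    (h1 : sg ρ a i ≠ 0)
    (he' : (e' = (a + ev j, i) ∧ sg ρ (a + ev j) i = sg ρ a i ∧ sg ρ a j = 0 ∧ sg ρ (a + ev i) j = 0) ∨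
      (e' = (a, j) ∧ sg ρ a j = sg ρ a i ∧ sg ρ (a + ev j) i = 0 ∧ sg ρ (a + ev i) j = 0) ∨
      (e' = (a + ev i, j) ∧ sg ρ (a + ev i) j = - sg ρ a i ∧ sg ρ (a + ev j) i = 0 ∧ sg ρ a j = 0)) :
    Rel ρ (a, i) e' := by
  refine ⟨fun k l g => if k = i ∧ l = j ∧ g = a then - sg ρ a i else 0, ?_, ?_⟩
  · intro k l g hne
    simp only [ne_eq, ite_eq_right_iff, not_forall] at hne
    obtain ⟨⟨_, _, rfl⟩, _⟩ := hne
    exact cut_mem_S h1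
  · intro g k hs
    rw [curl_single a i j hij]
    have hji : j ≠ i := hij.symm
    have hni : ev i ≠ (0 : J → ℤ) := ev_ne_zero i
    have hnj : ev j ≠ (0 : J → ℤ) := ev_ne_zero j
    have q2 : (a, i) ≠ (a + ev j, i) := by simp [hnj]
    have q3 : (a, i) ≠ (a, j) := by simp [hij]
    have q4 : (a, i) ≠ (a + ev i, j) := by simp [hij]
    have q23 : (a + ev j, i) ≠ (a, j) := by simp [hij]
    have q24 : (a + ev j, i) ≠ (a + ev i, j) := by simp [hij]
    have q34 : (a, j) ≠ (a + ev i, j) := by simp [hni]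
    by_cases c1 : (g, k) = (a, i)
    · obtain ⟨rfl, rfl⟩ := Prod.mk.inj c1
      rcases he' with ⟨rfl, h⟩ | ⟨rfl, h⟩ | ⟨rfl, h⟩ <;> simp [q2, q3, q4]
    by_cases c2 : (g, k) = (a + ev j, i)
    · rcases he' with ⟨rfl, h⟩ | ⟨rfl, h⟩ | ⟨rfl, h⟩
      · obtain ⟨rfl, rfl⟩ := Prod.mk.inj c2
        rw [if_neg q2.symm, if_pos rfl, if_neg q23, if_neg q24, h.1]; ring
      · obtain ⟨rfl, rfl⟩ := Prod.mk.inj c2; exact absurd h.2.1 hs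
      · obtain ⟨rfl, rfl⟩ := Prod.mk.inj c2; exact absurd h.2.1 hs
    by_cases c3 : (g, k) = (a, j)
    · rcases he' with ⟨rfl, h⟩ | ⟨rfl, h⟩ | ⟨rfl, h⟩
      · obtain ⟨rfl, rfl⟩ := Prod.mk.inj c3; exact absurd h.2.1 hs
      · obtain ⟨rfl, rfl⟩ := Prod.mk.inj c3
        rw [if_neg q3.symm, if_neg q23.symm, if_pos rfl, if_neg q34, h.1]; ring
      · obtain ⟨rfl, rfl⟩ := Prod.mk.inj c3; exact absurd h.2.2 hs
    by_cases c4 : (g, k) = (a + ev i, j)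
    · rcases he' with ⟨rfl, h⟩ | ⟨rfl, h⟩ | ⟨rfl, h⟩
      · obtain ⟨rfl, rfl⟩ := Prod.mk.inj c4; exact absurd h.2.2 hs
      · obtain ⟨rfl, rfl⟩ := Prod.mk.inj c4; exact absurd h.2.2 hs
      · obtain ⟨rfl, rfl⟩ := Prod.mk.inj c4
        rw [if_neg q4.symm, if_neg q24.symm, if_neg q34.symm, if_pos rfl, h.1]; ring
    rcases he' with ⟨rfl, h⟩ | ⟨rfl, h⟩ | ⟨rfl, h⟩ <;> simp [c1, c2, c3, c4]

theorem add_ev_apply (g : J → ℤ) (i k : J) : (g + ev i) k = g k + if k = i then 1 else 0 := by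
  by_cases h : k = i
  · subst h; simp [ev_self]
  · simp [ev_ne h, h]

/-- coordinates description of cut edges -/
theorem sg_pos {ρ : ℤ} {g : J → ℤ} {i : J} (hρ : 0 ≤ ρ) (hi : g i = ρ) (h : ∀ j, j ≠ i → -ρ ≤ g j ∧ g j ≤ ρ) :
    sg ρ g i = 1 := by
  have h1 : g ∈ Q J ρ := by
    rw [mem_Q]; intro k; by_cases hk : k = i
    · subst hk; omega
    · exact h k hk
  have h2 : g + ev i ∉ Q J ρ := by
    rw [mem_Q]; intro hc; have := hc i; rw [add_ev_apply] at this; simp at this; omega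
  simp [sg, h1, h2]

theorem sg_neg {ρ : ℤ} {g : J → ℤ} {i : J} (hρ : 0 ≤ ρ) (hi : g i = -ρ - 1) (h : ∀ j, j ≠ i → -ρ ≤ g j ∧ g j ≤ ρ) :
    sg ρ g i = -1 := by
  have h1 : g + ev i ∈ Q J ρ := by
    rw [mem_Q]; intro k; rw [add_ev_apply]; by_cases hk : k = i
    · subst hk; simp; omega
    · simp [hk]; exact h k hk
  have h2 : g ∉ Q J ρ := by
    rw [mem_Q]; intro hc; have := hc i; omega
  simp [sg, h1, h2]

theorem sg_zero_in {ρ : ℤ} {g : J → ℤ} {i : J} (hi : -ρ ≤ g i ∧ g i < ρ) : sg ρ g i = 0 := by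
  by_cases h : g ∈ Q J ρ
  · have h1 : g + ev i ∈ Q J ρ := by
      rw [mem_Q] at h ⊢; intro k; rw [add_ev_apply]; by_cases hk : k = i
      · subst hk; simp; omega
      · simp [hk]; exact h k
    simp [sg, h, h1]
  · have h1 : g + ev i ∉ Q J ρ := by
      intro hc; apply h; rw [mem_Q] at hc ⊢; intro k
      have := hc k; rw [add_ev_apply] at this
      by_cases hk : k = i
      · subst hk; omega
      · simpa [hk] using this
    simp [sg, h, h1]

theorem sg_zero_out {ρ : ℤ} {g : J → ℤ} {i j : J} (hij : j ≠ i) (hi : g j < -ρ ∨ ρ < g j) : sg ρ g i = 0 := by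
  have h1 : g ∉ Q J ρ := by
    rw [mem_Q]; intro hc; have := hc j; omega
  have h2 : g + ev i ∉ Q J ρ := by
    rw [mem_Q]; intro hc; have := hc j; rw [add_ev_apply] at this; simp [hij] at this; omega
  simp [sg, h1, h2]

theorem cut_coord {ρ : ℤ} {g : J → ℤ} {i : J} (h : sg ρ g i ≠ 0) :
    (g i = ρ ∨ g i = -ρ - 1) ∧ ∀ j, j ≠ i → -ρ ≤ g j ∧ g j ≤ ρ := by
  have h2 : ∀ j, j ≠ i → -ρ ≤ g j ∧ g j ≤ ρ := by
    intro j hj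
    by_contra hc
    exact h (sg_zero_out hj (by omega))
  refine ⟨?_, h2⟩
  by_contra hc
  push Not at hc
  by_cases h3 : -ρ ≤ g i ∧ g i < ρ
  · exact h (sg_zero_in h3)
  · apply h
    have h1 : g ∉ Q J ρ := by
      rw [mem_Q]; intro hcc; have := hcc i; omega
    have h2 : g + ev i ∉ Q J ρ := by
      rw [mem_Q]; intro hcc; have := hcc i; rw [add_ev_apply] at this; simp at this; omega
    simp [sg, h1, h2]

theorem Rel_raise {ρ : ℤ} (hρ : 1 ≤ ρ) (i : J) (N : ℕ) : ∀ g : J → ℤ, sg ρ g i ≠ 0 →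
    (∑ j ∈ Finset.univ.erase i, (ρ - g j).toNat = N) →
    Rel ρ (g, i) (fun k => if k = i then g i else ρ, i) := by
  induction N using Nat.strong_induction_on with
  | _ N ih =>
  intro g hg hN
  obtain ⟨hi, hj⟩ := cut_coord hg
  by_cases h : ∃ j, j ≠ i ∧ g j < ρ
  · obtain ⟨j, hji, hjρ⟩ := h
    have hne : ∀ k, k ≠ i → -ρ ≤ (g + ev j) k ∧ (g + ev j) k ≤ ρ := by
      intro k hk; rw [add_ev_apply]; have := hj k hk
      by_cases hkj : k = j
      · subst hkj; simp; omega
      · simp [hkj]; exact this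
    have hsi : (g + ev j) i = g i := by rw [add_ev_apply]; simp [hji.symm]
    have hs : sg ρ (g + ev j) i = sg ρ g i := by
      rcases hi with hi | hi
      · rw [sg_pos (by omega) hi hj, sg_pos (by omega) (hsi.trans hi) hne]
      · rw [sg_neg (by omega) hi hj, sg_neg (by omega) (hsi.trans hi) hne]
    have hstep : Rel ρ (g, i) (g + ev j, i) := by
      refine Rel_sq g i j hji.symm _ hg (Or.inl ⟨rfl, hs, sg_zero_in ⟨(hj j hji).1, hjρ⟩, sg_zero_in ?_⟩)
      rw [add_ev_apply]; simp [hji]; exact ⟨(hj j hji).1, hjρ⟩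
    have hrest := ih (∑ k ∈ Finset.univ.erase i, (ρ - (g + ev j) k).toNat) (by
      rw [← hN]
      refine Finset.sum_lt_sum ?_ ⟨j, by simp [hji], ?_⟩
      · intro k _; rw [add_ev_apply]; split_ifs <;> omega
      · rw [add_ev_apply]; simp; omega) (g + ev j) (by rw [hs]; exact hg) rfl
    rw [hsi] at hrest
    exact hstep.trans hrest
  · push Not at h
    have : (fun k => if k = i then g i else ρ) = g := by
      ext k; by_cases hk : k = i
      · subst hk; simp
      · simp [hk]; have := h k hk; have := hj k hk; omega
    rw [this]
    exact Rel.refl _ _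

theorem Rel_corner {ρ : ℤ} (hρ : 1 ≤ ρ) (i0 i1 : J) (hi01 : i0 ≠ i1) (g : J → ℤ) (i : J) (hg : sg ρ g i ≠ 0) :
    Rel ρ (g, i) (fun _ => ρ, i0) := by
  -- positive corner
  have hpos : ∀ i, Rel ρ (fun _ => ρ, i) (fun _ => ρ, i0) := by
    intro i
    by_cases h : i = i0
    · subst h; exact Rel.refl _ _
    · have e1 : ∀ k : J, sg ρ (fun _ => ρ) k = 1 := fun k => sg_pos (by omega) rfl (fun _ _ => by omega)
      refine Rel_sq _ i i0 h _ (by rw [e1]; norm_num) (Or.inr (Or.inl ⟨rfl, by rw [e1, e1], ?_, ?_⟩))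
      · apply sg_zero_out (j := i0) (Ne.symm h); rw [add_ev_apply]; simp
      · apply sg_zero_out (j := i) h; rw [add_ev_apply]; simp
  have hposface : ∀ g i, sg ρ g i ≠ 0 → g i = ρ → Rel ρ (g, i) (fun _ => ρ, i0) := by
    intro g i hg hi
    have h1 := Rel_raise hρ i _ g hg rfl
    have : (fun k => if k = i then g i else ρ) = fun _ => ρ := by
      ext k; by_cases hk : k = i <;> simp [hk, hi]
    rw [this] at h1
    exact h1.trans (hpos i)
  rcases (cut_coord hg).1 with hi | hi
  · exact hposface g i hg hi
  · have h1 := Rel_raise hρ i _ g hg rfl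
    refine h1.trans ?_
    obtain ⟨j, hj⟩ : ∃ j, j ≠ i := by
      by_cases h : i0 = i
      · exact ⟨i1, fun h' => hi01 (h.trans h'.symm)⟩
      · exact ⟨i0, h⟩
    set a : J → ℤ := fun k => if k = i then g i else ρ with ha
    have hai : a i = -ρ - 1 := by simp [ha, hi]
    have hak : ∀ k, k ≠ i → a k = ρ := fun k hk => by simp [ha, hk]
    have hsa : sg ρ a i = -1 := sg_neg (by omega) hai (fun k hk => by rw [hak k hk]; omega)
    have hsb : sg ρ (a + ev i) j = 1 := by
      apply sg_pos (by omega)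
      · rw [add_ev_apply]; simp [hj, hak j hj]
      · intro k hk; rw [add_ev_apply]
        by_cases hki : k = i
        · subst hki; rw [hai]; simp; omega
        · simp [hki, hak k hki]; omega
    have hstep : Rel ρ (a, i) (a + ev i, j) := by
      refine Rel_sq a i j hj.symm _ (by rw [hsa]; norm_num) (Or.inr (Or.inr ⟨rfl, by rw [hsa, hsb]; norm_num, ?_, ?_⟩))
      · apply sg_zero_out hj; rw [add_ev_apply]; simp [hak j hj]
      · apply sg_zero_out hj.symm; rw [hai]; omega
    refine hstep.trans (hposface _ _ (by rw [hsb]; norm_num) ?_)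
    rw [add_ev_apply]; simp [hj, hak j hj]

end phaseA
end BDE

namespace BDE

section phaseA2
variable {J : Type} [Fintype J] [DecidableEq J]

/-- integers inside the reals -/
def II : AddSubgroup ℝ := (Int.castAddHom ℝ).range

theorem mem_II {x : ℝ} : x ∈ II ↔ ∃ z : ℤ, (z : ℝ) = x := by
  exact Iff.rfl

theorem int_mem_II (z : ℤ) : (z : ℝ) ∈ II := mem_II.2 ⟨z, rfl⟩

theorem fract_sub_mem (x : ℝ) : Int.fract x - x ∈ II := by
  rw [mem_II]; refine ⟨-⌊x⌋, ?_⟩; rw [Int.fract]; push_cast; ring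

theorem int_mul_mem_II (z : ℤ) {x : ℝ} (hx : x ∈ II) : (z : ℝ) * x ∈ II := by
  obtain ⟨w, rfl⟩ := mem_II.1 hx
  rw [mem_II]; exact ⟨z * w, by push_cast; ring⟩

theorem curl_div (n : J → J → (J → ℤ) → ℝ) (g : J → ℤ) :
    ∑ i, (curl n i g - curl n i (g - ev i)) = 0 := by
  let F : J → J → ℝ := fun i j => n i j g - n i j (g - ev j) - n i j (g - ev i) + n i j (g - ev i - ev j)
  have h : ∑ i, (curl n i g - curl n i (g - ev i)) = ∑ i, ∑ j, (F i j - F j i) := by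
    refine Finset.sum_congr rfl fun i _ => ?_
    unfold curl
    rw [← Finset.sum_sub_distrib]
    refine Finset.sum_congr rfl fun j _ => ?_
    simp only [F]
    rw [sub_right_comm g (ev j) (ev i)]
    ring
  rw [h]
  simp only [Finset.sum_sub_distrib]
  rw [Finset.sum_comm, sub_self]

theorem curl_sub (n n' : J → J → (J → ℤ) → ℝ) (i : J) (g : J → ℤ) :
    curl n i g - curl n' i g = curl (fun i j g => n i j g - n' i j g) i g := by
  unfold curl
  rw [← Finset.sum_sub_distrib]
  exact Finset.sum_congr rfl fun j _ => by ring

theorem curl_mem (n : J → J → (J → ℤ) → ℝ) (i : J) (g : J → ℤ)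
    (h1 : ∀ i j, n i j g ∈ II) (h2 : ∀ i j k, n i j (g - ev k) ∈ II) : curl n i g ∈ II :=
  II.sum_mem fun j _ => II.sub_mem (II.sub_mem (h1 _ _) (h2 _ _ _)) (II.sub_mem (h1 _ _) (h2 _ _ _))

theorem curl_lincomb {ι : Type} (T : Finset ι) (c : ι → ℝ) (n : ι → J → J → (J → ℤ) → ℤ) (i : J) (g : J → ℤ) :
    curl (fun i j g => ∑ e ∈ T, c e * (n e i j g : ℝ)) i g = ∑ e ∈ T, c e * ((curl (n e) i g : ℤ) : ℝ) := by
  unfold curl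
  simp only [← Finset.sum_sub_distrib]
  rw [Finset.sum_comm]
  refine Finset.sum_congr rfl fun e _ => ?_
  push_cast
  rw [Finset.mul_sum]
  exact Finset.sum_congr rfl fun j _ => by ring

/-- flux through the boundary of a cube -/
theorem flux_eq (ρ : ℤ) (f : J → (J → ℤ) → ℝ) :
    ∑ e ∈ Q J (ρ + 1) ×ˢ (Finset.univ : Finset J), (sg ρ e.1 e.2 : ℝ) * f e.2 e.1 =
      ∑ g ∈ Q J ρ, ∑ i, (f i g - f i (g - ev i)) := by
  rw [Finset.sum_product, Finset.sum_comm, Finset.sum_comm (s := Q J ρ)]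
  refine Finset.sum_congr rfl fun i _ => ?_
  have h1 : ∀ g, (sg ρ g i : ℝ) * f i g = (if g ∈ Q J ρ then f i g else 0) -
      (if g + ev i ∈ Q J ρ then f i g else 0) := by
    intro g; unfold sg; push_cast; split_ifs <;> simp
  simp_rw [h1]
  rw [Finset.sum_sub_distrib, Finset.sum_sub_distrib, ← Finset.sum_filter, ← Finset.sum_filter]
  congr 1
  · apply Finset.sum_congr _ (fun _ _ => rfl)
    ext g; simp only [Finset.mem_filter]
    exact ⟨fun h => h.2, fun h => ⟨Q_mono (by omega) h, h⟩⟩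
  · refine Finset.sum_bij' (fun g _ => g + ev i) (fun g _ => g - ev i) ?_ ?_ ?_ ?_ ?_
    · intro g hg; exact (Finset.mem_filter.1 hg).2
    · intro g hg; refine Finset.mem_filter.2 ⟨Q_sub_mem hg (ev_mem_Q i), by rwa [sub_add_cancel]⟩
    · intro g _; simp
    · intro g _; simp
    · intro g _; simp

variable {Ω : Type} [MeasurableSpace Ω] [AddAction (J → ℤ) Ω]

/-- divergence of a flow on the action graph -/
def dvg {R : Type} [AddCommGroup R] (φ : J → Ω → R) (x : Ω) : R := ∑ i, (φ i x - φ i (-ev i +ᵥ x))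

theorem phaseA (hm : ∀ g : J → ℤ, Measurable (fun x : Ω => g +ᵥ x))
    (i0 i1 : J) (hi01 : i0 ≠ i1)
    (ρ : ℕ → ℤ) (V : ℕ → Set Ω) (hρ : ∀ k, 5 ≤ ρ k) (hV : ∀ k, MeasurableSet (V k))
    (hdisj : ∀ j k, ∀ x ∈ V j, ∀ z ∈ V k, ∀ g ∈ S J (ρ j) 3, ∀ h ∈ S J (ρ k) 3, g +ᵥ x = h +ᵥ z → j = k ∧ g = h)
    (φ : J → Ω → ℝ) (hφ : ∀ i, Measurable (φ i)) (M : ℝ) (hM : ∀ i x, |φ i x| ≤ M)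
    (D : Ω → ℤ) (hD : ∀ x, dvg φ x = D x) :
    ∃ φ' : J → Ω → ℝ, (∀ i, Measurable (φ' i)) ∧ (∃ M', ∀ i x, |φ' i x| ≤ M') ∧ (∀ x, dvg φ' x = D x) ∧
      ∀ k, ∀ y ∈ V k, ∀ g i, sg (ρ k) g i ≠ 0 → φ' i (g +ᵥ y) ∈ II := by
  classical
  have hn : ∀ (k : ℕ) (e : (J → ℤ) × J), ∃ n : J → J → (J → ℤ) → ℤ, sg (ρ k) e.1 e.2 ≠ 0 →
      ∀ g i, sg (ρ k) g i ≠ 0 → curl n i g = sg (ρ k) g i *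
        ((if (g, i) = ((fun _ => ρ k, i0) : (J → ℤ) × J) then 1 else 0) - (if (g, i) = e then 1 else 0)) := by
    intro k e
    by_cases h : sg (ρ k) e.1 e.2 ≠ 0
    · obtain ⟨n, _, hn⟩ := Rel_corner (by have := hρ k; omega) i0 i1 hi01 e.1 e.2 h
      exact ⟨n, fun _ => hn⟩
    · exact ⟨fun _ _ _ => 0, fun h' => absurd h' h⟩
  choose n hn using hn
  let t : ℕ × (J → ℤ) → Set Ω := fun p => if p.2 ∈ S J (ρ p.1) 3 then (fun x => -p.2 +ᵥ x) ⁻¹' V p.1 else ∅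
  have ht : ∀ p, MeasurableSet (t p) := by
    intro p; simp only [t]; split_ifs
    · exact hm _ (hV _)
    · exact MeasurableSet.empty
  have htdisj : ∀ p q x, x ∈ t p → x ∈ t q → p = q := by
    rintro ⟨j, g⟩ ⟨k, h⟩ x hp hq
    simp only [t] at hp hq
    split_ifs at hp hq with h1 h2
    · have := hdisj j k _ hp _ hq g h1 h h2 (by simp)
      exact Prod.ext this.1 this.2
    · exact hq.elim
    · exact hp.elim
    · exact hp.elim
  let β : J → J → ℕ × (J → ℤ) → Ω → ℝ := fun i j p x =>
    ∑ e ∈ Q J (ρ p.1 + 1) ×ˢ (Finset.univ : Finset J),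
      ((sg (ρ p.1) e.1 e.2 : ℝ) * φ e.2 (e.1 +ᵥ (-p.2 +ᵥ x))) * (n p.1 e i j p.2 : ℝ)
  have hβ : ∀ i j p, Measurable (β i j p) := by
    intro i j p
    refine Finset.measurable_fun_sum _ fun e _ => ?_
    have : Measurable (fun x : Ω => φ e.2 (e.1 +ᵥ (-p.2 +ᵥ x))) :=
      (hφ e.2).comp ((hm e.1).comp (hm (-p.2)))
    exact (this.const_mul _).mul_const _
  have hb : ∀ i j, ∃ b : Ω → ℝ, Measurable b ∧ ∀ p, Set.EqOn b (β i j p) (t p) := by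
    intro i j
    haveI : Nonempty (ℕ × (J → ℤ)) := ⟨(0, 0)⟩
    refine exists_measurable_piecewise t ht (β i j) (hβ i j) ?_
    intro p q hpq x hx
    exact absurd (htdisj p q x hx.1 hx.2) hpq
  choose b hbm hbe using hb
  let a : J → J → Ω → ℝ := fun i j x => Int.fract (b i j x)
  have ham : ∀ i j, Measurable (a i j) := fun i j => measurable_fract.comp (hbm i j)
  have ha1 : ∀ i j x, |a i j x| ≤ 1 := fun i j x => by
    rw [abs_of_nonneg (Int.fract_nonneg _)]; exact (Int.fract_lt_one _).le
  let orb : Ω → J → J → (J → ℤ) → ℝ := fun x i j g => a i j (g +ᵥ x)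
  have horb : ∀ x g h i, curl (orb (g +ᵥ x)) i h = curl (orb x) i (h + g) := by
    intro x g h i
    unfold curl
    refine Finset.sum_congr rfl fun j _ => ?_
    simp only [orb, vadd_vadd]
    rw [show h - ev j + g = h + g - ev j by abel]
  let φ' : J → Ω → ℝ := fun i x => φ i x + curl (orb x) i 0
  have hφ'm : ∀ i, Measurable (φ' i) := by
    intro i
    refine (hφ i).add ?_
    unfold curl
    refine Finset.measurable_fun_sum _ fun j _ => ?_
    have hh : ∀ i j g, Measurable (fun x => orb x i j g) := fun i j g => (ham i j).comp (hm g)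
    exact ((hh _ _ _).sub (hh _ _ _)).sub ((hh _ _ _).sub (hh _ _ _))
  refine ⟨φ', hφ'm, ⟨M + ∑ _j : J, 4, ?_⟩, ?_, ?_⟩
  · intro i x
    refine (abs_add_le _ _).trans (add_le_add (hM i x) ?_)
    unfold curl
    refine (Finset.abs_sum_le_sum_abs _ _).trans (Finset.sum_le_sum fun j _ => ?_)
    have q1 := abs_le.1 (ha1 i j ((0 : J → ℤ) +ᵥ x))
    have q2 := abs_le.1 (ha1 i j (((0 : J → ℤ) - ev j) +ᵥ x))
    have q3 := abs_le.1 (ha1 j i ((0 : J → ℤ) +ᵥ x))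
    have q4 := abs_le.1 (ha1 j i (((0 : J → ℤ) - ev j) +ᵥ x))
    rw [abs_le]
    simp only [orb]
    constructor <;> linarith
  · intro x
    rw [← hD x, ← sub_eq_zero]
    unfold dvg
    rw [← Finset.sum_sub_distrib, ← curl_div (orb x) 0]
    refine Finset.sum_congr rfl fun i _ => ?_
    simp only [φ']
    rw [horb]
    simp only [zero_add, zero_sub]
    ring
  · intro k y hy g i hs
    simp only [φ']
    rw [horb, zero_add]
    -- the real corrections
    let B : J → J → (J → ℤ) → ℝ := fun i j h =>
      ∑ e ∈ Q J (ρ k + 1) ×ˢ (Finset.univ : Finset J),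
        ((sg (ρ k) e.1 e.2 : ℝ) * φ e.2 (e.1 +ᵥ y)) * (n k e i j h : ℝ)
    have hbB : ∀ i j h, h ∈ S J (ρ k) 3 → b i j (h +ᵥ y) = B i j h := by
      intro i j h hh
      have hmem : h +ᵥ y ∈ t (k, h) := by simp [t, hh, hy]
      rw [hbe i j (k, h) hmem]
      simp [β, B]
    have hdiff : ∀ i j h, h ∈ S J (ρ k) 3 → orb y i j h - B i j h ∈ II := by
      intro i j h hh
      rw [← hbB i j h hh]; exact fract_sub_mem _
    have hgS := cut_mem_S hs
    have h1 : curl (orb y) i g - curl B i g ∈ II := by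
      rw [curl_sub]
      refine curl_mem _ _ _ (fun i j => hdiff i j g (S_mono (by omega) hgS)) (fun i j l => hdiff i j _ ?_)
      rw [sub_eq_add_neg]
      exact S_mono (by omega) (S_add_mem hgS (Q_neg_mem (ev_mem_Q l)))
    have h2 : φ i (g +ᵥ y) + curl B i g ∈ II := by
      simp only [B]
      rw [curl_lincomb]
      have hflux := flux_eq (ρ k) (fun i h => φ i (h +ᵥ y))
      have hintg : ∑ h ∈ Q J (ρ k), ∑ i, (φ i (h +ᵥ y) - φ i ((h - ev i) +ᵥ y)) ∈ II := by
        refine II.sum_mem fun h _ => ?_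
        have := hD (h +ᵥ y)
        unfold dvg at this
        simp only [vadd_vadd, neg_add_eq_sub] at this
        rw [this]; exact int_mem_II _
      rw [← hflux] at hintg
      set E := Q J (ρ k + 1) ×ˢ (Finset.univ : Finset J) with hE
      have hterm : ∀ e ∈ E, (sg (ρ k) e.1 e.2 : ℝ) * φ e.2 (e.1 +ᵥ y) * ((curl (n k e) i g : ℤ) : ℝ) =
          (sg (ρ k) g i * (if (g, i) = ((fun _ => ρ k, i0) : (J → ℤ) × J) then 1 else 0) : ℤ) *
            ((sg (ρ k) e.1 e.2 : ℝ) * φ e.2 (e.1 +ᵥ y)) -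
          (if (g, i) = e then (sg (ρ k) e.1 e.2 : ℝ) * φ e.2 (e.1 +ᵥ y) * sg (ρ k) g i else 0) := by
        intro e _
        by_cases hse : sg (ρ k) e.1 e.2 = 0
        · simp [hse]
        · rw [hn k e hse g i hs]
          push_cast
          split_ifs <;> ring
      rw [Finset.sum_congr rfl hterm, Finset.sum_sub_distrib, ← Finset.mul_sum]
      have hmemE : (g, i) ∈ E := by
        rw [hE, Finset.mem_product]; exact ⟨S_subset hgS, Finset.mem_univ _⟩
      rw [Finset.sum_ite_eq, if_pos hmemE]
      have hsq : (sg (ρ k) g i : ℝ) * sg (ρ k) g i = 1 := by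
        rcases sg_cases (ρ k) g i with h | h | h
        · exact absurd h hs
        · rw [h]; norm_num
        · rw [h]; norm_num
      have hfin : ∀ (A X f s : ℝ), s * s = 1 → f + (A * X - s * f * s) = A * X := by
        intro A X f s h; linear_combination (-f) * h
      rw [hfin _ _ _ _ hsq]
      exact int_mul_mem_II _ hintg
    have : φ i (g +ᵥ y) + curl (orb y) i g = (φ i (g +ᵥ y) + curl B i g) + (curl (orb y) i g - curl B i g) := by ring
    rw [this]
    exact II.add_mem h2 h1

end phaseA2
end BDE

namespace BDE

section phaseB
variable {J : Type} [Fintype J] [DecidableEq J]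

/-- internal edges of a cube -/
noncomputable def EE (J : Type) [Fintype J] [DecidableEq J] (ρ : ℤ) : Finset ((J → ℤ) × J) :=
  (Q J ρ ×ˢ (Finset.univ : Finset J)).filter (fun e => e.1 + ev e.2 ∈ Q J ρ)

theorem mem_EE {ρ : ℤ} {g : J → ℤ} {i : J} : (g, i) ∈ EE J ρ ↔ g ∈ Q J ρ ∧ g + ev i ∈ Q J ρ := by
  simp [EE]

/-- source of an internal edge -/
noncomputable def eSrc {ρ : ℤ} (e : EE J ρ) : Q J ρ := ⟨e.1.1, (mem_EE.1 e.2).1⟩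
/-- target of an internal edge -/
noncomputable def eTgt {ρ : ℤ} (e : EE J ρ) : Q J ρ := ⟨e.1.1 + ev e.1.2, (mem_EE.1 e.2).2⟩

theorem inc_sum {R : Type} [CommRing R] {ρ : ℤ} (f : (J → ℤ) × J → R) (v : Q J ρ) :
    ∑ e : EE J ρ, (inc eSrc eTgt v e : R) * f e.1 =
      ∑ i, ((if ((v : J → ℤ), i) ∈ EE J ρ then f (v, i) else 0) -
        (if ((v : J → ℤ) - ev i, i) ∈ EE J ρ then f (v - ev i, i) else 0)) := by
  have h1 : ∀ e : EE J ρ, (inc eSrc eTgt v e : R) * f e.1 =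
      (fun e : (J → ℤ) × J => (if e.1 = v then f e else 0) - (if e.1 + ev e.2 = v then f e else 0)) e.1 := by
    intro e
    have a1 : (eSrc e = v) ↔ (e.1.1 = v) := by rw [Subtype.ext_iff]; rfl
    have a2 : (eTgt e = v) ↔ (e.1.1 + ev e.1.2 = v) := by rw [Subtype.ext_iff]; rfl
    unfold inc
    simp only [a1, a2]
    push_cast
    split_ifs <;> simp
  rw [Finset.sum_congr rfl (fun e _ => h1 e)]
  rw [Finset.sum_coe_sort (EE J ρ) (fun e : (J → ℤ) × J => (if e.1 = v then f e else 0) - (if e.1 + ev e.2 = v then f e else 0))]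
  rw [Finset.sum_sub_distrib, Finset.sum_sub_distrib]
  unfold EE
  rw [Finset.sum_filter, Finset.sum_filter, Finset.sum_product_right, Finset.sum_product_right]
  have hv := v.2
  congr 1
  · refine Finset.sum_congr rfl fun i _ => ?_
    rw [Finset.sum_eq_single (v : J → ℤ)]
    · simp [hv]
    · intro b _ hb; simp [hb]
    · intro h; exact absurd hv h
  · refine Finset.sum_congr rfl fun i _ => ?_
    by_cases hvi : (v : J → ℤ) - ev i ∈ Q J ρ
    · rw [Finset.sum_eq_single ((v : J → ℤ) - ev i)]
      · simp [hv, hvi]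
      · intro b _ hb
        have : ¬ b + ev i = v := fun h => hb (by rw [← h]; simp)
        simp [this]
      · intro h; exact absurd hvi h
    · rw [if_neg (by simp [hvi])]
      refine Finset.sum_eq_zero fun b hb => ?_
      have : ¬ b + ev i = v := fun h => hvi (by rw [← h]; simpa using hb)
      simp [this]

variable {Ω : Type} [MeasurableSpace Ω] [AddAction (J → ℤ) Ω]

theorem II_sub_not {x : ℝ} (hx : x ∈ II) : (⌊x⌋ : ℝ) = x ∧ (⌈x⌉ : ℝ) = x := by
  obtain ⟨z, rfl⟩ := mem_II.1 hx; simp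

theorem roundStep (hm : ∀ g : J → ℤ, Measurable (fun x : Ω => g +ᵥ x))
    (ρ : ℤ) (V : Set Ω) (hV : MeasurableSet V)
    (hsep : ∀ x ∈ V, ∀ g ∈ Q J (2 * ρ), g +ᵥ x ∈ V → g = 0)
    (φ : J → Ω → ℝ) (hφ : ∀ i, Measurable (φ i))
    (D : Ω → ℤ) (hD : ∀ x, dvg φ x = D x)
    (hcut : ∀ y ∈ V, ∀ g i, sg ρ g i ≠ 0 → φ i (g +ᵥ y) ∈ II) :
    ∃ φ' : J → Ω → ℝ, (∀ i, Measurable (φ' i)) ∧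
      (∀ i x, (⌊φ i x⌋ : ℝ) ≤ φ' i x ∧ φ' i x ≤ ⌈φ i x⌉) ∧ (∀ x, dvg φ' x = D x) ∧
      ∀ y ∈ V, ∀ g i, g ∈ Q J ρ → g + ev i ∈ Q J ρ → φ' i (g +ᵥ y) ∈ II := by
  classical
  let Dat := (EE J ρ → ℤ) × (EE J ρ → ℤ) × (Q J ρ → ℤ)
  let good : Dat → (EE J ρ → ℤ) → Prop := fun d z =>
    (∀ e, d.1 e ≤ z e ∧ z e ≤ d.2.1 e) ∧ ∀ v, ∑ e, inc eSrc eTgt v e * z e = d.2.2 v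
  let Sel : Dat → EE J ρ → ℤ := fun d => if h : ∃ z, good d z then h.choose else 0
  have hSel : ∀ d, (∃ z, good d z) → good d (Sel d) := by
    intro d h; simp only [Sel, dif_pos h]; exact h.choose_spec
  let dat : Ω → Dat := fun y =>
    (fun e => ⌊φ e.1.2 (e.1.1 +ᵥ y)⌋, fun e => ⌈φ e.1.2 (e.1.1 +ᵥ y)⌉,
      fun v => ⌊∑ e : EE J ρ, (inc eSrc eTgt v e : ℝ) * φ e.1.2 (e.1.1 +ᵥ y)⌋)
  have hshift : ∀ i g, Measurable (fun y : Ω => φ i (g +ᵥ y)) := fun i g => (hφ i).comp (hm g)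
  have hdat : Measurable dat := by
    refine Measurable.prodMk ?_ (Measurable.prodMk ?_ ?_)
    · exact measurable_pi_iff.2 fun e => Int.measurable_floor.comp (hshift _ _)
    · exact measurable_pi_iff.2 fun e => Int.measurable_ceil.comp (hshift _ _)
    · exact measurable_pi_iff.2 fun v => Int.measurable_floor.comp
        (Finset.measurable_fun_sum _ fun e _ => (hshift _ _).const_mul _)
  let z : Ω → EE J ρ → ℤ := fun y => Sel (dat y)
  have hz : ∀ e, Measurable (fun y => z y e) := fun e =>
    (Measurable.of_discrete (f := fun d : Dat => Sel d e)).comp hdat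
  -- sum over internal edges is an integer
  have hintsum : ∀ y ∈ V, ∀ v : Q J ρ, ∑ e : EE J ρ, (inc eSrc eTgt v e : ℝ) * φ e.1.2 (e.1.1 +ᵥ y) ∈ II := by
    intro y hy v
    rw [inc_sum (fun e => φ e.2 (e.1 +ᵥ y)) v]
    have h0 := hD ((v : J → ℤ) +ᵥ y)
    unfold dvg at h0
    simp only [vadd_vadd, neg_add_eq_sub] at h0
    have h1 : (∑ i, (φ i ((v : J → ℤ) +ᵥ y) - φ i (((v : J → ℤ) - ev i) +ᵥ y))) -
      (∑ i, ((if ((v : J → ℤ), i) ∈ EE J ρ then φ i ((v : J → ℤ) +ᵥ y) else 0) -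
        (if ((v : J → ℤ) - ev i, i) ∈ EE J ρ then φ i (((v : J → ℤ) - ev i) +ᵥ y) else 0))) ∈ II := by
      rw [← Finset.sum_sub_distrib]
      refine II.sum_mem fun i _ => ?_
      have e1 : φ i ((v : J → ℤ) +ᵥ y) - (if ((v : J → ℤ), i) ∈ EE J ρ then φ i ((v : J → ℤ) +ᵥ y) else 0) ∈ II := by
        split_ifs with h
        · rw [sub_self]; exact II.zero_mem
        · rw [sub_zero]
          refine hcut y hy _ _ ?_
          rw [mem_EE] at h
          have : (v : J → ℤ) + ev i ∉ Q J ρ := fun h' => h ⟨v.2, h'⟩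
          simp [sg, v.2, this]
      have e2 : φ i (((v : J → ℤ) - ev i) +ᵥ y) - (if ((v : J → ℤ) - ev i, i) ∈ EE J ρ then φ i (((v : J → ℤ) - ev i) +ᵥ y) else 0) ∈ II := by
        split_ifs with h
        · rw [sub_self]; exact II.zero_mem
        · rw [sub_zero]
          refine hcut y hy _ _ ?_
          rw [mem_EE] at h
          have : (v : J → ℤ) - ev i ∉ Q J ρ := fun h' => h ⟨h', by simp⟩
          simp [sg, v.2, this]
      have := II.sub_mem e1 e2
      convert this using 1; ring
    have h2 := II.sub_mem (int_mem_II (D ((v : J → ℤ) +ᵥ y))) h1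
    rw [← h0] at h2
    convert h2 using 1; ring
  have hgood : ∀ y ∈ V, good (dat y) (z y) := by
    intro y hy
    refine hSel _ ?_
    obtain ⟨w, hw1, hw2⟩ := finite_round (eSrc (J := J) (ρ := ρ)) eTgt
      (fun v => ⌊∑ e : EE J ρ, (inc eSrc eTgt v e : ℝ) * φ e.1.2 (e.1.1 +ᵥ y)⌋) _
      (fun e : EE J ρ => φ e.1.2 (e.1.1 +ᵥ y)) rfl (fun v => ((II_sub_not (hintsum y hy v)).1).symm)
    exact ⟨w, hw1, hw2⟩
  let φ' : J → Ω → ℝ := fun i x => φ i x + ∑ e : EE J ρ,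
    (if e.1.2 = i then Set.indicator ((fun x : Ω => -e.1.1 +ᵥ x) ⁻¹' V) (fun x => (z (-e.1.1 +ᵥ x) e : ℝ) - φ i x) x else 0)
  have hφ'm : ∀ i, Measurable (φ' i) := by
    intro i
    refine (hφ i).add (Finset.measurable_fun_sum _ fun e _ => ?_)
    split_ifs
    · refine Measurable.indicator ?_ (hm _ hV)
      refine Measurable.sub ?_ (hφ i)
      exact (Measurable.of_discrete (f := fun a : ℤ => (a : ℝ))).comp ((hz e).comp (hm _))
    · exact measurable_const
  have huniq : ∀ y ∈ V, ∀ y' ∈ V, ∀ g ∈ Q J ρ, ∀ g' ∈ Q J ρ, g +ᵥ y = g' +ᵥ y' → g = g' ∧ y = y' := by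
    intro y hy y' hy' g hg g' hg' h
    have hyy : y' = (-g' + g) +ᵥ y := by rw [← vadd_vadd, h]; simp
    have : -g' + g = 0 := by
      refine hsep y hy _ ?_ (hyy ▸ hy')
      rw [two_mul]; exact Q_add_mem (Q_neg_mem hg') hg
    refine ⟨by rw [← sub_eq_zero, ← this]; abel, by rw [hyy, this, zero_vadd]⟩
  have hin : ∀ y ∈ V, ∀ e : EE J ρ, φ' e.1.2 (e.1.1 +ᵥ y) = z y e := by
    intro y hy e
    simp only [φ']
    rw [Finset.sum_eq_single e]
    · simp [hy]
    · intro e' _ hne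
      split_ifs with h
      · rw [Set.indicator_of_notMem]
        intro hmem
        have := (huniq y hy _ hmem e.1.1 (mem_EE.1 e.2).1 e'.1.1 (mem_EE.1 e'.2).1 (by simp)).1
        exact hne (Subtype.ext (Prod.ext this.symm h))
      · rfl
    · intro h; exact absurd (Finset.mem_univ _) h
  have hout : ∀ i x, (∀ y ∈ V, ∀ e : EE J ρ, e.1.2 = i → x ≠ e.1.1 +ᵥ y) → φ' i x = φ i x := by
    intro i x h
    simp only [φ']
    rw [Finset.sum_eq_zero, add_zero]
    intro e _
    split_ifs with h1
    · rw [Set.indicator_of_notMem]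
      intro hmem
      exact h _ hmem e h1 (by simp)
    · rfl
  refine ⟨φ', hφ'm, ?_, ?_, ?_⟩
  · intro i x
    by_cases h : ∀ y ∈ V, ∀ e : EE J ρ, e.1.2 = i → x ≠ e.1.1 +ᵥ y
    · rw [hout i x h]; exact ⟨Int.floor_le _, Int.le_ceil _⟩
    · push Not at h
      obtain ⟨y, hy, e, rfl, rfl⟩ := h
      rw [hin y hy e]
      have := (hgood y hy).1 e
      exact ⟨by exact_mod_cast this.1, by exact_mod_cast this.2⟩
  · intro x
    by_cases h : ∃ y ∈ V, ∃ g ∈ Q J ρ, x = g +ᵥ y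
    · obtain ⟨y, hy, g, hg, rfl⟩ := h
      have k1 : ∀ i, φ' i (g +ᵥ y) - φ i (g +ᵥ y) = if h : (g, i) ∈ EE J ρ then (z y ⟨_, h⟩ : ℝ) - φ i (g +ᵥ y) else 0 := by
        intro i
        split_ifs with h
        · rw [← hin y hy ⟨(g, i), h⟩]
        · rw [hout, sub_self]
          rintro y' hy' e rfl hx
          have := huniq y hy y' hy' g hg _ (mem_EE.1 e.2).1 hx
          exact h (by rw [this.1]; exact e.2)
      have k2 : ∀ i, φ' i ((g - ev i) +ᵥ y) - φ i ((g - ev i) +ᵥ y) = if h : (g - ev i, i) ∈ EE J ρ then (z y ⟨_, h⟩ : ℝ) - φ i ((g - ev i) +ᵥ y) else 0 := by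
        intro i
        split_ifs with h
        · rw [← hin y hy ⟨(g - ev i, i), h⟩]
        · rw [hout, sub_self]
          rintro y' hy' e rfl hx
          have hx' : g +ᵥ y = (e.1.1 + ev e.1.2) +ᵥ y' := by
            have := congrArg (fun t => ev e.1.2 +ᵥ t) hx
            simpa [vadd_vadd, add_comm] using this
          have := huniq y hy y' hy' g hg _ (mem_EE.1 e.2).2 hx'
          exact h (by rw [this.1, add_sub_cancel_right]; exact e.2)
      let f : (J → ℤ) × J → ℝ := fun e => if h : e ∈ EE J ρ then (z y ⟨_, h⟩ : ℝ) - φ e.2 (e.1 +ᵥ y) else 0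
      have hs := inc_sum f (⟨g, hg⟩ : Q J ρ)
      have hs0 : ∑ e : EE J ρ, (inc eSrc eTgt (⟨g, hg⟩ : Q J ρ) e : ℝ) * f e.1 = 0 := by
        have : ∀ e : EE J ρ, f e.1 = z y e - φ e.1.2 (e.1.1 +ᵥ y) := fun e => by simp [f, e.2]
        simp only [this, mul_sub, Finset.sum_sub_distrib]
        rw [← (II_sub_not (hintsum y hy ⟨g, hg⟩)).1, sub_eq_zero]
        exact_mod_cast (hgood y hy).2 ⟨g, hg⟩
      rw [← hD, ← sub_eq_zero]
      unfold dvg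
      simp only [vadd_vadd, neg_add_eq_sub]
      rw [← Finset.sum_sub_distrib, ← hs0, hs]
      refine Finset.sum_congr rfl fun i _ => ?_
      have e1 := k1 i
      have e2 := k2 i
      have e3 : (φ' i (g +ᵥ y) - φ' i ((g - ev i) +ᵥ y)) - (φ i (g +ᵥ y) - φ i ((g - ev i) +ᵥ y))
        = (φ' i (g +ᵥ y) - φ i (g +ᵥ y)) - (φ' i ((g - ev i) +ᵥ y) - φ i ((g - ev i) +ᵥ y)) := by ring
      rw [e3, e1, e2]
      simp only [f]
      split_ifs <;> simp
    · rw [← hD]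
      unfold dvg
      refine Finset.sum_congr rfl fun i _ => ?_
      rw [hout i x, hout i (-ev i +ᵥ x)]
      · rintro y hy e rfl hx
        refine h ⟨y, hy, _, (mem_EE.1 e.2).2, ?_⟩
        have := congrArg (fun t => ev e.1.2 +ᵥ t) hx
        simpa [vadd_vadd, add_comm] using this
      · rintro y hy e rfl hx
        exact h ⟨y, hy, _, (mem_EE.1 e.2).1, hx⟩
  · intro y hy g i hg hgi
    have := hin y hy ⟨(g, i), mem_EE.2 ⟨hg, hgi⟩⟩
    simp only at this
    rw [this]; exact int_mem_II _

end phaseB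
end BDE

namespace BDE

section rounding
variable {J : Type} [Fintype J] [DecidableEq J]
variable {Ω : Type} [MeasurableSpace Ω] [AddAction (J → ℤ) Ω]

theorem measurableSet_II : MeasurableSet (II : Set ℝ) := by
  have : (II : Set ℝ) = Set.range (fun z : ℤ => (z : ℝ)) := by
    ext x; exact mem_II
  rw [this]; exact (Set.countable_range _).measurableSet

theorem rounding (hm : ∀ g : J → ℤ, Measurable (fun x : Ω => g +ᵥ x))
    (hcol : HasCol J Ω) (ν : Measure Ω) [IsFiniteMeasure ν]
    (φ : J → Ω → ℝ) (hφ : ∀ i, Measurable (φ i)) (M : ℝ) (hM : ∀ i x, |φ i x| ≤ M)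
    (D : Ω → ℤ) (hD : ∀ x, dvg φ x = D x) :
    ∃ (ψ : J → Ω → ℤ) (B : ℤ), (∀ i, Measurable (ψ i)) ∧ (∀ i x, |ψ i x| ≤ B) ∧
      ∀ᵐ x ∂ν, dvg ψ x = D x := by
  classical
  rcases subsingleton_or_nontrivial J with hJ | hJ
  · refine ⟨fun i x => ⌊φ i x⌋, ⌈M⌉ + 1, fun i => Int.measurable_floor.comp (hφ i), ?_, ?_⟩
    · intro i x
      have h := abs_le.1 (hM i x)
      have h2 := Int.le_ceil M
      have h3 := Int.floor_le (φ i x)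
      have h4 := Int.lt_floor_add_one (φ i x)
      rw [abs_le]
      constructor
      · have : (-(⌈M⌉ + 1) : ℝ) ≤ ⌊φ i x⌋ := by linarith
        exact_mod_cast this
      · have : (⌊φ i x⌋ : ℝ) ≤ ⌈M⌉ + 1 := by linarith
        exact_mod_cast this
    · refine Filter.Eventually.of_forall fun x => ?_
      have h := hD x
      unfold dvg at h ⊢
      rcases isEmpty_or_nonempty J with hE | ⟨⟨i⟩⟩
      · simp only [Finset.univ_eq_empty, Finset.sum_empty] at h ⊢
        exact_mod_cast h
      · rw [Fintype.sum_subsingleton _ i] at h ⊢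
        have : φ i x = φ i (-ev i +ᵥ x) + D x := by linarith
        simp only [this, Int.floor_add_intCast]; ring
  · obtain ⟨i0, i1, hi01⟩ := hJ
    obtain ⟨ρ, V, hρ, hV, hsep, hdisj, hcov⟩ := toast hm hcol ν
    obtain ⟨φ0, h0m, ⟨M', hM'⟩, h0D, h0c⟩ := phaseA hm i0 i1 hi01 ρ V hρ hV hdisj φ hφ M hM D hD
    let St := {φ : J → Ω → ℝ // (∀ i, Measurable (φ i)) ∧ (∀ x, dvg φ x = D x) ∧
      ∀ k, ∀ y ∈ V k, ∀ g i, sg (ρ k) g i ≠ 0 → φ i (g +ᵥ y) ∈ II}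
    have keep : ∀ {a b : ℝ}, (⌊a⌋ : ℝ) ≤ b ∧ b ≤ ⌈a⌉ → a ∈ II → b = a := by
      intro a b h ha
      have := II_sub_not ha
      rw [this.1, this.2] at h
      exact le_antisymm h.2 h.1
    have step : ∀ (k : ℕ) (f : St), ∃ f' : St, (∀ i x, (⌊f.1 i x⌋ : ℝ) ≤ f'.1 i x ∧ f'.1 i x ≤ ⌈f.1 i x⌉) ∧
        ∀ y ∈ V k, ∀ g i, g ∈ Q J (ρ k) → g + ev i ∈ Q J (ρ k) → f'.1 i (g +ᵥ y) ∈ II := by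
      intro k f
      obtain ⟨f', h1, h2, h3, h4⟩ := roundStep hm (ρ k) (V k) (hV k)
        (fun x hx g hg => hsep k x hx g (Q_mono (by omega) hg)) f.1 f.2.1 D f.2.2.1 (f.2.2.2 k)
      refine ⟨⟨f', h1, h3, ?_⟩, h2, h4⟩
      intro j y hy g i hs
      have := f.2.2.2 j y hy g i hs
      rw [keep (h2 _ _) this]; exact this
    choose F hF1 hF2 using step
    let s : ℕ → St := fun k => Nat.rec ⟨φ0, h0m, h0D, h0c⟩ (fun k f => F k f) k
    have hs0 : (s 0).1 = φ0 := rfl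
    have hs : ∀ k, s (k + 1) = F k (s k) := fun k => rfl
    have hkeep : ∀ k j i x, (s k).1 i x ∈ II → (s (k + j)).1 i x = (s k).1 i x := by
      intro k j i x h
      induction j with
      | zero => rfl
      | succ j ih =>
        rw [← ih, ← add_assoc, hs]
        exact keep (hF1 _ _ _ _) (ih ▸ h)
    have hbd : ∀ k i x, (⌊φ0 i x⌋ : ℝ) ≤ (s k).1 i x ∧ (s k).1 i x ≤ ⌈φ0 i x⌉ := by
      intro k i x
      induction k with
      | zero => rw [hs0]; exact ⟨Int.floor_le _, Int.le_ceil _⟩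
      | succ k ih =>
        rw [hs]
        have h1 := hF1 k (s k) i x
        have h2 : ⌊φ0 i x⌋ ≤ ⌊(s k).1 i x⌋ := Int.le_floor.2 ih.1
        have h3 : ⌈(s k).1 i x⌉ ≤ ⌈φ0 i x⌉ := Int.ceil_le.2 ih.2
        exact ⟨le_trans (by exact_mod_cast h2) h1.1, le_trans h1.2 (by exact_mod_cast h3)⟩
    have hglue : ∀ i, ∃ r : Ω → ℝ, Measurable r ∧ ∀ k, Set.EqOn r ((s k).1 i) ((s k).1 i ⁻¹' II) := by
      intro i
      refine exists_measurable_piecewise _ (fun k => (s k).2.1 i measurableSet_II) _ (fun k => (s k).2.1 i) ?_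
      intro j k _ x hx
      rcases le_total j k with h | h
      · obtain ⟨d, rfl⟩ := Nat.exists_eq_add_of_le h
        exact (hkeep j d i x hx.1).symm
      · obtain ⟨d, rfl⟩ := Nat.exists_eq_add_of_le h
        exact hkeep k d i x hx.2
    choose r hrm hr using hglue
    let B : ℤ := ⌈M'⌉ + 1
    refine ⟨fun i x => max (-B) (min ⌊r i x⌋ B), |B|, ?_, ?_, ?_⟩
    · intro i
      exact measurable_const.max ((Int.measurable_floor.comp (hrm i)).min measurable_const)
    · intro i x
      have : |B| = B ∨ |B| = -B := abs_choice B
      have := le_abs_self B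
      have := neg_abs_le B
      have h0 : |max (-B) (min ⌊r i x⌋ B)| ≤ |B| := by
        rw [abs_le]; omega
      exact h0
    · filter_upwards [hcov] with x hx
      obtain ⟨k, g, hg, hgV⟩ := hx
      have key : ∀ i h, h ∈ Q J (ρ k) → h + ev i ∈ Q J (ρ k) → ∀ x', x' = h +ᵥ (g +ᵥ x) →
          ((max (-B) (min ⌊r i x'⌋ B) : ℤ) : ℝ) = (s (k+1)).1 i x' := by
        intro i h h1 h2 x' hx'
        have hI : (s (k+1)).1 i x' ∈ II := by
          rw [hx', hs]; exact hF2 k (s k) _ hgV h i h1 h2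
        rw [hr i (k+1) hI]
        have hb := hbd (k+1) i x'
        obtain ⟨z, hz⟩ := mem_II.1 hI
        rw [← hz] at hb ⊢
        have hb1 : ⌊φ0 i x'⌋ ≤ z := by exact_mod_cast hb.1
        have hb2 : z ≤ ⌈φ0 i x'⌉ := by exact_mod_cast hb.2
        have hMx := abs_le.1 (hM' i x')
        have l1 : ⌈φ0 i x'⌉ ≤ ⌈M'⌉ := Int.ceil_le_ceil hMx.2
        have l2 : -⌈M'⌉ ≤ ⌊φ0 i x'⌋ := by
          rw [Int.le_floor]; push_cast; have := Int.le_ceil M'; linarith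
        rw [Int.floor_intCast]
        congr 1
        simp only [B]
        omega
      have e := (s (k+1)).2.2.1 x
      have : ((dvg (fun i x => max (-B) (min ⌊r i x⌋ B)) x : ℤ) : ℝ) = (D x : ℝ) := by
        rw [← e]
        unfold dvg
        push_cast only [Int.cast_sum, Int.cast_sub]
        refine Finset.sum_congr rfl fun i _ => ?_
        have hg1 : -g ∈ Q J (ρ k) := Q_mono (by omega) (Q_neg_mem hg)
        rw [key i (-g) hg1 ?_ x (by simp), key i (-g - ev i) ?_ (by simpa using hg1) (-ev i +ᵥ x) ?_]
        · have := Q_sub_mem (Q_neg_mem hg) (ev_mem_Q i); simpa using this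
        · rw [vadd_vadd]; congr 1; abel
        · have := Q_add_mem (Q_neg_mem hg) (ev_mem_Q i); simpa using this
      exact_mod_cast this

end rounding
end BDE

namespace BDE

section glue
variable {J : Type} [Fintype J] [DecidableEq J]
variable {Ω : Type} [MeasurableSpace Ω] [AddAction (J → ℤ) Ω]

theorem meas_comp {C β : Type} [Countable C] [MeasurableSpace C] [MeasurableSingletonClass C] [MeasurableSpace β]
    {κ : Ω → C} (hκ : Measurable κ) {G : C → Ω → β} (hG : ∀ c, Measurable (G c)) :
    Measurable (fun x => G (κ x) x) := by
  have : Measurable (fun q : C × Ω => G q.1 q.2) := measurable_from_prod_countable_right hG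
  exact this.comp (hκ.prodMk measurable_id)

theorem bijOn_shortcut {Z : Type} (isT : Z → Prop) (S T : Set Z) (e : Z → Z) (he : Set.BijOn e S T)
    (hST : ∀ z, isT z → (z ∈ S ↔ z ∈ T)) (heT : ∀ z ∈ S, isT z → ¬ isT (e z)) (f : Z → Z)
    (hf1 : ∀ z, ¬ isT (e z) → f z = e z) (hf2 : ∀ z, isT (e z) → f z = e (e z)) :
    Set.BijOn f {z | ¬ isT z ∧ z ∈ S} {z | ¬ isT z ∧ z ∈ T} := by
  obtain ⟨hm, hi, hs⟩ := he
  refine ⟨?_, ?_, ?_⟩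
  · rintro z ⟨hz, hzS⟩
    by_cases h : isT (e z)
    · rw [hf2 z h]
      have h2 : e z ∈ S := (hST _ h).2 (hm hzS)
      exact ⟨heT _ h2 h, hm h2⟩
    · rw [hf1 z h]; exact ⟨h, hm hzS⟩
  · rintro z ⟨hz, hzS⟩ w ⟨hw, hwS⟩ h
    by_cases h1 : isT (e z) <;> by_cases h2 : isT (e w)
    · rw [hf2 z h1, hf2 w h2] at h
      exact hi hzS hwS (hi ((hST _ h1).2 (hm hzS)) ((hST _ h2).2 (hm hwS)) h)
    · rw [hf2 z h1, hf1 w h2] at h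
      have := hi ((hST _ h1).2 (hm hzS)) hwS h
      exact absurd (this ▸ h1) hw
    · rw [hf1 z h1, hf2 w h2] at h
      have := hi hzS ((hST _ h2).2 (hm hwS)) h
      exact absurd (this ▸ h2) hz
    · rw [hf1 z h1, hf1 w h2] at h
      exact hi hzS hwS h
  · rintro y ⟨hy, hyT⟩
    obtain ⟨w, hwS, rfl⟩ := hs hyT
    by_cases hw : isT w
    · obtain ⟨v, hvS, rfl⟩ := hs ((hST _ hw).1 hwS)
      refine ⟨v, ⟨fun hv => heT v hvS hv hw, hvS⟩, hf2 _ hw⟩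
    · exact ⟨w, ⟨hw, hwS⟩, hf1 _ hy⟩

theorem exists_bij_finset {E : Type} [DecidableEq E] (X Y XT YN : Finset E) (hXT : XT ⊆ X) (hYN : YN ⊆ Y)
    (hc : X.card = Y.card) (hc2 : XT.card ≤ YN.card) :
    ∃ f : E → E, Set.BijOn f X Y ∧ ∀ e ∈ XT, f e ∈ YN := by
  classical
  obtain ⟨Y1, hY1, hY1c⟩ := Finset.exists_subset_card_eq hc2
  have hc3 : (X \ XT).card = (Y \ Y1).card := by
    rw [Finset.card_sdiff_of_subset hXT, Finset.card_sdiff_of_subset (hY1.trans hYN), hc, hY1c]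
  let e1 := Finset.equivOfCardEq hY1c.symm
  let e2 := Finset.equivOfCardEq hc3
  let f : E → E := fun x => if h : x ∈ XT then e1 ⟨x, h⟩ else if h2 : x ∈ X \ XT then e2 ⟨x, h2⟩ else x
  have f1 : ∀ x (h : x ∈ XT), f x = e1 ⟨x, h⟩ := fun x h => by simp only [f, dif_pos h]
  have f2 : ∀ x (h : x ∈ X \ XT), f x = e2 ⟨x, h⟩ := fun x h => by
    have : x ∉ XT := (Finset.mem_sdiff.1 h).2
    simp only [f, dif_neg this, dif_pos h]
  have m1 : ∀ x, x ∈ XT → f x ∈ Y1 := fun x h => by rw [f1 x h]; exact (e1 _).2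
  have m2 : ∀ x, x ∈ X \ XT → f x ∈ Y \ Y1 := fun x h => by rw [f2 x h]; exact (e2 _).2
  refine ⟨f, ⟨?_, ?_, ?_⟩, fun e he => hY1 (m1 e he)⟩
  · intro x hx
    by_cases h : x ∈ XT
    · exact hYN (hY1 (m1 x h))
    · exact (Finset.mem_sdiff.1 (m2 x (Finset.mem_sdiff.2 ⟨hx, h⟩))).1
  · intro x hx y hy hxy
    by_cases h : x ∈ XT <;> by_cases h' : y ∈ XT
    · rw [f1 x h, f1 y h'] at hxy
      have := e1.injective (Subtype.ext hxy)
      exact congrArg Subtype.val this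
    · exact absurd (hxy ▸ m1 x h) (Finset.mem_sdiff.1 (m2 y (Finset.mem_sdiff.2 ⟨hy, h'⟩))).2
    · exact absurd (hxy ▸ m1 y h') (Finset.mem_sdiff.1 (m2 x (Finset.mem_sdiff.2 ⟨hx, h⟩))).2
    · rw [f2 x (Finset.mem_sdiff.2 ⟨hx, h⟩), f2 y (Finset.mem_sdiff.2 ⟨hy, h'⟩)] at hxy
      have := e2.injective (Subtype.ext hxy)
      exact congrArg Subtype.val this
  · intro y hy
    by_cases h : y ∈ Y1
    · refine ⟨(e1.symm ⟨y, h⟩).1, hXT (e1.symm ⟨y, h⟩).2, ?_⟩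
      rw [f1 _ (e1.symm ⟨y, h⟩).2]; simp
    · have h' : y ∈ Y \ Y1 := Finset.mem_sdiff.2 ⟨hy, h⟩
      refine ⟨(e2.symm ⟨y, h'⟩).1, (Finset.mem_sdiff.1 (e2.symm ⟨y, h'⟩).2).1, ?_⟩
      rw [f2 _ (e2.symm ⟨y, h'⟩).2]; simp

set_option maxHeartbeats 2000000 in
theorem glue (hm : ∀ g : J → ℤ, Measurable (fun x : Ω => g +ᵥ x))
    {U : Type} [Fintype U] [DecidableEq U] [MeasurableSpace U] [MeasurableSingletonClass U]
    (isT : U → Prop) (s : ℤ) (V : Set Ω) (κs κt : U → Ω → (J → ℤ))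
    (hκs : ∀ u, Measurable (κs u)) (hκt : ∀ u, Measurable (κt u))
    (hQs : ∀ u x, κs u x ∈ Q J s) (hQt : ∀ u x, κt u x ∈ Q J s)
    (hVs : ∀ u x, κs u x +ᵥ x ∈ V) (hVt : ∀ u x, κt u x +ᵥ x ∈ V)
    (Src Tgt : U → Set Ω) (hSrc : ∀ u, MeasurableSet (Src u)) (hTgt : ∀ u, MeasurableSet (Tgt u))
    (hT : ∀ u, isT u → Src u = Tgt u)
    (hbij : ∀ p ∈ V, ∃ f : Q J s × U → Q J s × U,
      Set.BijOn f {e | κs e.2 ((e.1 : J → ℤ) +ᵥ p) = -(e.1 : J → ℤ) ∧ (e.1 : J → ℤ) +ᵥ p ∈ Src e.2}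
        {e | κt e.2 ((e.1 : J → ℤ) +ᵥ p) = -(e.1 : J → ℤ) ∧ (e.1 : J → ℤ) +ᵥ p ∈ Tgt e.2} ∧
      ∀ e, (κs e.2 ((e.1 : J → ℤ) +ᵥ p) = -(e.1 : J → ℤ) ∧ (e.1 : J → ℤ) +ᵥ p ∈ Src e.2) → isT e.2 → ¬ isT (f e).2) :
    ∃ F : U → Ω → (J → ℤ) × U, (∀ u, Measurable (F u)) ∧ (∀ u x, (F u x).1 ∈ Q J (4 * s)) ∧
      Set.BijOn (fun q : Ω × U => ((F q.2 q.1).1 +ᵥ q.1, (F q.2 q.1).2))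
        {q | ¬ isT q.2 ∧ q.1 ∈ Src q.2} {q | ¬ isT q.2 ∧ q.1 ∈ Tgt q.2} := by
  classical
  let E := Q J s × U
  let Dat := (E → Prop) × (E → Prop)
  let good : Dat → (E → E) → Prop := fun d f => Set.BijOn f {e | d.1 e} {e | d.2 e} ∧
    ∀ e, d.1 e → isT e.2 → ¬ isT (f e).2
  let Sel : Dat → E → E := fun d => if h : ∃ f, good d f then h.choose else id
  let dat : Ω → Dat := fun p =>
    (fun e => κs e.2 ((e.1 : J → ℤ) +ᵥ p) = -(e.1 : J → ℤ) ∧ (e.1 : J → ℤ) +ᵥ p ∈ Src e.2,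
     fun e => κt e.2 ((e.1 : J → ℤ) +ᵥ p) = -(e.1 : J → ℤ) ∧ (e.1 : J → ℤ) +ᵥ p ∈ Tgt e.2)
  have hdat : Measurable dat := by
    refine Measurable.prodMk (measurable_pi_iff.2 fun e => ?_) (measurable_pi_iff.2 fun e => ?_)
    · refine measurableSet_setOfPred.1 (MeasurableSet.inter ?_ (hm _ (hSrc _)))
      exact ((hκs e.2).comp (hm _)) (measurableSet_singleton (-(e.1 : J → ℤ)))
    · refine measurableSet_setOfPred.1 (MeasurableSet.inter ?_ (hm _ (hTgt _)))
      exact ((hκt e.2).comp (hm _)) (measurableSet_singleton (-(e.1 : J → ℤ)))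
  have hgood : ∀ p ∈ V, good (dat p) (Sel (dat p)) := by
    intro p hp
    have h : ∃ f, good (dat p) f := hbij p hp
    simp only [Sel, dif_pos h]
    exact h.choose_spec
  have hdat1 : ∀ p e, (dat p).1 e ↔ (κs e.2 ((e.1 : J → ℤ) +ᵥ p) = -(e.1 : J → ℤ) ∧ (e.1 : J → ℤ) +ᵥ p ∈ Src e.2) := fun _ _ => Iff.rfl
  have hdat2 : ∀ p e, (dat p).2 e ↔ (κt e.2 ((e.1 : J → ℤ) +ᵥ p) = -(e.1 : J → ℤ) ∧ (e.1 : J → ℤ) +ᵥ p ∈ Tgt e.2) := fun _ _ => Iff.rfl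
  clear_value Sel dat
  let eh : U → Ω → (J → ℤ) × U := fun u x =>
    (((Sel (dat (κs u x +ᵥ x)) (⟨-κs u x, Q_neg_mem (hQs u x)⟩, u)).1 : J → ℤ) + κs u x,
      (Sel (dat (κs u x +ᵥ x)) (⟨-κs u x, Q_neg_mem (hQs u x)⟩, u)).2)
  have heh : ∀ u, Measurable (eh u) := by
    intro u
    let G : (J → ℤ) → Ω → (J → ℤ) × U := fun k x =>
      if h : -k ∈ Q J s then
        (((Sel (dat (k +ᵥ x)) (⟨-k, h⟩, u)).1 : J → ℤ) + k, (Sel (dat (k +ᵥ x)) (⟨-k, h⟩, u)).2)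
      else (0, u)
    have hG : ∀ k, Measurable (G k) := by
      intro k
      by_cases h : -k ∈ Q J s
      · simp only [G, dif_pos h]
        exact (Measurable.of_discrete (f := fun d : Dat =>
          ((((Sel d (⟨-k, h⟩, u)).1 : J → ℤ) + k, (Sel d (⟨-k, h⟩, u)).2) : (J → ℤ) × U))).comp (hdat.comp (hm k))
      · simp only [G, dif_neg h]; exact measurable_const
    have : eh u = fun x => G (κs u x) x := by
      funext x; simp only [eh, G, dif_pos (Q_neg_mem (hQs u x))]
    rw [this]
    exact meas_comp (hκs u) hG
  have hehQ : ∀ u x, (eh u x).1 ∈ Q J (2 * s) := by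
    intro u x; rw [two_mul]
    exact Q_add_mem (Subtype.coe_prop _) (hQs u x)
  let eM : Ω × U → Ω × U := fun q => ((eh q.2 q.1).1 +ᵥ q.1, (eh q.2 q.1).2)
  have heM1 : ∀ q : Ω × U, eM q = (((Sel (dat (κs q.2 q.1 +ᵥ q.1)) (⟨-κs q.2 q.1, Q_neg_mem (hQs _ _)⟩, q.2)).1 : J → ℤ) +ᵥ (κs q.2 q.1 +ᵥ q.1),
      (Sel (dat (κs q.2 q.1 +ᵥ q.1)) (⟨-κs q.2 q.1, Q_neg_mem (hQs _ _)⟩, q.2)).2) := by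
    intro q; simp only [eM, eh, vadd_vadd]
  have hsrc0 : ∀ x u, x ∈ Src u → (dat (κs u x +ᵥ x)).1 (⟨-κs u x, Q_neg_mem (hQs _ _)⟩, u) := by
    intro x u h
    simp only [hdat1, neg_vadd_vadd, neg_neg, true_and]
    exact h
  have hbe : Set.BijOn eM {q | q.1 ∈ Src q.2} {q | q.1 ∈ Tgt q.2} := by
    refine ⟨?_, ?_, ?_⟩
    · rintro ⟨x, u⟩ hx
      have := (hgood _ (hVs u x)).1.1 (hsrc0 x u hx)
      rw [heM1]
      exact ((hdat2 _ _).1 this).2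
    · rintro ⟨x, u⟩ hx ⟨y, v⟩ hy h
      rw [heM1, heM1] at h
      simp only [Prod.mk.injEq] at h
      have a1 := (hgood _ (hVs u x)).1.1 (hsrc0 x u hx)
      have a2 := (hgood _ (hVs v y)).1.1 (hsrc0 y v hy)
      set r1 := Sel (dat (κs u x +ᵥ x)) (⟨-κs u x, Q_neg_mem (hQs _ _)⟩, u) with hr1
      set r2 := Sel (dat (κs v y +ᵥ y)) (⟨-κs v y, Q_neg_mem (hQs _ _)⟩, v) with hr2
      have b1 : κt r1.2 ((r1.1 : J → ℤ) +ᵥ (κs u x +ᵥ x)) = -(r1.1 : J → ℤ) := ((hdat2 _ _).1 a1).1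
      have b2 : κt r2.2 ((r2.1 : J → ℤ) +ᵥ (κs v y +ᵥ y)) = -(r2.1 : J → ℤ) := ((hdat2 _ _).1 a2).1
      rw [h.1, h.2, b2, neg_inj] at b1
      have hp : κs u x +ᵥ x = κs v y +ᵥ y := by
        have := h.1; rw [← b1] at this; exact vadd_left_cancel _ this
      have hrr : r1 = r2 := Prod.ext (Subtype.ext b1.symm) h.2
      have hy' := hsrc0 y v hy
      rw [← hp] at hr2 hy'
      rw [hr1, hr2] at hrr
      have := (hgood _ (hVs u x)).1.2.1 (hsrc0 x u hx) hy' hrr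
      have k1 : -κs u x = -κs v y := congrArg (fun e : E => (e.1 : J → ℤ)) this
      have k2 : u = v := congrArg (fun e : E => e.2) this
      rw [neg_inj] at k1
      rw [k1] at hp
      exact Prod.ext (vadd_left_cancel _ hp) k2
    · rintro ⟨z, u'⟩ hz
      have hmem : (dat (κt u' z +ᵥ z)).2 (⟨-κt u' z, Q_neg_mem (hQt _ _)⟩, u') := by
        simp only [hdat2, neg_vadd_vadd, neg_neg, true_and]; exact hz
      obtain ⟨⟨g, u⟩, he, hfe⟩ := (hgood _ (hVt u' z)).1.2.2 hmem
      have he1 : κs u ((g : J → ℤ) +ᵥ (κt u' z +ᵥ z)) = -(g : J → ℤ) := ((hdat1 _ _).1 he).1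
      refine ⟨((g : J → ℤ) +ᵥ (κt u' z +ᵥ z), u), ((hdat1 _ _).1 he).2, ?_⟩
      rw [heM1]
      simp only
      have e1 : κs u ((g : J → ℤ) +ᵥ (κt u' z +ᵥ z)) +ᵥ ((g : J → ℤ) +ᵥ (κt u' z +ᵥ z)) = κt u' z +ᵥ z := by
        rw [he1, neg_vadd_vadd]
      rw [e1]
      have e2 : ((⟨-κs u ((g : J → ℤ) +ᵥ (κt u' z +ᵥ z)), Q_neg_mem (hQs _ _)⟩, u) : E) = (g, u) := by
        refine Prod.ext (Subtype.ext ?_) rfl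
        simp only [he1, neg_neg]
      rw [e2, hfe]
      simp
  let F : U → Ω → (J → ℤ) × U := fun u x =>
    if isT (eh u x).2 then ((eh (eh u x).2 ((eh u x).1 +ᵥ x)).1 + (eh u x).1, (eh (eh u x).2 ((eh u x).1 +ᵥ x)).2)
    else eh u x
  refine ⟨F, ?_, ?_, ?_⟩
  · intro u
    let G : (J → ℤ) × U → Ω → (J → ℤ) × U := fun c x =>
      if isT c.2 then ((eh c.2 (c.1 +ᵥ x)).1 + c.1, (eh c.2 (c.1 +ᵥ x)).2) else c
    refine meas_comp (heh u) (G := G) ?_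
    intro c
    by_cases h : isT c.2
    · simp only [G, if_pos h]
      exact (Measurable.of_discrete (f := fun d : (J → ℤ) × U => ((d.1 + c.1, d.2) : (J → ℤ) × U))).comp ((heh c.2).comp (hm c.1))
    · simp only [G, if_neg h]; exact measurable_const
  · intro u x
    simp only [F]
    split_ifs
    · have := Q_add_mem (hehQ (eh u x).2 ((eh u x).1 +ᵥ x)) (hehQ u x)
      rwa [show 2 * s + 2 * s = 4 * s by ring] at this
    · have hs : 0 ≤ s ∨ s < 0 := le_or_gt 0 s
      rcases hs with hs | hs
      · exact Q_mono (by omega) (hehQ u x)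
      · rw [mem_Q]; intro i
        have := (mem_Q.1 (hQs u x)) i
        omega
  · refine bijOn_shortcut (fun q : Ω × U => isT q.2) _ _ eM hbe ?_ ?_ _ ?_ ?_
    · rintro ⟨x, u⟩ h
      simp only [Set.mem_ofPred_eq, hT u h]
    · rintro ⟨x, u⟩ hx h
      exact (hgood _ (hVs u x)).2 _ (hsrc0 x u hx) h
    · rintro ⟨x, u⟩ h
      simp only [F, eM] at h ⊢
      simp only [if_neg h]
    · rintro ⟨x, u⟩ h
      simp only [F, eM] at h ⊢
      simp only [if_pos h, vadd_vadd]

end glue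
end BDE

namespace BDE

section tiles
variable {J : Type} [Fintype J] [DecidableEq J]
variable {Ω : Type} [MeasurableSpace Ω] [AddAction (J → ℤ) Ω]

open Classical in
theorem meas_finset {α β : Type} [MeasurableSpace β] (T : Finset α) (P : α → Ω → Prop)
    (hP : ∀ a, MeasurableSet {x | P a x}) (H : Finset α → β) :
    Measurable (fun x => H (T.filter (fun a => P a x))) := by
  let dat : Ω → (T → Prop) := fun x a => P a x
  have hdat : Measurable dat := measurable_pi_iff.2 fun a => measurableSet_setOfPred.1 (hP a)
  have : (fun x => H (T.filter (fun a => P a x))) =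
      (fun d : T → Prop => H (T.filter (fun a => ∃ h : a ∈ T, d ⟨a, h⟩))) ∘ dat := by
    funext x
    simp only [Function.comp, dat]
    congr 1
    refine Finset.filter_congr fun a ha => ?_
    exact ⟨fun h => ⟨ha, h⟩, fun ⟨_, h⟩ => h⟩
  rw [this]
  exact Measurable.of_discrete.comp hdat

/-- translation-invariant total order key -/
noncomputable def key (g : J → ℤ) : Lex (Fin (Fintype.card J) → ℤ) :=
  toLex (fun k => g ((Fintype.equivFin J).symm k))

theorem key_inj {g h : J → ℤ} (e : key g = key h) : g = h := by
  funext i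
  have := congrFun (toLex.injective e) (Fintype.equivFin J i)
  simpa using this

theorem key_sub (g h : J → ℤ) : key (g - h) = key g - key h := rfl

theorem exists_sel (J : Type) [Fintype J] [DecidableEq J] : ∃ sel : Finset (J → ℤ) → (J → ℤ),
    (∀ C, C.Nonempty → sel C ∈ C) ∧
    (∀ (C C' : Finset (J → ℤ)) (v : J → ℤ), C.Nonempty → (∀ g, g ∈ C ↔ g - v ∈ C') → sel C' = sel C - v) := by
  classical
  let sel : Finset (J → ℤ) → (J → ℤ) := fun C =>
    if h : C.Nonempty then (Finset.exists_min_image C key h).choose else 0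
  have h1 : ∀ C, C.Nonempty → sel C ∈ C ∧ ∀ g ∈ C, key (sel C) ≤ key g := by
    intro C h
    simp only [sel, dif_pos h]
    exact (Finset.exists_min_image C key h).choose_spec
  refine ⟨sel, fun C h => (h1 C h).1, ?_⟩
  intro C C' v hC hCC
  have hC' : C'.Nonempty := by
    obtain ⟨g, hg⟩ := hC; exact ⟨_, (hCC g).1 hg⟩
  have a := h1 C hC
  have b := h1 C' hC'
  apply key_inj
  apply le_antisymm
  · exact b.2 _ ((hCC _).1 a.1)
  · rw [key_sub, sub_le_iff_le_add]
    have := a.2 (sel C' + v) ((hCC _).2 (by simpa using b.1))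
    have e : key (sel C' + v) = key (sel C') + key v := rfl
    rwa [e] at this

theorem tiles (hm : ∀ g : J → ℤ, Measurable (fun x : Ω => g +ᵥ x)) (hcol : HasCol J Ω) (ρ : ℤ) (hρ : 1 ≤ ρ) :
    ∃ (V : Set Ω) (κ : Ω → (J → ℤ)), MeasurableSet V ∧ Measurable κ ∧ (∀ x, κ x ∈ Q J (2 * ρ)) ∧
      (∀ x, κ x +ᵥ x ∈ V) ∧ (∀ x ∈ V, ∀ g ∈ Q J (2 * ρ), g +ᵥ x ∈ V → g = 0) ∧
      (∀ p ∈ V, ∀ g ∈ Q J ρ, κ (g +ᵥ p) = -g) ∧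
      (∀ x i, κ (ev i +ᵥ x) ≠ κ x - ev i →
        ∃ g : J → ℤ, g +ᵥ x ∈ V ∧ (sg (2 * ρ) (g - ev i) i ≠ 0 ∨ sg ρ (g - ev i) i ≠ 0)) := by
  classical
  obtain ⟨c, hc, hcc⟩ := hcol (2 * ρ)
  obtain ⟨V, hV, hsep, hdense⟩ := markers hm (2 * ρ) (by omega) c hc hcc
  obtain ⟨sel, hsel1, hsel2⟩ := exists_sel J
  let H : Finset (J → ℤ) → (J → ℤ) := fun C =>
    if (C.filter (fun g => g ∈ Q J ρ)).Nonempty then sel (C.filter (fun g => g ∈ Q J ρ)) else sel C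
  let C : Ω → Finset (J → ℤ) := fun x => (Q J (2 * ρ)).filter (fun g => g +ᵥ x ∈ V)
  have hC : ∀ x g, g ∈ C x ↔ g ∈ Q J (2 * ρ) ∧ g +ᵥ x ∈ V := fun x g => Finset.mem_filter
  have hCne : ∀ x, (C x).Nonempty := fun x => by
    obtain ⟨g, hg, h⟩ := hdense x
    exact ⟨g, (hC x g).2 ⟨hg, h⟩⟩
  have hHmem : ∀ D : Finset (J → ℤ), D.Nonempty → H D ∈ D := by
    intro D hD
    simp only [H]
    split_ifs with h
    · exact (Finset.mem_filter.1 (hsel1 _ h)).1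
    · exact hsel1 _ hD
  let κ : Ω → (J → ℤ) := fun x => H (C x)
  have hκC : ∀ x, κ x ∈ C x := fun x => hHmem _ (hCne x)
  refine ⟨V, κ, hV, meas_finset _ _ (fun g => hm g hV) H, fun x => ((hC _ _).1 (hκC x)).1,
    fun x => ((hC _ _).1 (hκC x)).2, hsep, ?_, ?_⟩
  · intro p hp g hg
    have hne : ((C (g +ᵥ p)).filter (fun g => g ∈ Q J ρ)).Nonempty := by
      refine ⟨-g, Finset.mem_filter.2 ⟨(hC _ _).2 ⟨Q_mono (by omega) (Q_neg_mem hg), by simpa using hp⟩, Q_neg_mem hg⟩⟩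
    have h1 : κ (g +ᵥ p) = sel ((C (g +ᵥ p)).filter (fun g => g ∈ Q J ρ)) := if_pos hne
    have h2 := Finset.mem_filter.1 (hsel1 _ hne)
    rw [← h1] at h2
    have h3 := ((hC _ _).1 h2.1).2
    rw [vadd_vadd] at h3
    have := hsep p hp (κ (g +ᵥ p) + g) (by rw [two_mul]; exact Q_add_mem h2.2 hg) h3
    exact eq_neg_of_add_eq_zero_left this
  · intro x i hne
    by_contra hcon
    push Not at hcon
    apply hne
    have hiff : ∀ (r : ℤ) (g : J → ℤ), sg r (g - ev i) i = 0 → (g ∈ Q J r ↔ g - ev i ∈ Q J r) := by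
      intro r g h
      unfold sg at h
      rw [sub_add_cancel] at h
      split_ifs at h with a b b <;> simp_all
    have hmV : ∀ g : J → ℤ, (g - ev i) +ᵥ (ev i +ᵥ x) = g +ᵥ x := fun g => by
      rw [vadd_vadd, sub_add_cancel]
    have e1 : ∀ g, g ∈ C x ↔ g - ev i ∈ C (ev i +ᵥ x) := by
      intro g
      rw [hC, hC, hmV]
      constructor
      · rintro ⟨a, b⟩; exact ⟨(hiff _ _ (hcon g b).1).1 a, b⟩
      · rintro ⟨a, b⟩; exact ⟨(hiff _ _ (hcon g b).1).2 a, b⟩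
    have e2 : ∀ g, g ∈ (C x).filter (fun g => g ∈ Q J ρ) ↔ g - ev i ∈ (C (ev i +ᵥ x)).filter (fun g => g ∈ Q J ρ) := by
      intro g
      refine Iff.trans Finset.mem_filter (Iff.trans ?_ Finset.mem_filter.symm)
      rw [← e1]
      constructor
      · rintro ⟨a, b⟩; exact ⟨a, (hiff _ _ (hcon g ((hC _ _).1 a).2).2).1 b⟩
      · rintro ⟨a, b⟩; exact ⟨a, (hiff _ _ (hcon g ((hC _ _).1 a).2).2).2 b⟩
    simp only [κ, H]
    by_cases hn : ((C x).filter (fun g => g ∈ Q J ρ)).Nonempty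
    · have hn' : ((C (ev i +ᵥ x)).filter (fun g => g ∈ Q J ρ)).Nonempty := by
        obtain ⟨g, hg⟩ := hn; exact ⟨_, (e2 g).1 hg⟩
      rw [if_pos hn, if_pos hn']
      exact hsel2 _ _ _ hn e2
    · have hn' : ¬ ((C (ev i +ᵥ x)).filter (fun g => g ∈ Q J ρ)).Nonempty := by
        rintro ⟨g, hg⟩
        exact hn ⟨g + ev i, (e2 _).2 (by simpa using hg)⟩
      rw [if_neg hn, if_neg hn']
      exact hsel2 _ _ _ (hCne x) e1

end tiles
end BDE

namespace BDE

section step3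
variable {J : Type} [Fintype J] [DecidableEq J]
variable {Ω : Type} [MeasurableSpace Ω] [AddAction (J → ℤ) Ω]

theorem card_Q_le {a b : ℤ} (c : ℕ) (ha : 0 ≤ a) (hb : 0 ≤ b) (h : 2 * b + 1 ≤ c * (2 * a + 1)) :
    (Q J b).card ≤ c ^ Fintype.card J * (Q J a).card := by
  have h1 := card_Q (J := J) ha
  have h2 := card_Q (J := J) hb
  have : ((Q J b).card : ℤ) ≤ ((c ^ Fintype.card J * (Q J a).card : ℕ) : ℤ) := by
    push_cast
    rw [h1, h2, ← mul_pow]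
    exact pow_le_pow_left₀ (by omega) h _
  exact_mod_cast this

theorem rho_arith (P k T1 T2 q Q1 Q2 : ℝ) (hP1 : 1 ≤ P) (hk : 0 ≤ k) (hT1 : 0 ≤ T1)
    (a1 : (k * P * P * 2) * T1 ≤ Q1) (a2 : (k * P * P * 2) * T2 ≤ Q2) (b1 : Q1 ≤ P * q)
    (b2 : Q2 ≤ P * Q1) : k * T1 + k * T2 ≤ q := by
  have hP0 : 0 < P := by linarith
  have c1 : P * (P * (2 * (k * T1))) ≤ P * q := by linarith
  have c2 : P * (P * (2 * (k * T2))) ≤ P * (P * q) := by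
    have := mul_le_mul_of_nonneg_left b1 hP0.le
    linarith
  have d1 := le_of_mul_le_mul_left c1 hP0
  have d2 := le_of_mul_le_mul_left (le_of_mul_le_mul_left c2 hP0) hP0
  have hn : 0 ≤ k * T1 := mul_nonneg hk hT1
  have d3 : 2 * (k * T1) ≤ P * (2 * (k * T1)) := le_mul_of_one_le_left (by linarith) hP1
  linarith

theorem choose_rho (J : Type) [Fintype J] [DecidableEq J] (K : ℕ) (R : ℤ) (hR : 0 ≤ R) : ∃ ρ : ℤ, 1 ≤ ρ ∧ R ≤ ρ ∧
    K * ((S J (2 * ρ) 1).card + (S J ρ 1).card) * (Q J R).card ≤ (Q J (ρ - R)).card := by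
  set C : ℝ := K * (Q J R).card * 2 ^ Fintype.card J * 2 ^ Fintype.card J * 2 with hC
  obtain ⟨ρ₀, h⟩ := shell_small (J := J) 1 (by norm_num) C
  refine ⟨max (max ρ₀ (2 * R)) 1, by omega, by omega, ?_⟩
  set ρ := max (max ρ₀ (2 * R)) 1 with hρ
  have a1 := h ρ (by omega)
  have a2 := h (2 * ρ) (by omega)
  have b1 : (Q J ρ).card ≤ 2 ^ Fintype.card J * (Q J (ρ - R)).card :=
    card_Q_le 2 (by omega) (by omega) (by push_cast; omega)
  have b2 : (Q J (2 * ρ)).card ≤ 2 ^ Fintype.card J * (Q J ρ).card :=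
    card_Q_le 2 (by omega) (by omega) (by push_cast; omega)
  have b1' : ((Q J ρ).card : ℝ) ≤ 2 ^ Fintype.card J * (Q J (ρ - R)).card := by exact_mod_cast b1
  have b2' : ((Q J (2 * ρ)).card : ℝ) ≤ 2 ^ Fintype.card J * (Q J ρ).card := by exact_mod_cast b2
  have := rho_arith (2 ^ Fintype.card J) (K * (Q J R).card) (S J ρ 1).card (S J (2 * ρ) 1).card (Q J (ρ - R)).card
    (Q J ρ).card (Q J (2 * ρ)).card (one_le_pow₀ (by norm_num)) (mul_nonneg (Nat.cast_nonneg _) (Nat.cast_nonneg _))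
    (Nat.cast_nonneg _) a1 a2 b1' b2'
  have e : ((K * ((S J (2 * ρ) 1).card + (S J ρ 1).card) * (Q J R).card : ℕ) : ℝ) ≤ ((Q J (ρ - R)).card : ℝ) := by
    push_cast; linarith
  exact_mod_cast e

theorem sum_shift (s : ℤ) (f : (J → ℤ) → ℤ) (hf : ∀ g, g ∉ Q J (s - 1) → f g = 0) (i : J) :
    ∑ g ∈ Q J s, f (g + ev i) = ∑ g ∈ Q J s, f g := by
  have h1 : ∑ g ∈ Q J s, f g = ∑ g ∈ Q J (s - 1), f g := by
    refine (Finset.sum_subset (Q_mono (by omega)) fun g _ h => hf g h).symm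
  have h2 : ∑ g ∈ Q J s, f (g + ev i) = ∑ g ∈ (Q J s).filter (fun g => g + ev i ∈ Q J (s - 1)), f (g + ev i) := by
    rw [Finset.sum_filter]
    refine Finset.sum_congr rfl fun g _ => ?_
    split_ifs with h
    · rfl
    · exact hf _ h
  rw [h1, h2]
  refine Finset.sum_bij' (fun g _ => g + ev i) (fun g _ => g - ev i) ?_ ?_ ?_ ?_ ?_
  · intro g hg; exact (Finset.mem_filter.1 hg).2
  · intro g hg
    refine Finset.mem_filter.2 ⟨?_, by simpa using hg⟩
    have := Q_sub_mem hg (ev_mem_Q i)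
    simpa using this
  · intro g _; simp
  · intro g _; simp
  · intro g _; rfl

end step3
end BDE

namespace BDE

section step3
variable {J : Type} [Fintype J] [DecidableEq J]
variable {Ω : Type} [MeasurableSpace Ω] [AddAction (J → ℤ) Ω]

theorem card_eq_aux {L : Type} [Fintype L] [DecidableEq L] (ρ : ℤ) (M : ℕ)
    (τ : (J → ℤ) → Prop) [DecidablePred τ] (hτ : ∀ g, τ g → g ∈ Q J (2 * ρ))
    (a b : (J → ℤ) → L → Prop) [∀ g, DecidablePred (a g)] [∀ g, DecidablePred (b g)]
    (ψ : J → (J → ℤ) → ℕ) (hψ : ∀ i g, ψ i g ≤ M)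
    (hdvg : ∀ g, (∑ l, if a g l then (1 : ℤ) else 0) - (∑ l, if b g l then (1 : ℤ) else 0) =
      ∑ i, ((ψ i g : ℤ) - ψ i (g - ev i)))
    (X Y : Finset (Q J (2 * ρ + 1) × (L ⊕ (J × Fin M))))
    (hX1 : ∀ g l, (g, Sum.inl l) ∈ X ↔ τ g ∧ a g l)
    (hX2 : ∀ (g : Q J (2 * ρ + 1)) i k, (g, Sum.inr (i, k)) ∈ X ↔ (τ (g + ev i) ∧ ¬ τ g) ∧ (k : ℕ) < ψ i g)
    (hY1 : ∀ g l, (g, Sum.inl l) ∈ Y ↔ τ g ∧ b g l)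
    (hY2 : ∀ (g : Q J (2 * ρ + 1)) i k, (g, Sum.inr (i, k)) ∈ Y ↔ (τ g ∧ ¬ τ (g + ev i)) ∧ (k : ℕ) < ψ i g) :
    X.card = Y.card := by
  classical
  have hcard : ∀ X : Finset (Q J (2 * ρ + 1) × (L ⊕ (J × Fin M))), (X.card : ℤ) =
      ∑ g : Q J (2 * ρ + 1), ((∑ l, if (g, Sum.inl l) ∈ X then (1 : ℤ) else 0) +
        ∑ i, ∑ k, if (g, Sum.inr (i, k)) ∈ X then (1 : ℤ) else 0) := by
    intro X
    have : (X.card : ℤ) = ∑ e, if e ∈ X then (1 : ℤ) else 0 := by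
      rw [Finset.sum_ite_mem, Finset.univ_inter, Finset.sum_const, nsmul_eq_mul, mul_one]
    rw [this, Fintype.sum_prod_type]
    refine Finset.sum_congr rfl fun g _ => ?_
    rw [Fintype.sum_sum_type, Fintype.sum_prod_type]
  have hcount : ∀ n, n ≤ M → (∑ k : Fin M, if (k : ℕ) < n then (1 : ℤ) else 0) = n := by
    intro n hn
    rw [Fin.sum_univ_eq_sum_range (fun k => if k < n then (1 : ℤ) else 0) M, ← Finset.sum_filter, Finset.sum_const]
    have : (Finset.range M).filter (fun k => k < n) = Finset.range n := by
      ext k; simp; omega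
    rw [this]; simp
  let t : (J → ℤ) → ℤ := fun g => if τ g then 1 else 0
  have hXc : (X.card : ℤ) = ∑ g ∈ Q J (2 * ρ + 1), (t g * (∑ l, if a g l then (1 : ℤ) else 0) +
      ∑ i, t (g + ev i) * (1 - t g) * ψ i g) := by
    rw [hcard X, ← Finset.sum_coe_sort (Q J (2 * ρ + 1))]
    refine Finset.sum_congr rfl fun g _ => ?_
    congr 1
    · rw [Finset.mul_sum]
      refine Finset.sum_congr rfl fun l _ => ?_
      simp only [hX1, t]
      by_cases h1 : τ g <;> by_cases h2 : a g l <;> simp [h1, h2]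
    · refine Finset.sum_congr rfl fun i _ => ?_
      rw [← hcount (ψ i g) (hψ i g), Finset.mul_sum]
      refine Finset.sum_congr rfl fun k _ => ?_
      simp only [hX2, t]
      by_cases h1 : τ g <;> by_cases h2 : τ (g + ev i) <;> simp [h1, h2]
  have hYc : (Y.card : ℤ) = ∑ g ∈ Q J (2 * ρ + 1), (t g * (∑ l, if b g l then (1 : ℤ) else 0) +
      ∑ i, t g * (1 - t (g + ev i)) * ψ i g) := by
    rw [hcard Y, ← Finset.sum_coe_sort (Q J (2 * ρ + 1))]
    refine Finset.sum_congr rfl fun g _ => ?_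
    congr 1
    · rw [Finset.mul_sum]
      refine Finset.sum_congr rfl fun l _ => ?_
      simp only [hY1, t]
      by_cases h1 : τ g <;> by_cases h2 : b g l <;> simp [h1, h2]
    · refine Finset.sum_congr rfl fun i _ => ?_
      rw [← hcount (ψ i g) (hψ i g), Finset.mul_sum]
      refine Finset.sum_congr rfl fun k _ => ?_
      simp only [hY2, t]
      by_cases h1 : τ g <;> by_cases h2 : τ (g + ev i) <;> simp [h1, h2]
  have : (X.card : ℤ) = Y.card := by
    rw [← sub_eq_zero, hXc, hYc, ← Finset.sum_sub_distrib]
    have h1 : ∀ g ∈ Q J (2 * ρ + 1), (t g * (∑ l, if a g l then (1 : ℤ) else 0) +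
      ∑ i, t (g + ev i) * (1 - t g) * ψ i g) - (t g * (∑ l, if b g l then (1 : ℤ) else 0) +
      ∑ i, t g * (1 - t (g + ev i)) * ψ i g) = ∑ i, (t (g + ev i) * ψ i g - t g * ψ i (g - ev i)) := by
      intro g _
      have e1 : (∑ l, if a g l then (1 : ℤ) else 0) = (∑ l, if b g l then (1 : ℤ) else 0) + ∑ i, ((ψ i g : ℤ) - ψ i (g - ev i)) := by
        rw [← hdvg g]; ring
      rw [e1, mul_add, Finset.mul_sum (s := (Finset.univ : Finset J))]
      rw [add_assoc, add_sub_add_left_eq_sub, ← Finset.sum_add_distrib, ← Finset.sum_sub_distrib]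
      refine Finset.sum_congr rfl fun i _ => ?_
      ring
    rw [Finset.sum_congr rfl h1, Finset.sum_comm]
    refine Finset.sum_eq_zero fun i _ => ?_
    rw [Finset.sum_sub_distrib, sub_eq_zero]
    have := sum_shift (2 * ρ + 1) (fun g => t g * ψ i (g - ev i)) (fun g hg => ?_) i
    · simpa using this
    · have : ¬ τ g := fun h => hg (by simpa using hτ g h)
      simp [t, this]
  exact_mod_cast this

theorem card_le_aux {L : Type} [Fintype L] [DecidableEq L] (ρ R : ℤ) (hρ : 1 ≤ ρ) (hR : 0 ≤ R) (hRρ : R ≤ ρ) (M : ℕ)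
    (V : (J → ℤ) → Prop)
    (hsep : ∀ p q, V p → V q → q - p ∈ Q J (2 * ρ) → p = q)
    (X Y : Finset (Q J (2 * ρ + 1) × (L ⊕ (J × Fin M))))
    (hX2 : ∀ (g : Q J (2 * ρ + 1)) i k, (g, Sum.inr (i, k)) ∈ X → (g : J → ℤ) + ev i ∈ Q J (2 * ρ) ∧
      ∃ h : J → ℤ, V (h + g) ∧ (sg (2 * ρ) (h - ev i) i ≠ 0 ∨ sg ρ (h - ev i) i ≠ 0))
    (B : (J → ℤ) → L → Prop)
    (hsyn : ∀ g, ∃ f ∈ Q J R, ∃ l, B (f + g) l)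
    (hY1 : ∀ (g : Q J (2 * ρ + 1)) l, (g : J → ℤ) ∈ Q J ρ → B g l → (g, Sum.inl l) ∈ Y)
    (hK : (5 ^ Fintype.card J * Fintype.card J * M) * ((S J (2 * ρ) 1).card + (S J ρ 1).card) * (Q J R).card ≤ (Q J (ρ - R)).card) :
    (X.filter (fun e => e.2.isRight)).card ≤ (Y.filter (fun e => ¬ e.2.isRight)).card := by
  classical
  -- upper bound
  let P : Finset (J → ℤ) := (Q J (4 * ρ + 1)).filter V
  have hPc : P.card ≤ 5 ^ Fintype.card J := by
    have h1 := packing (P := P) (a := ρ) (Finset.filter_subset _ _)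
      (fun p hp q hq h => hsep p q (Finset.mem_filter.1 hp).2 (Finset.mem_filter.1 hq).2 h)
    have h2 : (Q J (ρ + (4 * ρ + 1))).card ≤ 5 ^ Fintype.card J * (Q J ρ).card :=
      card_Q_le 5 (by omega) (by omega) (by push_cast; omega)
    exact Nat.le_of_mul_le_mul_right (h1.trans h2) (card_Q_pos (by omega))
  let Sh : Finset (J → ℤ) := S J (2 * ρ) 1 ∪ S J ρ 1
  have hX : (X.filter (fun e => e.2.isRight)).card ≤
      (5 ^ Fintype.card J * Fintype.card J * M) * ((S J (2 * ρ) 1).card + (S J ρ 1).card) := by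
    let T := (P ×ˢ Sh) ×ˢ (Finset.univ : Finset (J × Fin M))
    let Ψ : ((J → ℤ) × (J → ℤ)) × (J × Fin M) → (J → ℤ) × (L ⊕ (J × Fin M)) :=
      fun w => (w.1.1 - ev w.2.1 - w.1.2, Sum.inr w.2)
    let Φ : Q J (2 * ρ + 1) × (L ⊕ (J × Fin M)) → (J → ℤ) × (L ⊕ (J × Fin M)) := fun e => (e.1, e.2)
    have hΦ : Function.Injective Φ := by
      rintro ⟨g, u⟩ ⟨g', u'⟩ h
      simp only [Φ, Prod.mk.injEq] at h
      exact Prod.ext (Subtype.ext h.1) h.2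
    have hsub : (X.filter (fun e => e.2.isRight)).image Φ ⊆ T.image Ψ := by
      intro w hw
      obtain ⟨⟨g, u⟩, he, rfl⟩ := Finset.mem_image.1 hw
      obtain ⟨he1, he2⟩ := Finset.mem_filter.1 he
      rcases u with l | ⟨i, k⟩
      · simp at he2
      · obtain ⟨hg, h, hV, hs⟩ := hX2 g i k he1
        have hσ : h - ev i ∈ Sh := by
          rcases hs with hs | hs
          · exact Finset.mem_union_left _ (cut_mem_S hs)
          · exact Finset.mem_union_right _ (cut_mem_S hs)
        have hσQ : h - ev i ∈ Q J (2 * ρ + 1) := by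
          rcases hs with hs | hs
          · exact S_subset (cut_mem_S hs)
          · exact Q_mono (by omega) (S_subset (cut_mem_S hs))
        refine Finset.mem_image.2 ⟨((h + g, h - ev i), (i, k)), ?_, ?_⟩
        · refine Finset.mem_product.2 ⟨Finset.mem_product.2 ⟨Finset.mem_filter.2 ⟨?_, hV⟩, hσ⟩, Finset.mem_univ _⟩
          have := Q_add_mem hσQ hg
          rw [show h - ev i + ((g : J → ℤ) + ev i) = h + g by abel] at this
          exact Q_mono (by omega) this
        · simp only [Ψ, Φ]
          congr 1
          abel
    calc (X.filter (fun e => e.2.isRight)).card = ((X.filter (fun e => e.2.isRight)).image Φ).card :=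
          (Finset.card_image_of_injective _ hΦ).symm
      _ ≤ (T.image Ψ).card := Finset.card_le_card hsub
      _ ≤ T.card := Finset.card_image_le
      _ = P.card * Sh.card * (Fintype.card J * M) := by simp [T, Finset.card_product]
      _ ≤ 5 ^ Fintype.card J * ((S J (2 * ρ) 1).card + (S J ρ 1).card) * (Fintype.card J * M) := by
          gcongr
          exact Finset.card_union_le _ _
      _ = _ := by ring
  -- lower bound
  let H : Finset (J → ℤ) := (Q J ρ).filter (fun g => ∃ l, B g l)
  have hH1 : (Q J (ρ - R)).card ≤ H.card * (Q J R).card := by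
    rw [← Finset.card_product]
    refine (Finset.card_le_card ?_).trans (Finset.card_image_le (f := fun w : (J → ℤ) × (J → ℤ) => w.1 - w.2))
    intro y hy
    obtain ⟨f, hf, l, hl⟩ := hsyn y
    refine Finset.mem_image.2 ⟨(f + y, f), Finset.mem_product.2 ⟨Finset.mem_filter.2 ⟨?_, l, hl⟩, hf⟩, by simp⟩
    have := Q_add_mem hf hy
    simpa using this
  have hH2 : H.card ≤ (Y.filter (fun e => ¬ e.2.isRight)).card := by
    refine (Finset.card_le_card ?_).trans (Finset.card_image_le (f := fun e : Q J (2 * ρ + 1) × (L ⊕ (J × Fin M)) => (e.1 : J → ℤ)))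
    intro g hg
    obtain ⟨h1, l, hl⟩ := Finset.mem_filter.1 hg
    refine Finset.mem_image.2 ⟨(⟨g, Q_mono (by omega) h1⟩, Sum.inl l), Finset.mem_filter.2 ⟨hY1 _ l h1 hl, by simp⟩, rfl⟩
  refine le_trans ?_ hH2
  refine Nat.le_of_mul_le_mul_right (c := (Q J R).card) ?_ (card_Q_pos hR)
  calc _ ≤ _ := Nat.mul_le_mul_right _ hX
    _ ≤ _ := hK
    _ ≤ _ := hH1

end step3
end BDE

namespace BDE

section step3
variable {J : Type} [Fintype J] [DecidableEq J]
variable {Ω : Type} [MeasurableSpace Ω] [AddAction (J → ℤ) Ω]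

theorem step3 (hm : ∀ g : J → ℤ, Measurable (fun x : Ω => g +ᵥ x)) (hcol : HasCol J Ω)
    {L : Type} [Fintype L] [DecidableEq L] (A B : L → Set Ω)
    (hA : ∀ l, MeasurableSet (A l)) (hB : ∀ l, MeasurableSet (B l))
    (ψ : J → Ω → ℕ) (hψm : ∀ i, Measurable (ψ i)) (M : ℕ) (hψ : ∀ i x, ψ i x ≤ M)
    (hdvg : ∀ x, (∑ l, (A l).indicator (fun _ => (1 : ℤ)) x) - (∑ l, (B l).indicator (fun _ => (1 : ℤ)) x) =
      ∑ i, ((ψ i x : ℤ) - ψ i (-ev i +ᵥ x)))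
    (R : ℤ) (hR : 0 ≤ R) (hsyn : ∀ x, ∃ g ∈ Q J R, ∃ l, g +ᵥ x ∈ B l) :
    ∃ (b : ℤ) (F : L → Ω → (J → ℤ) × L), (∀ l p, MeasurableSet {x | F l x = p}) ∧
      (∀ l x, (F l x).1 ∈ Q J b) ∧
      Set.BijOn (fun q : Ω × L => ((F q.2 q.1).1 +ᵥ q.1, (F q.2 q.1).2))
        {q | q.1 ∈ A q.2} {q | q.1 ∈ B q.2} := by
  classical
  obtain ⟨ρ, hρ, hRρ, hK⟩ := choose_rho J (5 ^ Fintype.card J * Fintype.card J * M) R hR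
  obtain ⟨V, κ, hV, hκ, hκQ, hκV, hsep, hκρ, hcut⟩ := tiles hm hcol ρ hρ
  let _ : MeasurableSpace (L ⊕ (J × Fin M)) := ⊤
  have : MeasurableSingletonClass (L ⊕ (J × Fin M)) := ⟨fun _ => trivial⟩
  let isT : L ⊕ (J × Fin M) → Prop := fun u => u.isRight = true
  let κs : L ⊕ (J × Fin M) → Ω → (J → ℤ) := fun u x => Sum.elim (fun _ => κ x) (fun w => κ (ev w.1 +ᵥ x) + ev w.1) u
  let κt : L ⊕ (J × Fin M) → Ω → (J → ℤ) := fun _ x => κ x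
  let XX : J → ℕ → Set Ω := fun i k => {x | κ (ev i +ᵥ x) ≠ κ x - ev i ∧ k < ψ i x}
  let Src : L ⊕ (J × Fin M) → Set Ω := fun u => Sum.elim A (fun w => XX w.1 w.2) u
  let Tgt : L ⊕ (J × Fin M) → Set Ω := fun u => Sum.elim B (fun w => XX w.1 w.2) u
  have hXX : ∀ i k, MeasurableSet (XX i k) := by
    intro i k
    refine MeasurableSet.inter ?_ ?_
    · exact (measurableSet_eq_fun (hκ.comp (hm (ev i))) (hκ.sub_const (ev i))).compl
    · exact measurableSet_lt measurable_const (hψm i)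
  have hev : ∀ i, ev i ∈ Q J 1 := fun i => ev_mem_Q i
  obtain ⟨F, hF, hFQ, hFb⟩ := glue hm isT (2 * ρ + 1) V κs κt
    (by
      rintro (l | w)
      · exact hκ
      · exact (hκ.comp (hm (ev w.1))).add_const (ev w.1))
    (fun u => hκ)
    (by
      rintro (l | w) x
      · exact Q_mono (by omega) (hκQ x)
      · exact Q_add_mem (hκQ _) (hev w.1))
    (fun u x => Q_mono (by omega) (hκQ x))
    (by
      rintro (l | w) x
      · exact hκV x
      · have := hκV (ev w.1 +ᵥ x)
        rwa [vadd_vadd] at this)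
    (fun u x => hκV x) Src Tgt
    (by
      rintro (l | w)
      · exact hA l
      · exact hXX _ _)
    (by
      rintro (l | w)
      · exact hB l
      · exact hXX _ _)
    (by
      rintro (l | w) h
      · simp [isT] at h
      · rfl)
    (by
      intro p hp
      let X : Finset (Q J (2 * ρ + 1) × (L ⊕ (J × Fin M))) := Finset.univ.filter (fun e => κs e.2 ((e.1 : J → ℤ) +ᵥ p) = -(e.1 : J → ℤ) ∧ (e.1 : J → ℤ) +ᵥ p ∈ Src e.2)
      let Y : Finset (Q J (2 * ρ + 1) × (L ⊕ (J × Fin M))) := Finset.univ.filter (fun e => κt e.2 ((e.1 : J → ℤ) +ᵥ p) = -(e.1 : J → ℤ) ∧ (e.1 : J → ℤ) +ᵥ p ∈ Tgt e.2)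
      let τ : (J → ℤ) → Prop := fun g => κ (g +ᵥ p) = -g
      have hX1 : ∀ g l, (g, Sum.inl l) ∈ X ↔ τ g ∧ (g : J → ℤ) +ᵥ p ∈ A l := by
        intro g l
        simp [X, τ, κs, Src]
      have hY1 : ∀ g l, (g, Sum.inl l) ∈ Y ↔ τ g ∧ (g : J → ℤ) +ᵥ p ∈ B l := by
        intro g l
        simp [Y, τ, κt, Tgt]
      have hX2 : ∀ (g : Q J (2 * ρ + 1)) i k, (g, Sum.inr (i, k)) ∈ X ↔ (τ (g + ev i) ∧ ¬ τ g) ∧ (k : ℕ) < ψ i ((g : J → ℤ) +ᵥ p) := by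
        intro g i k
        simp only [X, τ, κs, Src, XX, Finset.mem_filter, Finset.mem_univ, true_and, Sum.elim_inr, Set.mem_ofPred_eq, vadd_vadd, add_comm (ev i) (g : J → ℤ)]
        constructor
        · rintro ⟨h1, h2, h3⟩
          have h4 : κ (((g : J → ℤ) + ev i) +ᵥ p) = -((g : J → ℤ) + ev i) := by
            rw [eq_sub_of_add_eq h1]; abel
          refine ⟨⟨h4, fun h5 => h2 ?_⟩, h3⟩
          rw [h4, h5]; abel
        · rintro ⟨⟨h1, h2⟩, h3⟩
          refine ⟨by rw [h1]; abel, fun h5 => h2 ?_, h3⟩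
          rw [h1] at h5
          have := eq_add_of_sub_eq h5.symm
          rw [this]; abel
      have hY2 : ∀ (g : Q J (2 * ρ + 1)) i k, (g, Sum.inr (i, k)) ∈ Y ↔ (τ g ∧ ¬ τ (g + ev i)) ∧ (k : ℕ) < ψ i ((g : J → ℤ) +ᵥ p) := by
        intro g i k
        simp only [Y, τ, κt, Tgt, XX, Finset.mem_filter, Finset.mem_univ, true_and, Sum.elim_inr, Set.mem_ofPred_eq, vadd_vadd, add_comm (ev i) (g : J → ℤ)]
        constructor
        · rintro ⟨h1, h2, h3⟩
          refine ⟨⟨h1, fun h5 => h2 ?_⟩, h3⟩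
          rw [h1, h5]; abel
        · rintro ⟨⟨h1, h2⟩, h3⟩
          refine ⟨h1, fun h5 => h2 ?_, h3⟩
          rw [h5, h1]; abel
      have hτ : ∀ g, τ g → g ∈ Q J (2 * ρ) := by
        intro g hg
        have := hκQ (g +ᵥ p)
        rw [show κ (g +ᵥ p) = -g from hg] at this
        exact Q_neg_mem_iff.1 this
      have hc1 : X.card = Y.card :=
        card_eq_aux ρ M τ hτ (fun g l => g +ᵥ p ∈ A l) (fun g l => g +ᵥ p ∈ B l) (fun i g => ψ i (g +ᵥ p))
          (fun i g => hψ i _) (by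
            intro g
            have := hdvg (g +ᵥ p)
            simp only [Set.indicator_apply, vadd_vadd] at this
            rw [this]
            refine Finset.sum_congr rfl fun i _ => ?_
            rw [sub_eq_neg_add g (ev i)]) X Y hX1 hX2 hY1 hY2
      have hc2 := card_le_aux ρ R hρ hR hRρ M (fun g => g +ᵥ p ∈ V)
        (by
          intro a b ha hb hab
          have := hsep _ ha (b - a) hab (by rw [vadd_vadd, sub_add_cancel]; exact hb)
          exact (sub_eq_zero.1 this).symm) X Y
        (by
          intro g i k h
          obtain ⟨⟨h1, h2⟩, h3⟩ := (hX2 g i k).1 h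
          refine ⟨hτ _ h1, ?_⟩
          obtain ⟨a, ha, ha2⟩ := hcut ((g : J → ℤ) +ᵥ p) i (by
            rw [vadd_vadd, add_comm, show κ (((g : J → ℤ) + ev i) +ᵥ p) = _ from h1]
            intro h5
            apply h2
            have := eq_add_of_sub_eq h5.symm
            show κ _ = _
            rw [this]; abel)
          exact ⟨a, by rw [← vadd_vadd]; exact ha, ha2⟩)
        (fun g l => g +ᵥ p ∈ B l)
        (by
          intro g
          obtain ⟨f, hf, l, hl⟩ := hsyn (g +ᵥ p)
          exact ⟨f, hf, l, by rw [← vadd_vadd]; exact hl⟩)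
        (by
          intro g l hg hl
          exact (hY1 g l).2 ⟨hκρ p hp _ hg, hl⟩)
        hK
      obtain ⟨f, hf1, hf2⟩ := exists_bij_finset X Y _ _ (Finset.filter_subset _ X) (Finset.filter_subset _ Y) hc1 hc2
      refine ⟨f, ?_, ?_⟩
      · convert hf1 using 1 <;> ext e <;> simp [X, Y]
      · intro e he heT
        have := hf2 e (Finset.mem_filter.2 ⟨by simp only [X, Finset.mem_filter, Finset.mem_univ, true_and]; exact he, heT⟩)
        exact (Finset.mem_filter.1 this).2)
  let G : L → (J → ℤ) × (L ⊕ (J × Fin M)) → (J → ℤ) × L := fun l w => (w.1, Sum.elim id (fun _ => l) w.2)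
  refine ⟨4 * (2 * ρ + 1), fun l x => G l (F (Sum.inl l) x), ?_, fun l x => hFQ _ x, ?_⟩
  · intro l p
    have : {x | G l (F (Sum.inl l) x) = p} = F (Sum.inl l) ⁻¹' {w | G l w = p} := rfl
    rw [this]
    exact hF (Sum.inl l) ((Set.to_countable _).measurableSet)
  · have key : ∀ q : Ω × L, q.1 ∈ A q.2 → ∃ l', (F (Sum.inl q.2) q.1).2 = Sum.inl l' := by
      intro q hq
      have := hFb.mapsTo (show ((q.1, Sum.inl q.2) : Ω × (L ⊕ (J × Fin M))) ∈ _ from ⟨by simp [isT], hq⟩)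
      have h1 := this.1
      revert h1
      rcases h : (F (Sum.inl q.2) q.1).2 with l' | w
      · intro _; exact ⟨l', rfl⟩
      · intro h1; exact absurd (by simp [isT, h]) h1
    refine ⟨?_, ?_, ?_⟩
    · intro q hq
      obtain ⟨l', hl'⟩ := key q hq
      have := hFb.mapsTo (show ((q.1, Sum.inl q.2) : Ω × (L ⊕ (J × Fin M))) ∈ _ from ⟨by simp [isT], hq⟩)
      have h2 := this.2
      simp only [hl'] at h2
      simp only [G, hl', Sum.elim_inl, id]
      exact h2
    · intro q hq q' hq' h
      obtain ⟨l1, hl1⟩ := key q hq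
      obtain ⟨l2, hl2⟩ := key q' hq'
      simp only [G, hl1, hl2, Sum.elim_inl, id, Prod.mk.injEq] at h
      have := hFb.injOn (show ((q.1, Sum.inl q.2) : Ω × (L ⊕ (J × Fin M))) ∈ _ from ⟨by simp [isT], hq⟩)
        (show ((q'.1, Sum.inl q'.2) : Ω × (L ⊕ (J × Fin M))) ∈ _ from ⟨by simp [isT], hq'⟩)
        (by simp only [hl1, hl2]; rw [h.1, h.2])
      simp only [Prod.mk.injEq, Sum.inl.injEq] at this
      exact Prod.ext this.1 this.2
    · intro q hq
      obtain ⟨⟨x, u⟩, ⟨hu, hx⟩, he⟩ := hFb.surjOn (show ((q.1, Sum.inl q.2) : Ω × (L ⊕ (J × Fin M))) ∈ _ from ⟨by simp [isT], hq⟩)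
      rcases u with l | w
      · refine ⟨(x, l), hx, ?_⟩
        simp only [Prod.mk.injEq] at he
        simp only [G, he.2, Sum.elim_inl, id]
        exact Prod.ext he.1 rfl
      · exact absurd (by simp [isT]) hu

end step3
end BDE

namespace BDE

section step4
variable {J : Type} [Fintype J] [DecidableEq J]
variable {Ω : Type} [MeasurableSpace Ω] [AddAction (J → ℤ) Ω]

/-- `g` is good if all coboundaries along `g` are divergences of bounded flows -/
def GoodShift (Ω : Type) [MeasurableSpace Ω] [AddAction (J → ℤ) Ω] (g : J → ℤ) : Prop :=
  ∀ u : Ω → ℝ, Measurable u → (∃ M, ∀ x, |u x| ≤ M) →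
    ∃ φ : J → Ω → ℝ, (∀ i, Measurable (φ i)) ∧ (∃ M, ∀ i x, |φ i x| ≤ M) ∧
      ∀ x, dvg φ x = u x - u (-g +ᵥ x)

theorem dvg_add (φ ψ : J → Ω → ℝ) (x : Ω) : dvg (fun i x => φ i x + ψ i x) x = dvg φ x + dvg ψ x := by
  simp only [dvg, ← Finset.sum_add_distrib]
  exact Finset.sum_congr rfl fun i _ => by ring

theorem dvg_neg (φ : J → Ω → ℝ) (x : Ω) : dvg (fun i x => - φ i x) x = - dvg φ x := by
  simp only [dvg, ← Finset.sum_neg_distrib]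
  exact Finset.sum_congr rfl fun i _ => by ring

theorem good_zero : GoodShift Ω (0 : J → ℤ) := by
  intro u _ _
  refine ⟨fun _ _ => 0, fun _ => measurable_const, ⟨0, by simp⟩, fun x => by simp [dvg]⟩

theorem good_add (hm : ∀ g : J → ℤ, Measurable (fun x : Ω => g +ᵥ x)) {g h : J → ℤ}
    (hg : GoodShift Ω g) (hh : GoodShift Ω h) : GoodShift Ω (g + h) := by
  intro u hu hM
  obtain ⟨φ, h1, ⟨M1, hM1⟩, h2⟩ := hg u hu hM
  obtain ⟨ψ, h3, ⟨M2, hM2⟩, h4⟩ := hh (fun x => u (-g +ᵥ x)) (hu.comp (hm _))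
    (by obtain ⟨M, hM⟩ := hM; exact ⟨M, fun x => hM _⟩)
  refine ⟨fun i x => φ i x + ψ i x, fun i => (h1 i).add (h3 i), ⟨M1 + M2, fun i x => (abs_add_le _ _).trans (add_le_add (hM1 i x) (hM2 i x))⟩, ?_⟩
  intro x
  rw [dvg_add, h2, h4]
  simp only [vadd_vadd, neg_add]
  ring

theorem good_neg (hm : ∀ g : J → ℤ, Measurable (fun x : Ω => g +ᵥ x)) {g : J → ℤ}
    (hg : GoodShift Ω g) : GoodShift Ω (-g) := by
  intro u hu hM
  obtain ⟨φ, h1, ⟨M1, hM1⟩, h2⟩ := hg (fun x => u (g +ᵥ x)) (hu.comp (hm _))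
    (by obtain ⟨M, hM⟩ := hM; exact ⟨M, fun x => hM _⟩)
  refine ⟨fun i x => - φ i x, fun i => (h1 i).neg, ⟨M1, fun i x => by rw [abs_neg]; exact hM1 i x⟩, ?_⟩
  intro x
  rw [dvg_neg, h2]
  simp [vadd_vadd]

theorem good_ev (i : J) : GoodShift Ω (ev i) := by
  intro u hu ⟨M, hM⟩
  refine ⟨fun j x => if j = i then u x else 0, fun j => ?_, ⟨|M|, fun j x => ?_⟩, fun x => ?_⟩
  · by_cases h : j = i <;> simp [h, hu]
  · by_cases h : j = i
    · simp only [h, if_true]; exact (hM x).trans (le_abs_self _)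
    · simp [h]
  · simp only [dvg]
    rw [Finset.sum_eq_single i]
    · simp
    · intro j _ hj; simp [hj]
    · simp

theorem good_all (hm : ∀ g : J → ℤ, Measurable (fun x : Ω => g +ᵥ x)) (g : J → ℤ) : GoodShift Ω g := by
  let H : AddSubgroup (J → ℤ) :=
    { carrier := {g | GoodShift Ω g}
      zero_mem' := good_zero
      add_mem' := fun ha hb => good_add hm ha hb
      neg_mem' := fun ha => good_neg hm ha }
  have : g = ∑ i, g i • ev i := by
    ext j
    simp [ev, Finset.sum_apply, Pi.single_apply]
  have h2 : g ∈ H := by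
    rw [this]
    exact sum_mem fun i _ => H.zsmul_mem (good_ev i) _
  exact h2

theorem flow_sum (hm : ∀ g : J → ℤ, Measurable (fun x : Ω => g +ᵥ x)) {ι : Type} (T : Finset ι)
    (u : ι → Ω → ℝ) (hu : ∀ i, Measurable (u i)) (hM : ∀ i, ∃ M, ∀ x, |u i x| ≤ M) (g : ι → J → ℤ) :
    ∃ φ : J → Ω → ℝ, (∀ i, Measurable (φ i)) ∧ (∃ M, ∀ i x, |φ i x| ≤ M) ∧
      ∀ x, dvg φ x = ∑ d ∈ T, (u d x - u d (-g d +ᵥ x)) := by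
  classical
  induction T using Finset.induction_on with
  | empty => exact ⟨fun _ _ => 0, fun _ => measurable_const, ⟨0, by simp⟩, fun x => by simp [dvg]⟩
  | insert a T ha ih =>
    obtain ⟨φ, h1, ⟨M1, hM1⟩, h2⟩ := ih
    obtain ⟨ψ, h3, ⟨M2, hM2⟩, h4⟩ := good_all hm (g a) (u a) (hu a) (hM a)
    refine ⟨fun i x => ψ i x + φ i x, fun i => (h3 i).add (h1 i), ⟨M2 + M1, fun i x => (abs_add_le _ _).trans (add_le_add (hM2 i x) (hM1 i x))⟩, ?_⟩
    intro x
    rw [dvg_add, h2, h4, Finset.sum_insert ha]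

/-- a measurable a.e. property holds on an invariant measurable conull set -/
theorem inv_conull (hm : ∀ g : J → ℤ, Measurable (fun x : Ω => g +ᵥ x)) (ν : Measure Ω)
    (hq : ∀ g : J → ℤ, Measure.QuasiMeasurePreserving (fun x : Ω => g +ᵥ x) ν ν)
    (Y : Set Ω) (hY : MeasurableSet Y) (hY2 : ∀ᵐ x ∂ν, x ∈ Y) :
    ∃ X : Set Ω, MeasurableSet X ∧ (∀ᵐ x ∂ν, x ∈ X) ∧ (∀ (g : J → ℤ) x, g +ᵥ x ∈ X ↔ x ∈ X) ∧ X ⊆ Y := by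
  refine ⟨{x | ∀ g : J → ℤ, g +ᵥ x ∈ Y}, ?_, ?_, ?_, ?_⟩
  · rw [show {x : Ω | ∀ g : J → ℤ, g +ᵥ x ∈ Y} = ⋂ g : J → ℤ, (fun x : Ω => g +ᵥ x) ⁻¹' Y by ext; simp]
    exact MeasurableSet.iInter fun g => hm g hY
  · refine ae_all_iff.2 fun g => ?_
    exact (hq g).ae hY2
  · intro g x
    constructor
    · intro h a
      have := h (a - g)
      rwa [vadd_vadd, sub_add_cancel] at this
    · intro h a
      show a +ᵥ (g +ᵥ x) ∈ Y
      rw [vadd_vadd]; exact h _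
  · intro x hx
    have := hx 0
    rwa [zero_vadd] at this

theorem dvg_indicator {R : Type} [AddCommGroup R] (X : Set Ω) (hX : ∀ (g : J → ℤ) x, g +ᵥ x ∈ X ↔ x ∈ X) (φ : J → Ω → R) (x : Ω) :
    dvg (fun i => X.indicator (φ i)) x = X.indicator (dvg φ) x := by
  classical
  simp only [dvg, Set.indicator_apply, hX]
  by_cases h : x ∈ X <;> simp [h]

theorem dvg_measurable {R : Type} [AddCommGroup R] [MeasurableSpace R] [MeasurableAdd₂ R] [MeasurableSub₂ R]
    (hm : ∀ g : J → ℤ, Measurable (fun x : Ω => g +ᵥ x)) (φ : J → Ω → R)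
    (h : ∀ i, Measurable (φ i)) : Measurable (dvg φ) := by
  unfold dvg
  exact Finset.measurable_fun_sum _ fun i _ => (h i).sub ((h i).comp (hm _))

theorem abstract_main (hm : ∀ g : J → ℤ, Measurable (fun x : Ω => g +ᵥ x)) (hcol : HasCol J Ω)
    (ν : Measure Ω) [IsFiniteMeasure ν]
    (hq : ∀ g : J → ℤ, Measure.QuasiMeasurePreserving (fun x : Ω => g +ᵥ x) ν ν)
    {L : Type} [Fintype L] [DecidableEq L] (A B : L → Set Ω)
    (hA : ∀ l, MeasurableSet (A l)) (hB : ∀ l, MeasurableSet (B l))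
    (φ : J → Ω → ℝ) (hφm : ∀ i, Measurable (φ i)) (hφ : ∃ M, ∀ i x, |φ i x| ≤ M)
    (hdvg : ∀ᵐ x ∂ν, dvg φ x = (∑ l, (A l).indicator (fun _ => (1 : ℝ)) x) - (∑ l, (B l).indicator (fun _ => (1 : ℝ)) x))
    (R : ℤ) (hR : 0 ≤ R) (hsyn : ∀ x, ∃ g ∈ Q J R, ∃ l, g +ᵥ x ∈ B l) :
    ∃ (b : ℤ) (F : L → Ω → (J → ℤ) × L) (X : Set Ω), (∀ l p, MeasurableSet {x | F l x = p}) ∧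
      (∀ l x, (F l x).1 ∈ Q J b) ∧ MeasurableSet X ∧ (∀ᵐ x ∂ν, x ∈ X) ∧ (∀ (g : J → ℤ) x, g +ᵥ x ∈ X ↔ x ∈ X) ∧
      Set.BijOn (fun q : Ω × L => ((F q.2 q.1).1 +ᵥ q.1, (F q.2 q.1).2))
        {q | q.1 ∈ A q.2 ∧ q.1 ∈ X} {q | q.1 ∈ B q.2 ∧ q.1 ∈ X} := by
  classical
  let D : Ω → ℤ := fun x => (∑ l, (A l).indicator (fun _ => (1 : ℤ)) x) - (∑ l, (B l).indicator (fun _ => (1 : ℤ)) x)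
  have hDm : Measurable D :=
    (Finset.measurable_fun_sum _ fun l _ => measurable_const.indicator (hA l)).sub
      (Finset.measurable_fun_sum _ fun l _ => measurable_const.indicator (hB l))
  have hD : ∀ x, ((D x : ℤ) : ℝ) = (∑ l, (A l).indicator (fun _ => (1 : ℝ)) x) - (∑ l, (B l).indicator (fun _ => (1 : ℝ)) x) := by
    intro x
    simp only [D, Set.indicator_apply]
    push_cast
    rfl
  obtain ⟨X1, hX1m, hX1c, hX1i, hX1⟩ := inv_conull hm ν hq {x | dvg φ x = D x}
    (measurableSet_eq_fun (dvg_measurable hm φ hφm) (measurable_from_top.comp hDm))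
    (by filter_upwards [hdvg] with x hx; show _ = _; rw [hx, hD])
  obtain ⟨M, hM⟩ := hφ
  obtain ⟨ψ, C, hψm, hψ, hψd⟩ := rounding hm hcol ν (fun i => X1.indicator (φ i)) (fun i => (hφm i).indicator hX1m)
    (|M|) (by
      intro i x
      by_cases h : x ∈ X1
      · simp only [Set.indicator_of_mem h]; exact (hM i x).trans (le_abs_self _)
      · simp [Set.indicator_of_notMem h])
    (X1.indicator D) (by
      intro x
      rw [dvg_indicator X1 hX1i]
      by_cases h : x ∈ X1
      · rw [Set.indicator_of_mem h, Set.indicator_of_mem h]; exact hX1 h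
      · simp [Set.indicator_of_notMem h])
  obtain ⟨X2, hX2m, hX2c, hX2i, hX2⟩ := inv_conull hm ν hq {x | dvg ψ x = X1.indicator D x}
    (measurableSet_eq_fun (dvg_measurable hm ψ hψm) (hDm.indicator hX1m)) hψd
  let X := X1 ∩ X2
  have hXm : MeasurableSet X := hX1m.inter hX2m
  have hXi : ∀ (g : J → ℤ) x, g +ᵥ x ∈ X ↔ x ∈ X := fun g x => and_congr (hX1i g x) (hX2i g x)
  have hXd : ∀ x ∈ X, dvg ψ x = D x := by
    intro x hx
    have := hX2 hx.2
    rw [Set.mem_ofPred_eq, Set.indicator_of_mem hx.1] at this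
    exact this
  let A' : L → Set Ω := fun l => (A l ∩ X) ∪ (B l \ X)
  let ψ' : J → Ω → ℕ := fun i => X.indicator (fun x => (ψ i x + C).toNat)
  obtain ⟨b, F, hF1, hF2, hF3⟩ := step3 hm hcol A' B (fun l => ((hA l).inter hXm).union ((hB l).diff hXm)) hB
    ψ' (fun i => ((Measurable.of_discrete (f := Int.toNat)).comp ((hψm i).add_const C)).indicator hXm) (C + C).toNat
    (by
      intro i x
      have := abs_le.1 (hψ i x)
      by_cases h : x ∈ X
      · simp only [ψ', Set.indicator_of_mem h]
        omega
      · simp [ψ', Set.indicator_of_notMem h])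
    (by
      intro x
      by_cases h : x ∈ X
      · have h1 : ∀ l, (A' l).indicator (fun _ => (1 : ℤ)) x = (A l).indicator (fun _ => (1 : ℤ)) x := by
          intro l; simp [A', Set.indicator_apply, h]
        simp only [h1]
        have h2 := hXd x h
        refine h2.symm.trans ?_
        unfold dvg
        refine Finset.sum_congr rfl fun i _ => ?_
        have e1 := abs_le.1 (hψ i x)
        have e2 := abs_le.1 (hψ i (-ev i +ᵥ x))
        simp only [ψ', Set.indicator_of_mem h, Set.indicator_of_mem ((hXi (-ev i) x).2 h)]
        omega
      · have h1 : ∀ l, (A' l).indicator (fun _ => (1 : ℤ)) x = (B l).indicator (fun _ => (1 : ℤ)) x := by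
          intro l; simp [A', Set.indicator_apply, h]
        have h3 : ∀ i, ¬ (-ev i +ᵥ x ∈ X) := fun i h4 => h ((hXi _ _).1 h4)
        simp only [h1, sub_self, ψ', Set.indicator_of_notMem h, Set.indicator_of_notMem (h3 _)]
        simp)
    R hR hsyn
  refine ⟨b, F, X, hF1, hF2, hXm, by filter_upwards [hX1c, hX2c] with x h1 h2 using ⟨h1, h2⟩, hXi, ?_, ?_, ?_⟩
  · intro q hq
    have := hF3.mapsTo (show q ∈ {q : Ω × L | q.1 ∈ A' q.2} from Or.inl ⟨hq.1, hq.2⟩)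
    exact ⟨this, (hXi _ _).2 hq.2⟩
  · exact hF3.injOn.mono fun q hq => Or.inl ⟨hq.1, hq.2⟩
  · intro q hq
    obtain ⟨q', hq', rfl⟩ := hF3.surjOn (show q ∈ {q : Ω × L | q.1 ∈ B q.2} from hq.1)
    have hx : q'.1 ∈ X := (hXi _ _).1 hq.2
    refine ⟨q', ⟨?_, hx⟩, rfl⟩
    rcases hq' with h | h
    · exact h.1
    · exact absurd hx h.2

end step4
end BDE

namespace BDE

theorem hilbert_nested {H : Type} [NormedAddCommGroup H] [InnerProductSpace ℝ H] [CompleteSpace H]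
    (C : ℕ → Set H) (hanti : Antitone C) (hcl : ∀ k, IsClosed (C k)) (hcv : ∀ k, Convex ℝ (C k))
    (hne : ∀ k, (C k).Nonempty) (M : ℝ) (hM : ∀ k, ∀ x ∈ C k, ‖x‖ ≤ M) : ∃ x, ∀ k, x ∈ C k := by
  have h1 : ∀ k, ∃ v ∈ C k, ∀ w ∈ C k, ‖v‖ ≤ ‖w‖ := by
    intro k
    obtain ⟨v, hv, h⟩ := exists_norm_eq_iInf_of_complete_convex (hne k) (hcl k).isComplete (hcv k) (0 : H)
    refine ⟨v, hv, fun w hw => ?_⟩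
    have hb : BddBelow (Set.range fun w : C k => ‖(0 : H) - w‖) := ⟨0, by rintro _ ⟨w, rfl⟩; exact norm_nonneg _⟩
    have := ciInf_le hb ⟨w, hw⟩
    rw [← h] at this
    simpa using this
  choose v hv hmin using h1
  have hmono : Monotone fun k => ‖v k‖ ^ 2 := by
    intro k l hkl
    exact pow_le_pow_left₀ (norm_nonneg _) (hmin k _ (hanti hkl (hv l))) 2
  have hbdd : BddAbove (Set.range fun k => ‖v k‖ ^ 2) := by
    refine ⟨M ^ 2, ?_⟩
    rintro _ ⟨k, rfl⟩
    exact pow_le_pow_left₀ (norm_nonneg _) (hM k _ (hv k)) 2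
  have hlim := tendsto_atTop_ciSup hmono hbdd
  have hpar : ∀ k l, k ≤ l → ‖v k - v l‖ ^ 2 ≤ 2 * (‖v l‖ ^ 2 - ‖v k‖ ^ 2) := by
    intro k l hkl
    have hmid : (1 / 2 : ℝ) • v k + (1 / 2 : ℝ) • v l ∈ C k :=
      hcv k (hv k) (hanti hkl (hv l)) (by norm_num) (by norm_num) (by norm_num)
    have h2 := hmin k _ hmid
    rw [← smul_add, norm_smul, Real.norm_of_nonneg (by norm_num)] at h2
    have h3 := parallelogram_law_with_norm ℝ (v k) (v l)
    have h4 : (2 * ‖v k‖) ^ 2 ≤ ‖v k + v l‖ ^ 2 :=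
      pow_le_pow_left₀ (by positivity) (by linarith) 2
    nlinarith
  have hc : CauchySeq v := by
    rw [Metric.cauchySeq_iff']
    intro ε hε
    obtain ⟨N, hN⟩ := Metric.cauchySeq_iff'.1 hlim.cauchySeq (ε ^ 2 / 2) (by positivity)
    refine ⟨N, fun n hn => ?_⟩
    have h1 := hpar N n hn
    have h2 := hN n hn
    rw [Real.dist_eq] at h2
    have h3 := (abs_lt.1 h2).2
    rw [dist_comm, dist_eq_norm]
    refine lt_of_pow_lt_pow_left₀ 2 hε.le ?_
    linarith
  obtain ⟨x, hx⟩ := cauchySeq_tendsto_of_complete hc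
  refine ⟨x, fun k => (hcl k).mem_of_tendsto hx ?_⟩
  filter_upwards [Filter.eventually_ge_atTop k] with l hl using hanti hl (hv l)

/-- admissible tail convex coefficients -/
def Adm (k : ℕ) : Set (ℕ →₀ ℝ) := {c | (∀ j, 0 ≤ c j) ∧ (∀ j, j < k → c j = 0) ∧ c.sum (fun _ a => a) = 1}

theorem Adm_convex (k : ℕ) : Convex ℝ (Adm k) := by
  intro c hc d hd a b ha hb hab
  refine ⟨fun j => ?_, fun j hj => ?_, ?_⟩
  · simp only [Finsupp.add_apply, Finsupp.smul_apply, smul_eq_mul]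
    exact add_nonneg (mul_nonneg ha (hc.1 j)) (mul_nonneg hb (hd.1 j))
  · simp [hc.2.1 j hj, hd.2.1 j hj]
  · rw [Finsupp.sum_add_index' (by simp) (by simp), Finsupp.sum_smul_index' (by simp), Finsupp.sum_smul_index' (by simp)]
    simp only [smul_eq_mul]
    rw [Finsupp.sum, Finsupp.sum, ← Finset.mul_sum, ← Finset.mul_sum]
    have h1 := hc.2.2
    have h2 := hd.2.2
    rw [Finsupp.sum] at h1 h2
    rw [h1, h2]; linarith

theorem Adm_single (k : ℕ) : Finsupp.single k (1 : ℝ) ∈ Adm k := by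
  refine ⟨fun j => ?_, fun j hj => ?_, by simp⟩
  · rw [Finsupp.single_apply]; split_ifs <;> norm_num
  · rw [Finsupp.single_apply, if_neg (by omega)]

theorem Adm_anti {k l : ℕ} (h : k ≤ l) : Adm l ⊆ Adm k := fun _ hc =>
  ⟨hc.1, fun j hj => hc.2.1 j (by omega), hc.2.2⟩

theorem Adm_tendsto {c : ℕ → ℕ →₀ ℝ} {s : ℕ → ℕ} (hs : Filter.Tendsto s Filter.atTop Filter.atTop)
    (hc : ∀ k, c k ∈ Adm (s k)) (a : ℕ → ℝ) (l : ℝ) (ha : Filter.Tendsto a Filter.atTop (nhds l)) :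
    Filter.Tendsto (fun k => (c k).sum fun j b => b * a j) Filter.atTop (nhds l) := by
  rw [Metric.tendsto_atTop] at ha ⊢
  intro ε hε
  obtain ⟨N, hN⟩ := ha (ε / 2) (by positivity)
  obtain ⟨N', hN'⟩ := (Filter.tendsto_atTop.1 hs N).exists_forall_of_atTop
  refine ⟨N', fun k hk => ?_⟩
  have h1 := hc k
  rw [Real.dist_eq]
  have h2 : (c k).sum (fun j b => b * a j) - l = (c k).sum (fun j b => b * (a j - l)) := by
    have h3 := h1.2.2
    simp only [Finsupp.sum] at h3 ⊢
    simp only [mul_sub, Finset.sum_sub_distrib, ← Finset.sum_mul, h3, one_mul]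
  rw [h2]
  have h3 := h1.2.2
  simp only [Finsupp.sum] at h3 ⊢
  calc _ ≤ ∑ j ∈ (c k).support, |c k j * (a j - l)| := Finset.abs_sum_le_sum_abs _ _
    _ ≤ ∑ j ∈ (c k).support, c k j * (ε / 2) := by
        refine Finset.sum_le_sum fun j hj => ?_
        rw [abs_mul, abs_of_nonneg (h1.1 j)]
        refine mul_le_mul_of_nonneg_left ?_ (h1.1 j)
        have : s k ≤ j := by
          by_contra h
          exact (Finsupp.mem_support_iff.1 hj) (h1.2.1 j (by omega))
        have := hN j ((hN' k hk).trans this)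
        rw [Real.dist_eq] at this
        exact this.le
    _ = ε / 2 := by rw [← Finset.sum_mul, h3, one_mul]
    _ < ε := by linarith

theorem komlos {α : Type} [MeasurableSpace α] (μ : Measure α) {E : Type} [NormedAddCommGroup E]
    [InnerProductSpace ℝ E] [CompleteSpace E] (v : ℕ → α → E) (hv : ∀ k, MemLp (v k) 2 μ) (M : NNReal)
    (hM : ∀ k, eLpNorm (v k) 2 μ ≤ M) :
    ∃ (c : ℕ → ℕ →₀ ℝ) (s : ℕ → ℕ), Filter.Tendsto s Filter.atTop Filter.atTop ∧ (∀ k, c k ∈ Adm (s k)) ∧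
      ∃ w : α → E, StronglyMeasurable w ∧
        ∀ᵐ x ∂μ, Filter.Tendsto (fun k => (c k).sum fun j a => a • v j x) Filter.atTop (nhds (w x)) := by
  let V : ℕ → Lp E 2 μ := fun k => (hv k).toLp (v k)
  let Φ : (ℕ →₀ ℝ) →ₗ[ℝ] Lp E 2 μ := Finsupp.linearCombination ℝ V
  have hVn : ∀ k, ‖V k‖ ≤ M := by
    intro k
    rw [Lp.norm_toLp]
    exact ENNReal.toReal_le_coe_of_le_coe (hM k)
  have hΦn : ∀ k, ∀ c ∈ Adm k, ‖Φ c‖ ≤ M := by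
    intro k c hc
    rw [Finsupp.linearCombination_apply, Finsupp.sum]
    refine (norm_sum_le _ _).trans ?_
    have h3 := hc.2.2
    rw [Finsupp.sum] at h3
    calc _ ≤ ∑ j ∈ c.support, c j * (M : ℝ) := by
          refine Finset.sum_le_sum fun j _ => ?_
          rw [norm_smul, Real.norm_of_nonneg (hc.1 j)]
          exact mul_le_mul_of_nonneg_left (hVn j) (hc.1 j)
      _ = M := by rw [← Finset.sum_mul, h3, one_mul]
  obtain ⟨w, hw⟩ := hilbert_nested (fun k => closure (Φ '' Adm k))
    (fun k l h => closure_mono (Set.image_mono (Adm_anti h))) (fun k => isClosed_closure)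
    (fun k => ((Adm_convex k).linear_image Φ).closure)
    (fun k => ⟨_, subset_closure ⟨_, Adm_single k, rfl⟩⟩) M
    (fun k x hx => by
      have : closure (Φ '' Adm k) ⊆ Metric.closedBall 0 M := by
        refine closure_minimal ?_ Metric.isClosed_closedBall
        rintro _ ⟨c, hc, rfl⟩
        rw [mem_closedBall_zero_iff]
        exact hΦn k c hc
      exact mem_closedBall_zero_iff.1 (this hx))
  have h1 : ∀ k : ℕ, ∃ c ∈ Adm k, dist w (Φ c) < 1 / ((k : ℝ) + 1) := by
    intro k
    obtain ⟨_, ⟨c, hc, rfl⟩, h⟩ := Metric.mem_closure_iff.1 (hw k) (1 / ((k : ℝ) + 1)) (by positivity)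
    exact ⟨c, hc, h⟩
  choose c hc hcd using h1
  have hlim : Filter.Tendsto (fun k => Φ (c k)) Filter.atTop (nhds w) := by
    rw [tendsto_iff_dist_tendsto_zero]
    refine squeeze_zero (fun _ => dist_nonneg) (fun k => ?_) tendsto_one_div_add_atTop_nhds_zero_nat
    rw [dist_comm]; exact (hcd k).le
  obtain ⟨s, hs, hs2⟩ := (tendstoInMeasure_of_tendsto_Lp hlim).exists_seq_tendsto_ae
  refine ⟨fun k => c (s k), s, hs.tendsto_atTop, fun k => hc _, w, Lp.stronglyMeasurable w, ?_⟩
  have h2 : ∀ᵐ x ∂μ, ∀ k, V k x = v k x := ae_all_iff.2 fun k => (hv k).coeFn_toLp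
  have h3 : ∀ᵐ x ∂μ, ∀ k, (Φ (c k)) x = (c k).sum fun j a => a • V j x := by
    refine ae_all_iff.2 fun k => ?_
    rw [Finsupp.linearCombination_apply, Finsupp.sum]
    have h4 := Lp.coeFn_finsetSum (c k).support (fun j => (c k) j • V j)
    have h5 : ∀ᵐ x ∂μ, ∀ j, ((c k j • V j : Lp E 2 μ) : α → E) x = c k j • V j x :=
      ae_all_iff.2 fun j => Lp.coeFn_smul (c k j) (V j)
    filter_upwards [h4, h5] with x h6 h7
    rw [h6, Finset.sum_apply, Finsupp.sum]
    exact Finset.sum_congr rfl fun j _ => h7 j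
  filter_upwards [hs2, h2, h3] with x h4 h5 h6
  simp only [h6, h5] at h4
  exact h4

end BDE

namespace BDE

open scoped ENNReal

section avg
variable {G : Type} [AddCommGroup G] [Countable G] {X : Type} [NormedAddCommGroup X] [MeasurableSpace X] [BorelSpace X]

/-- weighted local count -/
noncomputable def Nf (p : G →+ X) (w : G → ℝ≥0∞) (r : ℝ) (P : Set G) (x : X) : ℝ≥0∞ :=
  ∑' γ, (P ∩ {γ | dist (p γ) x < r}).indicator w γ

theorem Nf_measurable (p : G →+ X) (w : G → ℝ≥0∞) (r : ℝ) (P : Set G) : Measurable (Nf p w r P) := by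
  classical
  refine Measurable.tsum fun γ => ?_
  by_cases h : γ ∈ P
  · have : (fun x => (P ∩ {γ | dist (p γ) x < r}).indicator w γ) = (Metric.ball (p γ) r).indicator (fun _ => w γ) := by
      ext x
      simp [Set.indicator_apply, h, Metric.mem_ball, dist_comm]
    rw [this]
    exact measurable_const.indicator measurableSet_ball
  · have : (fun x => (P ∩ {γ | dist (p γ) x < r}).indicator w γ) = fun _ => 0 := by
      ext x
      simp [h]
    rw [this]; exact measurable_const

theorem Nf_ne_top (p : G →+ X) (w : G → ℝ≥0∞) (hw : ∑' γ, w γ ≠ ∞) (r : ℝ) (P : Set G) (x : X) : Nf p w r P x ≠ ∞ := by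
  refine ne_top_of_le_ne_top hw (ENNReal.tsum_le_tsum fun γ => ?_)
  exact Set.indicator_le_self _ _ _

theorem Nf_mono (p : G →+ X) (w : G → ℝ≥0∞) (r : ℝ) {P P' : Set G} (x : X)
    (h : ∀ γ, dist (p γ) x < r → γ ∈ P → γ ∈ P') : Nf p w r P x ≤ Nf p w r P' x := by
  refine ENNReal.tsum_le_tsum fun γ => ?_
  refine Set.indicator_le_indicator_of_subset ?_ (fun _ => zero_le) γ
  rintro γ ⟨h1, h2⟩
  exact ⟨h γ h2 h1, h2⟩

theorem Nf_eq_zero (p : G →+ X) (w : G → ℝ≥0∞) (r : ℝ) {P : Set G} (x : X)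
    (h : ∀ γ, dist (p γ) x < r → γ ∉ P) : Nf p w r P x = 0 := by
  rw [Nf, ENNReal.tsum_eq_zero]
  intro γ
  refine Set.indicator_of_notMem ?_ _
  rintro ⟨h1, h2⟩
  exact h γ h2 h1

theorem Nf_univ_ne_zero (p : G →+ X) (hp : DenseRange p) (w : G → ℝ≥0∞) (hw : ∀ γ, w γ ≠ 0) (r : ℝ) (hr : 0 < r) (x : X) :
    Nf p w r Set.univ x ≠ 0 := by
  obtain ⟨γ, h⟩ := hp.exists_dist_lt x hr
  rw [Nf, Ne, ENNReal.tsum_eq_zero]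
  push Not
  refine ⟨γ, ?_⟩
  rw [Set.indicator_of_mem (by refine ⟨trivial, ?_⟩; rw [Set.mem_ofPred_eq, dist_comm]; exact h)]
  exact hw γ

theorem Nf_shift_le (p : G →+ X) (w : G → ℝ≥0∞) (r : ℝ) (x : X) (δ : G) (q : ℝ≥0∞)
    (hq : ∀ γ, w γ ≤ q * w (γ + δ)) : Nf p w r Set.univ (x - p δ) ≤ q * Nf p w r Set.univ x := by
  unfold Nf
  rw [← ENNReal.tsum_mul_left, ← (Equiv.addRight δ).tsum_eq (fun γ => q * (Set.univ ∩ {γ | dist (p γ) x < r}).indicator w γ)]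
  refine ENNReal.tsum_le_tsum fun γ => ?_
  simp only [Equiv.coe_addRight]
  by_cases h : dist (p γ) (x - p δ) < r
  · have h' : dist (p (γ + δ)) x < r := by
      rw [map_add]
      have : dist (p γ + p δ) x = dist (p γ) (x - p δ) := by
        rw [dist_eq_norm, dist_eq_norm]; congr 1; abel
      rwa [this]
    rw [Set.indicator_of_mem (show γ ∈ Set.univ ∩ {γ | dist (p γ) (x - p δ) < r} from ⟨trivial, h⟩),
      Set.indicator_of_mem (show γ + δ ∈ Set.univ ∩ {γ | dist (p γ) x < r} from ⟨trivial, h'⟩)]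
    exact hq γ
  · rw [Set.indicator_of_notMem (fun h2 => h h2.2)]
    exact zero_le

theorem Nf_shift_ge (p : G →+ X) (w : G → ℝ≥0∞) (r : ℝ) (x : X) (δ : G) (q : ℝ≥0∞)
    (hq : ∀ γ, w γ ≤ q * w (γ - δ)) : Nf p w r Set.univ x ≤ q * Nf p w r Set.univ (x - p δ) := by
  have := Nf_shift_le p w r (x - p δ) (-δ) q (fun γ => by rw [← sub_eq_add_neg]; exact hq γ)
  simpa using this

theorem Nf_sum (p : G →+ X) (w : G → ℝ≥0∞) (r : ℝ) (x : X) (T : Finset G) (f : G → G) (P : Set G)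
    (hf : ∀ γ ∈ P, f γ ∈ T) : ∑ δ ∈ T, Nf p w r {γ | γ ∈ P ∧ f γ = δ} x = Nf p w r P x := by
  classical
  unfold Nf
  rw [← Summable.tsum_finsetSum (fun _ _ => ENNReal.summable)]
  refine tsum_congr fun γ => ?_
  by_cases h : γ ∈ P ∩ {γ | dist (p γ) x < r}
  · rw [Set.indicator_of_mem h, Finset.sum_eq_single (f γ)]
    · have h3 : γ ∈ {γ' | γ' ∈ P ∧ f γ' = f γ} ∩ {γ | dist (p γ) x < r} := ⟨⟨h.1, rfl⟩, h.2⟩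
      exact Set.indicator_of_mem h3 w
    · intro δ _ hδ
      exact Set.indicator_of_notMem (fun h2 => hδ h2.1.2.symm) _
    · intro h2
      exact absurd (hf γ h.1) h2
  · rw [Set.indicator_of_notMem h]
    refine Finset.sum_eq_zero fun δ _ => ?_
    exact Set.indicator_of_notMem (fun h2 => h ⟨h2.1.1, h2.2⟩) _

theorem Nf_sum_shift (p : G →+ X) (w : G → ℝ≥0∞) (r : ℝ) (x : X) (T : Finset G) (f : G → G) (P : Set G)
    (hf : ∀ γ ∈ P, f γ ∈ T) : ∑ δ ∈ T, Nf p w r {γ | γ ∈ P ∧ f γ = δ} (x - p δ) =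
      ∑' γ, (P ∩ {γ | dist (p (γ + f γ)) x < r}).indicator w γ := by
  classical
  unfold Nf
  rw [← Summable.tsum_finsetSum (fun _ _ => ENNReal.summable)]
  refine tsum_congr fun γ => ?_
  have key : ∀ δ, dist (p (γ + δ)) x = dist (p γ) (x - p δ) := by
    intro δ
    rw [map_add, dist_eq_norm, dist_eq_norm]; congr 1; abel
  by_cases h : γ ∈ P ∩ {γ | dist (p (γ + f γ)) x < r}
  · rw [Set.indicator_of_mem h, Finset.sum_eq_single (f γ)]
    · have h3 : γ ∈ {γ' | γ' ∈ P ∧ f γ' = f γ} ∩ {γ' | dist (p γ') (x - p (f γ)) < r} := by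
        refine ⟨⟨h.1, rfl⟩, ?_⟩
        rw [Set.mem_ofPred_eq, ← key]; exact h.2
      exact Set.indicator_of_mem h3 w
    · intro δ _ hδ
      exact Set.indicator_of_notMem (fun h2 => hδ h2.1.2.symm) _
    · intro h2
      exact absurd (hf γ h.1) h2
  · rw [Set.indicator_of_notMem h]
    refine Finset.sum_eq_zero fun δ _ => ?_
    refine Set.indicator_of_notMem (fun h2 => h ⟨h2.1.1, ?_⟩) _
    have h3 := h2.2
    rw [Set.mem_ofPred_eq, ← key] at h3
    rw [Set.mem_ofPred_eq, h2.1.2]; exact h3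

theorem Nf_bij (p : G →+ X) (w : G → ℝ≥0∞) (r : ℝ) (x : X) (f : G → G) (P P' : Set G)
    (hb : Set.BijOn (fun γ => γ + f γ) P P') :
    ∑' γ, (P ∩ {γ | dist (p (γ + f γ)) x < r}).indicator (fun γ => w (γ + f γ)) γ = Nf p w r P' x := by
  classical
  unfold Nf
  have h1 : ∀ γ, (P ∩ {γ | dist (p (γ + f γ)) x < r}).indicator (fun γ => w (γ + f γ)) γ =
      P.indicator (fun γ => ({γ | dist (p γ) x < r}).indicator w (γ + f γ)) γ := by
    intro γ
    by_cases h : γ ∈ P <;> simp [Set.indicator_apply, h]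
  have h2 : ∀ γ, (P' ∩ {γ | dist (p γ) x < r}).indicator w γ = P'.indicator (({γ | dist (p γ) x < r}).indicator w) γ := by
    intro γ
    by_cases h : γ ∈ P' <;> simp [Set.indicator_apply, h]
  simp only [h1, h2]
  rw [← tsum_subtype P, ← tsum_subtype P', ← (hb.equiv _).tsum_eq]
  rfl

theorem avg_bounds (p : G →+ X) (hp : DenseRange p) (w : G → ℝ≥0∞) (hw0 : ∀ γ, w γ ≠ 0) (hw : ∑' γ, w γ ≠ ∞)
    (r : ℝ) (hr : 0 < r) (x : X) (T : Finset G) (f : G → G) (P P' : Set G)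
    (hf : ∀ γ ∈ P, f γ ∈ T) (hb : Set.BijOn (fun γ => γ + f γ) P P') (q : ℝ≥0∞)
    (hq1 : ∀ δ ∈ T, ∀ γ, w γ ≤ q * w (γ + δ)) (hq2 : ∀ δ ∈ T, ∀ γ, w γ ≤ q * w (γ - δ)) :
    (∑ δ ∈ T, Nf p w r {γ | γ ∈ P ∧ f γ = δ} (x - p δ) / Nf p w r Set.univ (x - p δ)) * Nf p w r Set.univ x ≤ q * q * Nf p w r P' x ∧
    Nf p w r P' x ≤ q * q * (∑ δ ∈ T, Nf p w r {γ | γ ∈ P ∧ f γ = δ} (x - p δ) / Nf p w r Set.univ (x - p δ)) * Nf p w r Set.univ x := by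
  have hZ0 := Nf_univ_ne_zero p hp w hw0 r hr
  have hZt := Nf_ne_top p w hw r Set.univ
  set Z := Nf p w r Set.univ with hZ
  set N := ∑' γ, (P ∩ {γ | dist (p (γ + f γ)) x < r}).indicator w γ with hN
  have hs := Nf_sum_shift p w r x T f P hf
  have hbij := Nf_bij p w r x f P P' hb
  have hN1 : N ≤ q * Nf p w r P' x := by
    rw [← hbij, ← ENNReal.tsum_mul_left]
    refine ENNReal.tsum_le_tsum fun γ => ?_
    by_cases h : γ ∈ P ∩ {γ | dist (p (γ + f γ)) x < r}
    · rw [Set.indicator_of_mem h, Set.indicator_of_mem h]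
      exact hq1 _ (hf γ h.1) γ
    · rw [Set.indicator_of_notMem h]; exact zero_le
  have hN2 : Nf p w r P' x ≤ q * N := by
    rw [← hbij, ← ENNReal.tsum_mul_left]
    refine ENNReal.tsum_le_tsum fun γ => ?_
    by_cases h : γ ∈ P ∩ {γ | dist (p (γ + f γ)) x < r}
    · rw [Set.indicator_of_mem h, Set.indicator_of_mem h]
      have := hq2 _ (hf γ h.1) (γ + f γ)
      rwa [add_sub_cancel_right] at this
    · rw [Set.indicator_of_notMem h]; exact zero_le
  constructor
  · calc _ = ∑ δ ∈ T, Nf p w r {γ | γ ∈ P ∧ f γ = δ} (x - p δ) / Z (x - p δ) * Z x := by rw [Finset.sum_mul]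
      _ ≤ ∑ δ ∈ T, q * Nf p w r {γ | γ ∈ P ∧ f γ = δ} (x - p δ) := by
          refine Finset.sum_le_sum fun δ hδ => ?_
          calc _ ≤ Nf p w r {γ | γ ∈ P ∧ f γ = δ} (x - p δ) / Z (x - p δ) * (q * Z (x - p δ)) :=
                mul_le_mul_right (Nf_shift_ge p w r x δ q (hq2 δ hδ)) _
            _ = q * (Nf p w r {γ | γ ∈ P ∧ f γ = δ} (x - p δ) / Z (x - p δ) * Z (x - p δ)) := by ring
            _ = _ := by rw [ENNReal.div_mul_cancel (hZ0 _) (hZt _)]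
      _ = q * N := by rw [← Finset.mul_sum, hs]
      _ ≤ q * (q * Nf p w r P' x) := mul_le_mul_right hN1 _
      _ = _ := by ring
  · calc _ ≤ q * N := hN2
      _ = ∑ δ ∈ T, q * Nf p w r {γ | γ ∈ P ∧ f γ = δ} (x - p δ) := by rw [← Finset.mul_sum, hs]
      _ = ∑ δ ∈ T, q * (Nf p w r {γ | γ ∈ P ∧ f γ = δ} (x - p δ) / Z (x - p δ) * Z (x - p δ)) := by
          refine Finset.sum_congr rfl fun δ _ => ?_
          rw [ENNReal.div_mul_cancel (hZ0 _) (hZt _)]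
      _ ≤ ∑ δ ∈ T, q * (Nf p w r {γ | γ ∈ P ∧ f γ = δ} (x - p δ) / Z (x - p δ) * (q * Z x)) := by
          refine Finset.sum_le_sum fun δ hδ => ?_
          exact mul_le_mul_right (mul_le_mul_right (Nf_shift_le p w r x δ q (hq1 δ hδ)) _) _
      _ = _ := by
          rw [Finset.mul_sum, Finset.sum_mul]
          exact Finset.sum_congr rfl fun δ _ => by ring

end avg
end BDE

namespace BDE

open scoped ENNReal

section avg
variable {G : Type} [AddCommGroup G] [Countable G] {X : Type} [NormedAddCommGroup X] [MeasurableSpace X] [BorelSpace X]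

theorem komlos_fin {α : Type} [MeasurableSpace α] (μ : Measure α) {D : Type} [Fintype D]
    (K : Set α) (hK : MeasurableSet K) (hKμ : μ K ≠ ∞) (v : ℕ → D → α → ℝ) (hv : ∀ k d, Measurable (v k d))
    (h0 : ∀ k d x, 0 ≤ v k d x) (h1 : ∀ k d x, v k d x ≤ 1) (hvK : ∀ k d x, x ∉ K → v k d x = 0) :
    ∃ (c : ℕ → ℕ →₀ ℝ) (s : ℕ → ℕ), Filter.Tendsto s Filter.atTop Filter.atTop ∧ (∀ k, c k ∈ Adm (s k)) ∧
      ∃ u : D → α → ℝ, (∀ d, Measurable (u d)) ∧ (∀ d x, 0 ≤ u d x ∧ u d x ≤ 1) ∧ (∀ d x, x ∉ K → u d x = 0) ∧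
        ∀ᵐ x ∂μ, ∀ d, Filter.Tendsto (fun k => (c k).sum fun j a => a * v j d x) Filter.atTop (nhds (u d x)) := by
  classical
  let V : ℕ → α → EuclideanSpace ℝ D := fun k x => WithLp.toLp 2 (fun d => v k d x)
  have hVm : ∀ k, Measurable (V k) := fun k =>
    (WithLp.measurable_toLp 2 (D → ℝ)).comp (measurable_pi_lambda _ fun d => hv k d)
  have hVn : ∀ k x, ‖V k x‖ ≤ Real.sqrt (Fintype.card D) := by
    intro k x
    rw [EuclideanSpace.norm_eq]
    refine Real.sqrt_le_sqrt ?_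
    calc _ ≤ ∑ d : D, (1 : ℝ) := by
          refine Finset.sum_le_sum fun d _ => ?_
          simp only [V]
          rw [Real.norm_of_nonneg (h0 k d x)]
          exact pow_le_one₀ (h0 k d x) (h1 k d x)
      _ = _ := by simp
  have hVK : ∀ k, V k = K.indicator (V k) := by
    intro k
    refine (Set.indicator_eq_self.2 ?_).symm
    intro x hx
    by_contra h
    apply hx
    simp only [V]
    ext d
    simp [hvK k d x h]
  have hfin : IsFiniteMeasure (μ.restrict K) := ⟨by rw [Measure.restrict_apply_univ]; exact hKμ.lt_top⟩
  have hbd : ∀ k, eLpNorm (V k) 2 μ ≤ (μ.restrict K) Set.univ ^ (ENNReal.toReal 2)⁻¹ * ENNReal.ofReal (Real.sqrt (Fintype.card D)) := by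
    intro k
    rw [hVK k, eLpNorm_indicator_eq_eLpNorm_restrict hK]
    exact eLpNorm_le_of_ae_bound (Filter.Eventually.of_forall (hVn k))
  have hC : (μ.restrict K) Set.univ ^ (ENNReal.toReal 2)⁻¹ * ENNReal.ofReal (Real.sqrt (Fintype.card D)) ≠ ∞ := by
    refine ENNReal.mul_ne_top (ENNReal.rpow_ne_top_of_nonneg (by norm_num) (measure_ne_top _ _)) ENNReal.ofReal_ne_top
  obtain ⟨c, s, hs, hc, w, hw, hlim⟩ := komlos μ V
    (fun k => ⟨(hVm k).aestronglyMeasurable, (hbd k).trans_lt hC.lt_top⟩)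
    (ENNReal.toNNReal _) (fun k => by rw [ENNReal.coe_toNNReal hC]; exact hbd k)
  refine ⟨c, s, hs, hc, fun d x => max 0 (min 1 (K.indicator (fun x => w x d) x)), ?_, ?_, ?_, ?_⟩
  · intro d
    have : Measurable fun x => w x d := by
      have h2 : Measurable (fun y : EuclideanSpace ℝ D => y d) := (EuclideanSpace.proj (𝕜 := ℝ) d).continuous.measurable
      exact h2.comp hw.measurable
    exact measurable_const.max (measurable_const.min (this.indicator hK))
  · intro d x
    exact ⟨le_max_left _ _, max_le zero_le_one (min_le_left _ _)⟩
  · intro d x hx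
    simp [hx]
  · filter_upwards [hlim] with x hx d
    have h2 : Filter.Tendsto (fun k => (c k).sum fun j a => a * v j d x) Filter.atTop (nhds (w x d)) := by
      have := ((EuclideanSpace.proj (𝕜 := ℝ) d).continuous.tendsto (w x)).comp hx
      refine this.congr fun k => ?_
      simp only [Function.comp]
      rw [map_finsuppSum]
      rfl
    have h3 : 0 ≤ w x d := by
      refine ge_of_tendsto' h2 fun k => ?_
      exact Finset.sum_nonneg fun j _ => mul_nonneg ((hc k).1 j) (h0 _ _ _)
    have h4 : w x d ≤ 1 := by
      refine le_of_tendsto' h2 fun k => ?_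
      refine le_trans (Finset.sum_le_sum fun j _ => ?_) (hc k).2.2.le
      exact mul_le_of_le_one_right ((hc k).1 j) (h1 _ _ _)
    by_cases hxK : x ∈ K
    · simp only [Set.indicator_of_mem hxK]
      rw [min_eq_right h4, max_eq_right h3]; exact h2
    · have h5 : w x d = 0 := by
        refine tendsto_nhds_unique h2 ?_
        simp [hvK _ _ _ hxK, Finsupp.sum]
      simp only [Set.indicator_of_notMem hxK]
      rw [h5] at h2
      simpa using h2

theorem frac_match [ProperSpace X] (μ : Measure X) [μ.IsAddLeftInvariant] [IsFiniteMeasureOnCompacts μ]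
    (p : G →+ X) (hp : DenseRange p) (w : ℕ → G → ℝ≥0∞) (hw0 : ∀ k γ, w k γ ≠ 0) (hw : ∀ k, ∑' γ, w k γ ≠ ∞)
    (W W' : Set X) (hWb : Bornology.IsBounded W) (hW : μ (frontier W) = 0) (hW' : μ (frontier W') = 0)
    (T : Finset G) (f : G → G) (hf : ∀ γ, p γ ∈ W → f γ ∈ T)
    (hb : Set.BijOn (fun γ => γ + f γ) {γ | p γ ∈ W} {γ | p γ ∈ W'}) (q : ℕ → ℝ≥0∞)
    (hq1 : ∀ k, ∀ δ ∈ T, ∀ γ, w k γ ≤ q k * w k (γ + δ)) (hq2 : ∀ k, ∀ δ ∈ T, ∀ γ, w k γ ≤ q k * w k (γ - δ))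
    (hq : Filter.Tendsto q Filter.atTop (nhds 1)) (hqt : ∀ k, q k ≠ ∞) (hq0 : ∀ k, q k ≠ 0) :
    ∃ u : T → X → ℝ, (∀ d, Measurable (u d)) ∧ (∀ d x, 0 ≤ u d x ∧ u d x ≤ 1) ∧
      (∃ K : Set X, Bornology.IsBounded K ∧ ∀ d x, x ∉ K → u d x = 0) ∧
      (∀ᵐ x ∂μ, ∑ d, u d x = W.indicator (fun _ => (1 : ℝ)) x) ∧
      (∀ᵐ x ∂μ, ∑ d, u d (x - p d) = W'.indicator (fun _ => (1 : ℝ)) x) := by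
  classical
  let r : ℕ → ℝ := fun k => 1 / ((k : ℝ) + 1)
  have hr : ∀ k, 0 < r k := fun k => by positivity
  have hr1 : ∀ k, r k ≤ 1 := fun k => by
    simp only [r]; rw [div_le_one (by positivity)]; linarith [(Nat.cast_nonneg k : (0 : ℝ) ≤ k)]
  have hrt : Filter.Tendsto r Filter.atTop (nhds 0) := tendsto_one_div_add_atTop_nhds_zero_nat
  let P : Set G := {γ | p γ ∈ W}
  let P' : Set G := {γ | p γ ∈ W'}
  let Z : ℕ → X → ℝ≥0∞ := fun k => Nf p (w k) (r k) Set.univ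
  let N : ℕ → T → X → ℝ≥0∞ := fun k d => Nf p (w k) (r k) {γ | γ ∈ P ∧ f γ = d}
  have hZ0 : ∀ k x, Z k x ≠ 0 := fun k x => Nf_univ_ne_zero p hp (w k) (hw0 k) (r k) (hr k) x
  have hZt : ∀ k x, Z k x ≠ ∞ := fun k x => Nf_ne_top p (w k) (hw k) (r k) _ x
  have hNt : ∀ k d x, N k d x ≠ ∞ := fun k d x => Nf_ne_top p (w k) (hw k) (r k) _ x
  have hNZ : ∀ k d x, N k d x ≤ Z k x := fun k d x => Nf_mono p (w k) (r k) x (fun _ _ _ => trivial)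
  have hdt : ∀ k d x, N k d x / Z k x ≠ ∞ := fun k d x => ENNReal.div_ne_top (hNt k d x) (hZ0 k x)
  let v : ℕ → T → X → ℝ := fun k d x => (N k d x / Z k x).toReal
  let K : Set X := Metric.cthickening 1 W
  have hKb : Bornology.IsBounded K := hWb.cthickening
  obtain ⟨c, s, hs, hc, u, hum, hu01, huK, hlim⟩ := komlos_fin μ K Metric.isClosed_cthickening.measurableSet
    (hKb.measure_lt_top.ne) v
    (fun k d => ((Nf_measurable p (w k) (r k) _).div (Nf_measurable p (w k) (r k) _)).ennreal_toReal)
    (fun k d x => ENNReal.toReal_nonneg)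
    (fun k d x => by
      refine ENNReal.toReal_le_of_le_ofReal zero_le_one ?_
      rw [ENNReal.ofReal_one]
      exact ENNReal.div_le_of_le_mul (by rw [one_mul]; exact hNZ k d x))
    (fun k d x hx => by
      have : N k d x = 0 := by
        refine Nf_eq_zero p (w k) (r k) x fun γ h1 h2 => hx ?_
        refine Metric.mem_cthickening_of_dist_le x (p γ) 1 W h2.1 ?_
        rw [dist_comm]; exact (h1.le.trans (hr1 k))
      simp only [v, this, ENNReal.zero_div, ENNReal.toReal_zero])
  have hsumc : ∀ k (y : T → X), ∑ d, ((c k).sum fun j a => a * v j d (y d)) = (c k).sum fun j a => a * ∑ d, v j d (y d) := by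
    intro k y
    simp only [Finsupp.sum, Finset.mul_sum]
    exact Finset.sum_comm
  have hsumv : ∀ k (y : T → X), ∑ d, v k d (y d) = (∑ d, N k d (y d) / Z k (y d)).toReal := by
    intro k y
    rw [ENNReal.toReal_sum fun d _ => hdt _ _ _]
  have hmain : ∀ (y : T → X) (l : ℝ), (∀ d, Filter.Tendsto (fun k => (c k).sum fun j a => a * v j d (y d)) Filter.atTop (nhds (u d (y d)))) →
      Filter.Tendsto (fun k => (∑ d, N k d (y d) / Z k (y d)).toReal) Filter.atTop (nhds l) → ∑ d, u d (y d) = l := by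
    intro y l h1 h2
    have h3 := tendsto_finsetSum Finset.univ fun d _ => h1 d
    simp only [hsumc] at h3
    refine tendsto_nhds_unique h3 (Adm_tendsto hs hc _ l ?_)
    simp only [hsumv]
    exact h2
  refine ⟨u, hum, hu01, ⟨K, hKb, huK⟩, ?_, ?_⟩
  · have hfr : ∀ᵐ x ∂μ, x ∉ frontier W := measure_eq_zero_iff_ae_notMem.1 hW
    filter_upwards [hlim, hfr] with x hx hxf
    refine hmain (fun _ => x) _ hx ?_
    have e1 : ∀ k, ∑ d : T, N k d x / Z k x = Nf p (w k) (r k) P x / Z k x := by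
      intro k
      rw [← Nf_sum p (w k) (r k) x T f P hf]
      simp only [div_eq_mul_inv, ← Finset.sum_mul]
      rw [← Finset.sum_coe_sort T]
    simp only [e1]
    by_cases hxW : x ∈ W
    · have hxi : x ∈ interior W := by
        by_contra h; exact hxf ⟨subset_closure hxW, h⟩
      obtain ⟨ε, hε, hball⟩ := Metric.isOpen_iff.1 isOpen_interior x hxi
      rw [Set.indicator_of_mem hxW]
      refine tendsto_const_nhds.congr' ?_
      filter_upwards [hrt.eventually (gt_mem_nhds hε)] with k hk
      have : Nf p (w k) (r k) P x = Z k x :=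
        le_antisymm (Nf_mono _ _ _ _ fun _ _ _ => trivial)
          (Nf_mono _ _ _ _ fun γ h1 _ => show p γ ∈ _ from interior_subset (hball (Metric.mem_ball.2 (h1.trans hk))))
      rw [this, ENNReal.div_self (hZ0 k x) (hZt k x), ENNReal.toReal_one]
    · have hxi : x ∈ (closure W)ᶜ := fun h => hxf ⟨h, fun h2 => hxW (interior_subset h2)⟩
      obtain ⟨ε, hε, hball⟩ := Metric.isOpen_iff.1 isClosed_closure.isOpen_compl x hxi
      rw [Set.indicator_of_notMem hxW]
      refine tendsto_const_nhds.congr' ?_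
      filter_upwards [hrt.eventually (gt_mem_nhds hε)] with k hk
      have : Nf p (w k) (r k) P x = 0 :=
        Nf_eq_zero _ _ _ _ fun γ h1 h2 => hball (Metric.mem_ball.2 (h1.trans hk)) (subset_closure h2)
      rw [this, ENNReal.zero_div, ENNReal.toReal_zero]
  · have hfr : ∀ᵐ x ∂μ, x ∉ frontier W' := measure_eq_zero_iff_ae_notMem.1 hW'
    have hshift : ∀ᵐ x ∂μ, ∀ d : T, ∀ d', Filter.Tendsto (fun k => (c k).sum fun j a => a * v j d' (x - p d)) Filter.atTop (nhds (u d' (x - p d))) :=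
      ae_all_iff.2 fun d => (measurePreserving_sub_right μ (p d)).quasiMeasurePreserving.ae hlim
    filter_upwards [hshift, hfr] with x hx hxf
    refine hmain (fun d => x - p d) _ (fun d => hx d d) ?_
    have hbd := fun k => avg_bounds p hp (w k) (hw0 k) (hw k) (r k) (hr k) x T f P P' hf hb (q k) (hq1 k) (hq2 k)
    have e1 : ∀ k, ∑ δ ∈ T, Nf p (w k) (r k) {γ | γ ∈ P ∧ f γ = δ} (x - p δ) / Nf p (w k) (r k) Set.univ (x - p δ) = ∑ d : T, N k d (x - p d) / Z k (x - p d) := by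
      intro k
      rw [← Finset.sum_coe_sort T]
    simp only [e1] at hbd
    by_cases hxW : x ∈ W'
    · have hxi : x ∈ interior W' := by
        by_contra h; exact hxf ⟨subset_closure hxW, h⟩
      obtain ⟨ε, hε, hball⟩ := Metric.isOpen_iff.1 isOpen_interior x hxi
      rw [Set.indicator_of_mem hxW]
      have hqq : Filter.Tendsto (fun k => q k * q k) Filter.atTop (nhds 1) := by
        have := ENNReal.Tendsto.mul hq (Or.inl one_ne_zero) hq (Or.inl one_ne_zero)
        simpa using this
      have hqi : Filter.Tendsto (fun k => (q k * q k)⁻¹) Filter.atTop (nhds 1) := by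
        have := tendsto_inv_iff.2 hqq
        simpa using this
      have hA : Filter.Tendsto (fun k => ∑ d : T, N k d (x - p d) / Z k (x - p d)) Filter.atTop (nhds 1) := by
        refine tendsto_of_tendsto_of_tendsto_of_le_of_le' hqi hqq ?_ ?_
        all_goals
          filter_upwards [hrt.eventually (gt_mem_nhds hε)] with k hk
          have h1 : Nf p (w k) (r k) P' x = Z k x :=
            le_antisymm (Nf_mono _ _ _ _ fun _ _ _ => trivial)
              (Nf_mono _ _ _ _ fun γ h1 _ => show p γ ∈ _ from interior_subset (hball (Metric.mem_ball.2 (h1.trans hk))))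
          obtain ⟨h2, h3⟩ := hbd k
          rw [h1] at h2 h3
        · have h4 : 1 * Z k x ≤ (q k * q k * ∑ d : T, N k d (x - p d) / Z k (x - p d)) * Z k x := by
            rw [one_mul]; exact h3
          have h5 := (ENNReal.mul_le_mul_iff_left (hZ0 k x) (hZt k x)).1 h4
          rw [ENNReal.inv_le_iff_le_mul]
          · exact h5
          · intro _; exact mul_ne_zero (hq0 k) (hq0 k)
          · intro h; exact absurd h (ENNReal.mul_ne_top (hqt k) (hqt k))
        · exact (ENNReal.mul_le_mul_iff_left (hZ0 k x) (hZt k x)).1 h2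
      have := (ENNReal.tendsto_toReal ENNReal.one_ne_top).comp hA
      rw [ENNReal.toReal_one] at this
      exact this
    · have hxi : x ∈ (closure W')ᶜ := fun h => hxf ⟨h, fun h2 => hxW (interior_subset h2)⟩
      obtain ⟨ε, hε, hball⟩ := Metric.isOpen_iff.1 isClosed_closure.isOpen_compl x hxi
      rw [Set.indicator_of_notMem hxW]
      refine tendsto_const_nhds.congr' ?_
      filter_upwards [hrt.eventually (gt_mem_nhds hε)] with k hk
      have h1 : Nf p (w k) (r k) P' x = 0 :=
        Nf_eq_zero _ _ _ _ fun γ h1 h2 => hball (Metric.mem_ball.2 (h1.trans hk)) (subset_closure h2)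
      have h2 := (hbd k).1
      rw [h1, mul_zero, nonpos_iff_eq_zero] at h2
      rw [(mul_eq_zero.1 h2).resolve_right (hZ0 k x), ENNReal.toReal_zero]

end avg
end BDE

namespace BDE

open scoped ENNReal

theorem exp_summable {E : Type} [NormedAddCommGroup E] [NormedSpace ℝ E] [FiniteDimensional ℝ E]
    (Γ : AddSubgroup E) [DiscreteTopology Γ] (a : ℝ) (ha : 0 < a) :
    Summable fun γ : Γ => Real.exp (-(‖(γ : E)‖ / a)) := by
  let L : Submodule ℤ E := AddSubgroup.toIntSubmodule Γ
  have hdL : DiscreteTopology L := inferInstanceAs (DiscreteTopology Γ)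
  let N := Module.finrank ℤ L + 1
  have hsum : Summable fun z : L => ‖z‖⁻¹ ^ N := ZLattice.summable_norm_pow_inv L N (by simp [N])
  have hsum2 : Summable fun z : Γ => ‖(z : E)‖⁻¹ ^ N := hsum
  refine Summable.of_norm_bounded_eventually (hsum2.mul_left (N.factorial * a ^ N)) ?_
  refine Set.Finite.subset (Set.finite_singleton (0 : Γ)) ?_
  intro γ hγ
  by_contra h0
  apply hγ
  have h1 : 0 < ‖(γ : E)‖ := norm_pos_iff.2 (fun h => h0 (Subtype.ext h))
  show ‖Real.exp (-(‖(γ : E)‖ / a))‖ ≤ N.factorial * a ^ N * ‖(γ : E)‖⁻¹ ^ N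
  rw [Real.norm_of_nonneg (Real.exp_pos _).le, Real.exp_neg]
  have h2 := Real.pow_div_factorial_le_exp (‖(γ : E)‖ / a) (by positivity) N
  have h3 : (0 : ℝ) < (‖(γ : E)‖ / a) ^ N / N.factorial := by positivity
  refine (inv_anti₀ h3 h2).trans (le_of_eq ?_)
  rw [inv_div, div_pow, inv_pow]
  field_simp

theorem frac_match_lattice {m n : ℕ}
    (Γ : AddSubgroup ((Fin m → ℝ) × (Fin n → ℝ))) (hΓ : IsLattice Γ)
    (hinj : Set.InjOn Prod.fst (Γ : Set ((Fin m → ℝ) × (Fin n → ℝ))))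
    (hdense : Dense (Prod.snd '' (Γ : Set ((Fin m → ℝ) × (Fin n → ℝ)))))
    (W W' : Set (Fin n → ℝ))
    (hWbd : Bornology.IsBounded W) (hW'bd : Bornology.IsBounded W')
    (hWrm : volume (frontier W) = 0) (hW'rm : volume (frontier W') = 0)
    (hbde : BDEquiv (modelSet Γ W) (modelSet Γ W')) :
    ∃ (T : Finset Γ) (u : T → (Fin n → ℝ) → ℝ), (∀ d, Measurable (u d)) ∧ (∀ d x, 0 ≤ u d x ∧ u d x ≤ 1) ∧
      (∃ K : Set (Fin n → ℝ), Bornology.IsBounded K ∧ ∀ d x, x ∉ K → u d x = 0) ∧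
      (∀ᵐ x, ∑ d, u d x = W.indicator (fun _ => (1 : ℝ)) x) ∧
      (∀ᵐ x, ∑ d, u d (x - d.1.1.2) = W'.indicator (fun _ => (1 : ℝ)) x) := by
  classical
  have hdisc : DiscreteTopology Γ := hΓ.1
  have hcount : Countable Γ := countable_of_Lindelof_of_discrete
  let p : Γ →+ (Fin n → ℝ) := (AddMonoidHom.snd _ _).comp Γ.subtype
  have hp : DenseRange p := by
    have : Set.range p = Prod.snd '' (Γ : Set ((Fin m → ℝ) × (Fin n → ℝ))) := by
      ext x
      constructor
      · rintro ⟨γ, rfl⟩; exact ⟨γ, γ.2, rfl⟩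
      · rintro ⟨γ, h, rfl⟩; exact ⟨⟨γ, h⟩, rfl⟩
    rw [DenseRange, this]; exact hdense
  obtain ⟨C, hC, χ, hχ, hχd⟩ := hbde
  -- the matching
  have key : ∀ γ : Γ, p γ ∈ W → ∃ δ : Γ, ∃ h : (γ : (Fin m → ℝ) × (Fin n → ℝ)).1 ∈ modelSet Γ W,
      p (γ + δ) ∈ W' ∧ (χ ⟨_, h⟩ : Fin m → ℝ) = ((γ + δ : Γ) : (Fin m → ℝ) × (Fin n → ℝ)).1 := by
    intro γ hγ
    have h : (γ : (Fin m → ℝ) × (Fin n → ℝ)).1 ∈ modelSet Γ W := ⟨γ, γ.2, hγ, rfl⟩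
    obtain ⟨γ', hγ', h1, h2⟩ := (χ ⟨_, h⟩).2
    refine ⟨⟨γ', hγ'⟩ - γ, h, ?_, ?_⟩
    · rw [add_sub_cancel]; exact h1
    · rw [add_sub_cancel]; exact h2.symm
  let f : Γ → Γ := fun γ => if h : p γ ∈ W then (key γ h).choose else 0
  have hf : ∀ γ, p γ ∈ W → ∃ h : (γ : (Fin m → ℝ) × (Fin n → ℝ)).1 ∈ modelSet Γ W,
      p (γ + f γ) ∈ W' ∧ (χ ⟨_, h⟩ : Fin m → ℝ) = ((γ + f γ : Γ) : (Fin m → ℝ) × (Fin n → ℝ)).1 := by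
    intro γ h
    simp only [f, dif_pos h]
    exact (key γ h).choose_spec
  have hpinj : ∀ a b : Γ, (a : (Fin m → ℝ) × (Fin n → ℝ)).1 = (b : (Fin m → ℝ) × (Fin n → ℝ)).1 → a = b :=
    fun a b h => Subtype.ext (hinj a.2 b.2 h)
  have hb : Set.BijOn (fun γ => γ + f γ) {γ | p γ ∈ W} {γ | p γ ∈ W'} := by
    refine ⟨fun γ hγ => (hf γ hγ).choose_spec.1, ?_, ?_⟩
    · intro a ha b hb hab
      obtain ⟨h1, h2, h3⟩ := hf a ha
      obtain ⟨h4, h5, h6⟩ := hf b hb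
      have : χ ⟨_, h1⟩ = χ ⟨_, h4⟩ := Subtype.ext (by rw [h3, h6]; exact congrArg (fun z : Γ => (z : (Fin m → ℝ) × (Fin n → ℝ)).1) hab)
      have := hχ.1 this
      exact hpinj a b (congrArg Subtype.val this)
    · intro b hb
      obtain ⟨⟨_, γ, hγ, hγW, rfl⟩, ha2⟩ := hχ.2 ⟨(b : (Fin m → ℝ) × (Fin n → ℝ)).1, b, b.2, hb, rfl⟩
      refine ⟨⟨γ, hγ⟩, hγW, hpinj _ _ ?_⟩
      obtain ⟨h1, h2, h3⟩ := hf ⟨γ, hγ⟩ hγW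
      show ((⟨γ, hγ⟩ + f ⟨γ, hγ⟩ : Γ) : (Fin m → ℝ) × (Fin n → ℝ)).1 = _
      rw [← h3, ha2]
  obtain ⟨r1, hr1⟩ := hWbd.subset_closedBall 0
  obtain ⟨r2, hr2⟩ := hW'bd.subset_closedBall 0
  have hfb : ∀ γ, p γ ∈ W → ((f γ : Γ) : (Fin m → ℝ) × (Fin n → ℝ)) ∈ Metric.closedBall 0 (max C (r2 + r1)) := by
    intro γ hγ
    obtain ⟨h1, h2, h3⟩ := hf γ hγ
    rw [mem_closedBall_zero_iff, Prod.norm_def]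
    refine max_le_max ?_ ?_
    · have := hχd ⟨_, h1⟩
      rw [h3, dist_eq_norm] at this
      simpa using this
    · have e1 := mem_closedBall_zero_iff.1 (hr2 h2)
      have e2 := mem_closedBall_zero_iff.1 (hr1 hγ)
      have e3 : (f γ : (Fin m → ℝ) × (Fin n → ℝ)).2 = p (γ + f γ) - p γ := by
        rw [map_add, add_sub_cancel_left]; rfl
      rw [e3]
      exact (norm_sub_le _ _).trans (add_le_add e1 e2)
  have hfin : Set.Finite {γ : Γ | (γ : (Fin m → ℝ) × (Fin n → ℝ)) ∈ Metric.closedBall (0 : (Fin m → ℝ) × (Fin n → ℝ)) (max C (r2 + r1))} := by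
    have H : IsClosed (Γ : Set ((Fin m → ℝ) × (Fin n → ℝ))) := AddSubgroup.isClosed_of_discrete
    exact ((Metric.finite_isBounded_inter_isClosed DiscreteTopology.isDiscrete
      (Metric.isBounded_closedBall (x := (0 : (Fin m → ℝ) × (Fin n → ℝ))) (r := max C (r2 + r1))) H).preimage_embedding
      (.subtype _)).subset fun γ hγ => ⟨hγ, γ.2⟩
  let T : Finset Γ := hfin.toFinset
  have hTn : ∀ δ ∈ T, ‖(δ : (Fin m → ℝ) × (Fin n → ℝ))‖ ≤ max C (r2 + r1) := by
    intro δ hδ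
    exact mem_closedBall_zero_iff.1 (hfin.mem_toFinset.1 hδ)
  let c := max C (r2 + r1)
  have hwq : ∀ (k : ℕ) (a b : Γ), ‖((a - b : Γ) : (Fin m → ℝ) × (Fin n → ℝ))‖ ≤ c →
      ENNReal.ofReal (Real.exp (-(‖(a : (Fin m → ℝ) × (Fin n → ℝ))‖ / ((k : ℝ) + 1)))) ≤
      ENNReal.ofReal (Real.exp (c / ((k : ℝ) + 1))) * ENNReal.ofReal (Real.exp (-(‖(b : (Fin m → ℝ) × (Fin n → ℝ))‖ / ((k : ℝ) + 1)))) := by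
    intro k a b hab
    rw [← ENNReal.ofReal_mul (Real.exp_pos _).le, ← Real.exp_add]
    refine ENNReal.ofReal_le_ofReal (Real.exp_le_exp.2 ?_)
    have h1 : ‖(b : (Fin m → ℝ) × (Fin n → ℝ))‖ ≤ ‖(a : (Fin m → ℝ) × (Fin n → ℝ))‖ + c := by
      have h2 := norm_le_norm_add_norm_sub (a : (Fin m → ℝ) × (Fin n → ℝ)) b
      have h3 : ‖(a : (Fin m → ℝ) × (Fin n → ℝ)) - b‖ ≤ c := hab
      linarith
    rw [← sub_eq_add_neg, neg_le_sub_iff_le_add, ← add_div]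
    exact div_le_div_of_nonneg_right (by linarith) (by positivity)
  obtain ⟨u, h1, h2, h3, h4, h5⟩ := frac_match volume p hp (fun k γ => ENNReal.ofReal (Real.exp (-(‖(γ : (Fin m → ℝ) × (Fin n → ℝ))‖ / ((k : ℝ) + 1)))))
    (fun k γ => by rw [Ne, ENNReal.ofReal_eq_zero, not_le]; exact Real.exp_pos _)
    (fun k => (exp_summable Γ _ (by positivity)).tsum_ofReal_ne_top) W W' hWbd hWrm hW'rm T f
    (fun γ hγ => hfin.mem_toFinset.2 (hfb γ hγ)) hb (fun k => ENNReal.ofReal (Real.exp (c / ((k : ℝ) + 1))))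
    (fun k δ hδ γ => hwq k γ (γ + δ) (by
      rw [show γ - (γ + δ) = -δ by abel, NegMemClass.coe_neg, norm_neg]; exact hTn δ hδ))
    (fun k δ hδ γ => hwq k γ (γ - δ) (by
      rw [show γ - (γ - δ) = δ by abel]; exact hTn δ hδ))
    (by
      have h1 : Filter.Tendsto (fun k : ℕ => c / ((k : ℝ) + 1)) Filter.atTop (nhds 0) := by
        have := (tendsto_one_div_add_atTop_nhds_zero_nat (𝕜 := ℝ)).const_mul c
        simpa only [mul_one_div, mul_zero] using this
      have h2 := ENNReal.tendsto_ofReal ((Real.continuous_exp.tendsto 0).comp h1)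
      simpa using h2)
    (fun k => ENNReal.ofReal_ne_top)
    (fun k => by rw [Ne, ENNReal.ofReal_eq_zero, not_le]; exact Real.exp_pos _)
  exact ⟨T, u, h1, h2, h3, h4, h5⟩

end BDE

namespace BDE

theorem split_group {m n : ℕ}
    (Γ : AddSubgroup ((Fin m → ℝ) × (Fin n → ℝ))) (hΓ : IsLattice Γ) :
    ∃ (κ : Type) (_ : Fintype κ) (b : Module.Basis κ ℝ (Fin n → ℝ)) (J : Type) (_ : Fintype J) (_ : DecidableEq J)
      (i : (J → ℤ) →+ (Fin n → ℝ)),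
      (∀ z ∈ Submodule.span ℤ (Set.range b), z ∈ Prod.snd '' (Γ : Set ((Fin m → ℝ) × (Fin n → ℝ)))) ∧
      (∀ g, i g ∈ Prod.snd '' (Γ : Set ((Fin m → ℝ) × (Fin n → ℝ)))) ∧
      (∀ x ∈ Prod.snd '' (Γ : Set ((Fin m → ℝ) × (Fin n → ℝ))), ∃ g, ∃ z ∈ Submodule.span ℤ (Set.range b), x = i g + z) ∧
      (∀ g, i g ∈ Submodule.span ℤ (Set.range b) → g = 0) := by
  classical
  let L : Submodule ℤ ((Fin m → ℝ) × (Fin n → ℝ)) := AddSubgroup.toIntSubmodule Γ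
  have hdL : DiscreteTopology L := hΓ.1
  have hfin : Module.Finite ℤ L := inferInstance
  let G : Submodule ℤ (Fin n → ℝ) := L.map ((LinearMap.snd ℤ (Fin m → ℝ) (Fin n → ℝ)))
  have hG : ∀ x, x ∈ G ↔ x ∈ Prod.snd '' (Γ : Set ((Fin m → ℝ) × (Fin n → ℝ))) := by
    intro x; rfl
  have hfinG : Module.Finite ℤ G := Module.Finite.iff_fg.2 ((Module.Finite.iff_fg.1 hfin).map _)
  have hfree : Module.Free ℤ G := inferInstance
  let β := Module.Free.chooseBasis ℤ G
  let I := Module.Free.ChooseBasisIndex ℤ G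
  let v : I → (Fin n → ℝ) := fun j => (β j : Fin n → ℝ)
  have hGs : ∀ x ∈ G, ∃ c : I → ℤ, x = ∑ j, c j • v j := by
    intro x hx
    refine ⟨fun j => β.repr ⟨x, hx⟩ j, ?_⟩
    have := congrArg (Subtype.val) (β.sum_repr ⟨x, hx⟩)
    refine this.symm.trans ?_
    rw [AddSubmonoidClass.coe_finsetSum]
    rfl
  have hvli : LinearIndependent ℤ v := β.linearIndependent.map' G.subtype (Submodule.ker_subtype _)
  have hvspan : Submodule.span ℝ (Set.range v) = ⊤ := by
    rw [eq_top_iff]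
    have h1 : Submodule.span ℝ (Γ : Set ((Fin m → ℝ) × (Fin n → ℝ))) ≤
        (Submodule.span ℝ (Set.range v)).comap (LinearMap.snd ℝ _ _) := by
      rw [Submodule.span_le]
      intro γ hγ
      obtain ⟨c, hc⟩ := hGs γ.2 ((hG _).2 ⟨γ, hγ, rfl⟩)
      show γ.2 ∈ Submodule.span ℝ (Set.range v)
      rw [hc]
      refine Submodule.sum_mem _ fun j _ => ?_
      rw [← Int.cast_smul_eq_zsmul ℝ]
      exact Submodule.smul_mem _ _ (Submodule.subset_span ⟨j, rfl⟩)
    rw [hΓ.2] at h1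
    intro x _
    exact h1 (x := ((0 : Fin m → ℝ), x)) trivial
  obtain ⟨κ, a, ha, hspan, hli⟩ := exists_linearIndependent' ℝ v
  have hκ : Finite κ := Finite.of_injective a ha
  let ft : Fintype κ := Fintype.ofFinite κ
  let b : Module.Basis κ ℝ (Fin n → ℝ) := Module.Basis.mk hli (by rw [hspan, hvspan])
  have hb : ∀ k, b k = v (a k) := fun k => by simp [b]
  let J := {j : I // j ∉ Set.range a}
  let i : (J → ℤ) →+ (Fin n → ℝ) := 
    { toFun := fun g => ∑ j : J, g j • v j
      map_zero' := by simp
      map_add' := fun g h => by simp [add_smul, Finset.sum_add_distrib] }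
  have hi : ∀ g, i g = ∑ j : J, g j • v j := fun g => rfl
  have hvG : ∀ j, v j ∈ G := fun j => (β j).2
  have hsplit : ∀ c : I → ℤ, ∑ j, c j • v j = (∑ j : J, c j • v j) + ∑ k, c (a k) • v (a k) := by
    intro c
    have h1 := Fintype.sum_subtype_add_sum_subtype (fun j => j ∉ Set.range a) (fun j => c j • v j)
    rw [← h1]
    congr 1
    refine (Fintype.sum_equiv ((Equiv.ofInjective a ha).trans (Equiv.subtypeEquivRight (by simp))) _ _ ?_).symm
    intro k; rfl
  refine ⟨κ, ft, b, J, inferInstance, inferInstance, i, ?_, ?_, ?_, ?_⟩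
  · intro z hz
    rw [← hG]
    have : Submodule.span ℤ (Set.range b) ≤ G := by
      rw [Submodule.span_le]
      rintro _ ⟨k, rfl⟩
      rw [hb]; exact hvG _
    exact this hz
  · intro g
    rw [← hG, hi]
    exact Submodule.sum_mem _ fun j _ => Submodule.smul_mem _ _ (hvG _)
  · intro x hx
    obtain ⟨c, hc⟩ := hGs x ((hG _).2 hx)
    refine ⟨fun j => c j, ∑ k, c (a k) • v (a k), ?_, ?_⟩
    · refine Submodule.sum_mem _ fun k _ => Submodule.smul_mem _ _ (Submodule.subset_span ⟨k, hb k⟩)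
    · rw [hc, hsplit, hi]
  · intro g hg
    obtain ⟨d, hd⟩ := (Submodule.mem_span_range_iff_exists_fun ℤ).1 hg
    let c : I → ℤ := fun j => if h : j ∈ Set.range a then - d h.choose else g ⟨j, h⟩
    have hc1 : ∀ j : J, c j = g j := fun j => by simp only [c]; rw [dif_neg j.2]
    have hc2 : ∀ k, c (a k) = - d k := fun k => by
      have h : a k ∈ Set.range a := ⟨k, rfl⟩
      simp only [c]; rw [dif_pos h, ha h.choose_spec]
    have h0 : ∑ j, c j • v j = 0 := by
      rw [hsplit]
      simp only [hc1, hc2]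
      rw [← hi, ← hd]
      simp only [hb, neg_smul, Finset.sum_neg_distrib, add_neg_cancel]
    have := Fintype.linearIndependent_iff.1 hvli c h0
    ext j
    rw [← hc1, this]; rfl

end BDE

namespace BDE

section Om

variable {n : ℕ} {κ : Type} [Fintype κ] {J : Type} [Fintype J] [DecidableEq J]

/-- The fundamental domain, on which `ℤ^J` acts through translations modulo the lattice. -/
def Om (b : Module.Basis κ ℝ (Fin n → ℝ)) (_i : (J → ℤ) →+ (Fin n → ℝ)) : Type := ZSpan.fundamentalDomain b

variable (b : Module.Basis κ ℝ (Fin n → ℝ)) (i : (J → ℤ) →+ (Fin n → ℝ))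

/-- the integer part -/
noncomputable def fl (x : Fin n → ℝ) : Fin n → ℝ := (ZSpan.floor b x : Fin n → ℝ)

/-- the value of a point of the fundamental domain -/
def Om.val {b : Module.Basis κ ℝ (Fin n → ℝ)} {i : (J → ℤ) →+ (Fin n → ℝ)} (ω : Om b i) : Fin n → ℝ := Subtype.val ω

/-- reduction modulo the lattice -/
noncomputable def pr (x : Fin n → ℝ) : Om b i := ZSpan.fractRestrict b x

instance : MeasurableSpace (Om b i) := inferInstanceAs (MeasurableSpace (ZSpan.fundamentalDomain b))

theorem fl_mem (x : Fin n → ℝ) : fl b x ∈ Submodule.span ℤ (Set.range b) := (ZSpan.floor b x).2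

theorem val_pr (x : Fin n → ℝ) : (pr b i x).val = ZSpan.fract b x := rfl

theorem val_pr_add (x : Fin n → ℝ) : (pr b i x).val + fl b x = x := by
  rw [val_pr, ZSpan.fract_apply]; exact sub_add_cancel _ _

variable {b i}

theorem Om.ext {ω ω' : Om b i} (h : ω.val = ω'.val) : ω = ω' := Subtype.ext h

theorem val_mem (ω : Om b i) : ω.val ∈ ZSpan.fundamentalDomain b := Subtype.prop ω

theorem pr_val (ω : Om b i) : pr b i ω.val = ω := Om.ext (ZSpan.fract_eq_self.2 (val_mem ω))

theorem pr_add (x : Fin n → ℝ) {z : Fin n → ℝ} (hz : z ∈ Submodule.span ℤ (Set.range b)) :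
    pr b i (x + z) = pr b i x := Om.ext (ZSpan.fract_add_ZSpan b x hz)

theorem pr_add_left (x : Fin n → ℝ) {z : Fin n → ℝ} (hz : z ∈ Submodule.span ℤ (Set.range b)) :
    pr b i (z + x) = pr b i x := Om.ext (ZSpan.fract_zSpan_add b x hz)

theorem pr_val_add (x y : Fin n → ℝ) : pr b i (y + (pr b i x).val) = pr b i (y + x) := by
  conv_rhs => rw [← val_pr_add b i x, ← add_assoc, pr_add _ (fl_mem b x)]

theorem fl_add_mem (ω : Om b i) {z : Fin n → ℝ} (hz : z ∈ Submodule.span ℤ (Set.range b)) :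
    fl b (ω.val + z) = z := by
  have h := val_pr_add b i (ω.val + z)
  rw [pr_add _ hz, pr_val] at h
  exact add_left_cancel h

noncomputable instance : AddAction (J → ℤ) (Om b i) where
  vadd g ω := pr b i (i g + ω.val)
  zero_vadd ω := by
    show pr b i (i 0 + ω.val) = ω
    rw [map_zero, zero_add, pr_val]
  add_vadd g h ω := by
    show pr b i (i (g + h) + ω.val) = pr b i (i g + (pr b i (i h + ω.val)).val)
    rw [pr_val_add, map_add, add_assoc]

theorem vadd_def (g : J → ℤ) (ω : Om b i) : g +ᵥ ω = pr b i (i g + ω.val) := rfl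

theorem vadd_pr (g : J → ℤ) (x : Fin n → ℝ) : g +ᵥ pr b i x = pr b i (i g + x) := by
  rw [vadd_def, pr_val_add]

theorem measurable_val : Measurable (Om.val : Om b i → (Fin n → ℝ)) := measurable_subtype_coe

theorem measurable_fl : Measurable (fl b) := by
  have : fl b = fun x => ∑ k, ((⌊b.repr x k⌋ : ℤ) : ℝ) • b k := by
    funext x
    rw [← b.sum_repr (fl b x)]
    exact Finset.sum_congr rfl fun k _ => by rw [fl, ZSpan.repr_floor_apply]
  rw [this]
  refine Finset.measurable_fun_sum _ fun k _ => ?_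
  refine Measurable.smul_const ?_ _
  have h1 : Measurable fun x => b.repr x k := by
    have : Continuous fun x => b.coord k x := LinearMap.continuous_of_finiteDimensional _
    exact this.measurable
  exact (Measurable.of_discrete (f := fun z : ℤ => (z : ℝ))).comp (Int.measurable_floor.comp h1)

theorem measurable_pr : Measurable (pr b i) := by
  refine Measurable.subtype_mk ?_
  exact measurable_id.sub measurable_fl

theorem measurable_vadd_Om (g : J → ℤ) : Measurable (fun ω : Om b i => g +ᵥ ω) :=
  measurable_pr.comp (measurable_val.const_add _)

theorem hasCol_Om (hi : ∀ g, i g ∈ Submodule.span ℤ (Set.range b) → g = 0) : HasCol J (Om b i) := by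
  classical
  intro s
  have hcl : IsClosed ((Submodule.span ℤ (Set.range b) : Submodule ℤ (Fin n → ℝ)) : Set (Fin n → ℝ)) :=
    AddSubgroup.isClosed_of_discrete (H := (Submodule.span ℤ (Set.range b)).toAddSubgroup)
  have h1 : ∀ g : J → ℤ, ∃ ε > 0, g ≠ 0 → ∀ z ∈ Submodule.span ℤ (Set.range b), ε ≤ dist (i g) z := by
    intro g
    by_cases hg : g = 0
    · exact ⟨1, one_pos, fun h => absurd hg h⟩
    · have : i g ∈ ((Submodule.span ℤ (Set.range b) : Submodule ℤ (Fin n → ℝ)) : Set (Fin n → ℝ))ᶜ := fun h => hg (hi g h)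
      obtain ⟨ε, hε, h⟩ := Metric.isOpen_iff.1 hcl.isOpen_compl _ this
      refine ⟨ε, hε, fun _ z hz => ?_⟩
      by_contra hlt
      rw [not_le, dist_comm] at hlt
      exact h hlt hz
  choose ε hε hεd using h1
  obtain ⟨δ, hδ, hδε⟩ : ∃ δ > 0, ∀ g ∈ Q J s, δ ≤ ε g := by
    by_cases hne : (Q J s).Nonempty
    · obtain ⟨g, hg, h⟩ := (Q J s).exists_min_image ε hne
      exact ⟨ε g, hε g, h⟩
    · exact ⟨1, one_pos, fun g hg => absurd ⟨g, hg⟩ hne⟩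
  have hex : ∀ ω : Om b i, ∃ N : ℕ, dist ω.val (TopologicalSpace.denseSeq (Fin n → ℝ) N) < δ / 2 := by
    intro ω
    obtain ⟨N, hN⟩ := (TopologicalSpace.denseRange_denseSeq (Fin n → ℝ)).exists_dist_lt ω.val (half_pos hδ)
    exact ⟨N, hN⟩
  refine ⟨fun ω => Nat.find (hex ω), measurable_find hex fun k => ?_, ?_⟩
  · exact measurableSet_lt (measurable_val.dist measurable_const) measurable_const
  · intro ω g hg hg0 heq
    have e1 := Nat.find_spec (hex ω)
    have e2 := Nat.find_spec (hex (g +ᵥ ω))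
    simp only at heq
    rw [heq] at e2
    have e3 := dist_triangle_right (g +ᵥ ω).val ω.val (TopologicalSpace.denseSeq (Fin n → ℝ) (Nat.find (hex ω)))
    have e4 := hεd g hg0 _ (fl_mem b (i g + ω.val))
    have e5 := hδε g hg
    have e6 : dist (g +ᵥ ω).val ω.val = dist (i g) (fl b (i g + ω.val)) := by
      have := val_pr_add b i (i g + ω.val)
      rw [← vadd_def] at this
      rw [dist_eq_norm, dist_eq_norm]
      congr 1
      rw [sub_eq_sub_iff_add_eq_add, this]
    linarith

/-- the measure on the fundamental domain -/
noncomputable def nuOm (b : Module.Basis κ ℝ (Fin n → ℝ)) (i : (J → ℤ) →+ (Fin n → ℝ)) : Measure (Om b i) :=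
  Measure.comap (Subtype.val : ZSpan.fundamentalDomain b → (Fin n → ℝ)) volume

theorem map_nuOm : (nuOm b i).map Om.val = volume.restrict (ZSpan.fundamentalDomain b) :=
  map_comap_subtype_coe (ZSpan.fundamentalDomain_measurableSet b) volume

theorem ae_nuOm {P : (Fin n → ℝ) → Prop} :
    (∀ᵐ ω ∂(nuOm b i), P ω.val) ↔ ∀ᵐ x, x ∈ ZSpan.fundamentalDomain b → P x := by
  have he : MeasurableEmbedding (Om.val : Om b i → (Fin n → ℝ)) :=
    MeasurableEmbedding.subtype_coe (ZSpan.fundamentalDomain_measurableSet b)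
  rw [← he.ae_map_iff, map_nuOm, ae_restrict_iff' (ZSpan.fundamentalDomain_measurableSet b)]

instance : IsFiniteMeasure (nuOm b i) := by
  constructor
  have h : (nuOm b i).map Om.val Set.univ = nuOm b i Set.univ := by
    rw [Measure.map_apply measurable_val MeasurableSet.univ, Set.preimage_univ]
  rw [← h, map_nuOm, Measure.restrict_apply_univ]
  exact (ZSpan.fundamentalDomain_isBounded b).measure_lt_top

theorem ae_translate {P : (Fin n → ℝ) → Prop} (h : ∀ᵐ x, P x) (z : Fin n → ℝ) : ∀ᵐ x, P (x + z) :=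
  (measurePreserving_add_right volume z).quasiMeasurePreserving.ae h

theorem ae_pull {P : Om b i → Prop} (h : ∀ᵐ ω ∂(nuOm b i), P ω) : ∀ᵐ x, P (pr b i x) := by
  have h1 : ∀ᵐ x, x ∈ ZSpan.fundamentalDomain b → P (pr b i x) := by
    rw [← ae_nuOm (i := i) (P := fun x => P (pr b i x))]
    simpa only [pr_val] using h
  have : Countable (Submodule.span ℤ (Set.range b)) := countable_of_Lindelof_of_discrete
  have h2 : ∀ᵐ x : Fin n → ℝ, ∀ z : Submodule.span ℤ (Set.range b),
      x + z ∈ ZSpan.fundamentalDomain b → P (pr b i (x + z)) := by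
    rw [ae_all_iff]
    intro z
    exact ae_translate h1 z
  filter_upwards [h2] with x hx
  have := hx (-ZSpan.floor b x) (by
    have := ZSpan.fract_mem_fundamentalDomain b x
    rw [ZSpan.fract_apply, sub_eq_add_neg] at this
    exact this)
  rwa [pr_add _ (-ZSpan.floor b x).2] at this

theorem ae_push {P : (Fin n → ℝ) → Prop} (h : ∀ᵐ x, P x) (z : Fin n → ℝ) :
    ∀ᵐ ω ∂(nuOm b i), P (ω.val + z) := by
  rw [ae_nuOm (i := i) (P := fun x => P (x + z))]
  exact (ae_translate h z).mono fun x hx _ => hx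

theorem quasi_Om (g : J → ℤ) : Measure.QuasiMeasurePreserving (fun ω : Om b i => g +ᵥ ω) (nuOm b i) (nuOm b i) := by
  refine ⟨measurable_vadd_Om g, ?_⟩
  refine Measure.AbsolutelyContinuous.mk fun N hN hN0 => ?_
  rw [Measure.map_apply (measurable_vadd_Om g) hN]
  have h1 : ∀ᵐ ω ∂(nuOm b i), ω ∉ N := measure_eq_zero_iff_ae_notMem.1 hN0
  have h2 := ae_push (b := b) (i := i) (ae_pull h1) (i g)
  rw [measure_eq_zero_iff_ae_notMem]
  filter_upwards [h2] with ω hω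
  rw [add_comm] at hω
  exact hω

theorem syndetic_Om (U : Set (Fin n → ℝ)) (hU : IsOpen U) (hne : U.Nonempty)
    (hd : Dense {x | ∃ g, ∃ z ∈ Submodule.span ℤ (Set.range b), x = i g + z}) :
    ∃ R : ℤ, 0 ≤ R ∧ ∀ ω : Om b i, ∃ g ∈ Q J R, ∃ z ∈ Submodule.span ℤ (Set.range b), i g + ω.val + z ∈ U := by
  classical
  have hc : IsCompact (closure (ZSpan.fundamentalDomain b)) := (ZSpan.fundamentalDomain_isBounded b).isCompact_closure
  let O : (J → ℤ) → Set (Fin n → ℝ) := fun g =>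
    ⋃ z : Submodule.span ℤ (Set.range b), {x | i g + x + z ∈ U}
  have hO : ∀ g, IsOpen (O g) := fun g => isOpen_iUnion fun z => by
    exact hU.preimage (by fun_prop : Continuous fun x : Fin n → ℝ => i g + x + z)
  have hcov : closure (ZSpan.fundamentalDomain b) ⊆ ⋃ g, O g := by
    intro x _
    have ho : IsOpen {y | x + y ∈ U} := hU.preimage (by fun_prop : Continuous fun y : Fin n → ℝ => x + y)
    obtain ⟨u, hu⟩ := hne
    obtain ⟨y, ⟨g, z, hz, rfl⟩, hy⟩ := hd.exists_mem_open ho ⟨u - x, by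
      show x + (u - x) ∈ U
      rwa [add_sub_cancel]⟩
    refine Set.mem_iUnion.2 ⟨g, Set.mem_iUnion.2 ⟨⟨z, hz⟩, ?_⟩⟩
    show i g + x + z ∈ U
    have hy2 : x + (i g + z) ∈ U := hy
    rwa [add_comm (i g) x, add_assoc]
  obtain ⟨t, ht⟩ := hc.elim_finite_subcover O hO hcov
  refine ⟨∑ g ∈ t, ∑ j, |g j|, Finset.sum_nonneg fun g _ => Finset.sum_nonneg fun j _ => abs_nonneg _, ?_⟩
  intro ω
  obtain ⟨g, hg, hgO⟩ := Set.mem_iUnion₂.1 (ht (subset_closure (val_mem ω)))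
  obtain ⟨z, hz⟩ := Set.mem_iUnion.1 hgO
  refine ⟨g, ?_, z, z.2, hz⟩
  rw [mem_Q]
  intro j
  rw [← abs_le]
  refine (Finset.single_le_sum (f := fun j => |g j|) (fun j _ => abs_nonneg _) (Finset.mem_univ j)).trans ?_
  exact Finset.single_le_sum (f := fun g : J → ℤ => ∑ j, |g j|) (fun g _ => Finset.sum_nonneg fun j _ => abs_nonneg _) hg

/-- floors of a bounded set -/
theorem floors (K : Set (Fin n → ℝ)) (hK : Bornology.IsBounded K) :
    ∃ S : Finset (Fin n → ℝ), (∀ z ∈ S, z ∈ Submodule.span ℤ (Set.range b)) ∧ ∀ x ∈ K, fl b x ∈ S := by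
  have h1 := ZSpan.setFinite_inter b (hK.sub (ZSpan.fundamentalDomain_isBounded b))
  refine ⟨h1.toFinset, fun z hz => ((h1.mem_toFinset).1 hz).2, fun x hx => h1.mem_toFinset.2 ⟨?_, fl_mem b x⟩⟩
  refine ⟨x, hx, ZSpan.fract b x, ZSpan.fract_mem_fundamentalDomain b x, ?_⟩
  simp [ZSpan.fract_apply, fl]

end Om

end BDE

namespace BDE

section Per

variable {n : ℕ} {κ : Type} [Fintype κ] {J : Type} [Fintype J] [DecidableEq J]

/-- periodization -/
noncomputable def per (b : Module.Basis κ ℝ (Fin n → ℝ)) (f : (Fin n → ℝ) → ℝ) (x : Fin n → ℝ) : ℝ :=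
  ∑' z : Submodule.span ℤ (Set.range b), f (x + z)

variable {b : Module.Basis κ ℝ (Fin n → ℝ)} {i : (J → ℤ) →+ (Fin n → ℝ)}

theorem per_add (f : (Fin n → ℝ) → ℝ) (x : Fin n → ℝ) {z : Fin n → ℝ}
    (hz : z ∈ Submodule.span ℤ (Set.range b)) : per b f (x + z) = per b f x := by
  have := (Equiv.addLeft (⟨z, hz⟩ : Submodule.span ℤ (Set.range b))).tsum_eq
    (fun y : Submodule.span ℤ (Set.range b) => f (x + y))
  rw [per, per, ← this]
  refine tsum_congr fun y => ?_
  rw [add_assoc]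
  rfl

theorem per_pr (f : (Fin n → ℝ) → ℝ) (x : Fin n → ℝ) : per b f (pr b i x).val = per b f x := by
  conv_rhs => rw [← val_pr_add b i x, per_add f _ (fl_mem b x)]

theorem per_eq (f : (Fin n → ℝ) → ℝ) (S : Finset (Fin n → ℝ))
    (hS : ∀ z ∈ S, z ∈ Submodule.span ℤ (Set.range b)) (hf : ∀ x, f x ≠ 0 → fl b x ∈ S) (ω : Om b i) :
    per b f ω.val = ∑ l : S, f (ω.val + l) := by
  classical
  have h1 := tsum_eq_sum (L := SummationFilter.unconditional _) (s := S.subtype (· ∈ Submodule.span ℤ (Set.range b)))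
    (f := fun z : Submodule.span ℤ (Set.range b) => f (ω.val + z)) (by
      intro z hz
      by_contra h
      have := hf _ h
      rw [fl_add_mem ω z.2] at this
      exact hz (Finset.mem_subtype.2 this))
  rw [per, h1]
  have h2 := Finset.sum_subtype_of_mem (p := (· ∈ Submodule.span ℤ (Set.range b))) (s := S) (fun z => f (ω.val + z)) hS
  exact h2.trans (Finset.sum_coe_sort S (fun z => f (ω.val + z))).symm

theorem exists_flow {T : Type} [Fintype T] (u : T → (Fin n → ℝ) → ℝ) (p : T → (Fin n → ℝ))
    (hum : ∀ d, Measurable (u d)) (hu : ∀ d x, 0 ≤ u d x ∧ u d x ≤ 1)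
    (S : Finset (Fin n → ℝ)) (hS : ∀ z ∈ S, z ∈ Submodule.span ℤ (Set.range b))
    (h1 : ∀ d x, u d x ≠ 0 → fl b x ∈ S) (h2 : ∀ d x, u d (x - p d) ≠ 0 → fl b x ∈ S)
    (U U' : Set (Fin n → ℝ))
    (hp : ∀ d, ∃ g, ∃ z ∈ Submodule.span ℤ (Set.range b), p d = i g + z)
    (hW : ∀ᵐ x, ∑ d, u d x = U.indicator (fun _ => (1 : ℝ)) x)
    (hW' : ∀ᵐ x, ∑ d, u d (x - p d) = U'.indicator (fun _ => (1 : ℝ)) x) :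
    ∃ φ : J → Om b i → ℝ, (∀ j, Measurable (φ j)) ∧ (∃ M, ∀ j ω, |φ j ω| ≤ M) ∧
      ∀ᵐ ω ∂(nuOm b i), dvg φ ω = (∑ l : S, {ω : Om b i | ω.val + l ∈ U}.indicator (fun _ => (1 : ℝ)) ω) -
        (∑ l : S, {ω : Om b i | ω.val + l ∈ U'}.indicator (fun _ => (1 : ℝ)) ω) := by
  choose g z hz hpz using hp
  let v : T → Om b i → ℝ := fun d ω => ∑ l : S, u d (ω.val + l)
  obtain ⟨φ, hφm, hφb, hφ⟩ := flow_sum (fun g => measurable_vadd_Om (b := b) (i := i) g) Finset.univ v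
    (fun d => Finset.measurable_fun_sum _ fun l _ => (hum d).comp (measurable_val.add_const _))
    (fun d => ⟨∑ l : S, 1, fun ω => (Finset.abs_sum_le_sum_abs _ _).trans (Finset.sum_le_sum fun l _ => by
      rw [abs_of_nonneg (hu d _).1]; exact (hu d _).2)⟩) g
  refine ⟨φ, hφm, hφb, ?_⟩
  have e1 : ∀ᵐ ω ∂(nuOm b i), ∀ l : S, ∑ d, u d (ω.val + l) = U.indicator (fun _ => (1 : ℝ)) (ω.val + l) :=
    ae_all_iff.2 fun l => ae_push hW l
  have e2 : ∀ᵐ ω ∂(nuOm b i), ∀ l : S, ∑ d, u d (ω.val + l - p d) = U'.indicator (fun _ => (1 : ℝ)) (ω.val + l) :=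
    ae_all_iff.2 fun l => ae_push hW' l
  filter_upwards [e1, e2] with ω hω1 hω2
  rw [hφ, Finset.sum_sub_distrib]
  congr 1
  · simp only [v]
    rw [Finset.sum_comm]
    exact Finset.sum_congr rfl fun l _ => hω1 l
  · have key : ∀ d, v d (-g d +ᵥ ω) = ∑ l : S, u d (ω.val + l - p d) := by
      intro d
      have a1 : v d (-g d +ᵥ ω) = per b (u d) (-g d +ᵥ ω).val := (per_eq (u d) S hS (h1 d) _).symm
      have a2 : per b (u d) (ω.val - p d) = per b (fun x => u d (x - p d)) ω.val :=
        tsum_congr fun y => by rw [sub_add_eq_add_sub]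
      rw [a1, vadd_def, per_pr, ← per_eq (fun x => u d (x - p d)) S hS (h2 d) ω, ← a2, map_neg,
        ← per_add (u d) (ω.val - p d) (hz d), hpz]
      congr 1
      abel
    simp only [key]
    rw [Finset.sum_comm]
    exact Finset.sum_congr rfl fun l _ => hω2 l

end Per

theorem equidecomp_of {n : ℕ} {Kt : Type} [Fintype Kt] (W W' U U' H Y : Set (Fin n → ℝ))
    (P : Kt → Set (Fin n → ℝ)) (h : Kt → (Fin n → ℝ)) (hP : ∀ k, MeasurableSet (P k)) (hh : ∀ k, h k ∈ H)
    (hU : ∀ᵐ x, x ∈ W ↔ x ∈ U) (hU' : ∀ᵐ x, x ∈ W' ↔ x ∈ U') (hY : ∀ᵐ x, x ∈ Y)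
    (hYi : ∀ k x, h k + x ∈ Y ↔ x ∈ Y)
    (hPU : ∀ k, P k ⊆ U) (hUP : ∀ x ∈ U, ∃ k, x ∈ P k) (hdisj : ∀ k k' x, x ∈ P k → x ∈ P k' → k = k')
    (himg : ∀ k, ∀ x ∈ P k, x ∈ Y → h k + x ∈ U')
    (hinj : ∀ k k' x x', x ∈ P k → x' ∈ P k' → x ∈ Y → x' ∈ Y → h k + x = h k' + x' → x = x')
    (hsurj : ∀ y ∈ U', y ∈ Y → ∃ k, ∃ x ∈ P k, x ∈ Y ∧ h k + x = y) :
    EquidecompUpToNullMeasPieces W W' H := by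
  let e := Fintype.equivFin Kt
  let X' : Set (Fin n → ℝ) := {x | (x ∈ W ↔ x ∈ U) ∧ (x ∈ W' ↔ x ∈ U') ∧ x ∈ Y}
  refine ⟨Fintype.card Kt, fun j => P (e.symm j), fun j => h (e.symm j), X', ?_, fun j => hP _, fun j => hh _, ⟨?_, ?_⟩, ⟨?_, ?_⟩⟩
  · have : ∀ᵐ x, x ∈ X' := by
      filter_upwards [hU, hU', hY] with x a1 a2 a3 using ⟨a1, a2, a3⟩
    exact this
  · ext x
    simp only [Set.mem_iUnion, Set.mem_inter_iff]
    constructor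
    · rintro ⟨j, h1, h2⟩
      exact ⟨h2.1.2 (hPU _ h1), h2⟩
    · rintro ⟨h1, h2⟩
      obtain ⟨k, hk⟩ := hUP x (h2.1.1 h1)
      exact ⟨e k, by rwa [e.symm_apply_apply], h2⟩
  · intro j j' hjj
    rw [Function.onFun, Set.disjoint_left]
    rintro x ⟨h1, _⟩ ⟨h2, _⟩
    exact hjj (e.symm.injective (hdisj _ _ _ h1 h2))
  · ext y
    simp only [Set.mem_iUnion, Set.mem_inter_iff]
    constructor
    · rintro ⟨j, ⟨x, h1, rfl⟩, h2⟩
      refine ⟨h2.2.1.2 (himg _ x h1 ((hYi _ x).1 h2.2.2)), h2⟩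
    · rintro ⟨h1, h2⟩
      obtain ⟨k, x, hk, _, hx⟩ := hsurj y (h2.2.1.1 h1) h2.2.2
      exact ⟨e k, ⟨x, by rwa [e.symm_apply_apply], by simpa using hx⟩, h2⟩
  · intro j j' hjj
    rw [Function.onFun, Set.disjoint_left]
    rintro y ⟨⟨x, h1, rfl⟩, hy⟩ ⟨⟨x', h2, hx⟩, _⟩
    have hx2 : h (e.symm j') + x' = h (e.symm j) + x := hx
    have hxY : x ∈ Y := (hYi _ x).1 hy.2.2
    have hxY' : x' ∈ Y := (hYi (e.symm j') x').1 (by rw [hx2]; exact hy.2.2)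
    have := hinj _ _ _ _ h1 h2 hxY hxY' hx2.symm
    subst this
    exact hjj (e.symm.injective (hdisj _ _ _ h1 h2))

end BDE

namespace BDE

theorem ae_interior {n : ℕ} (W : Set (Fin n → ℝ)) (h : volume (frontier W) = 0) : ∀ᵐ x, x ∈ W ↔ x ∈ interior W := by
  have h1 : ∀ᵐ x, x ∉ frontier W := measure_eq_zero_iff_ae_notMem.1 h
  filter_upwards [h1] with x hx
  refine ⟨fun hW => ?_, fun hi => interior_subset hi⟩
  by_contra hc
  exact hx ⟨subset_closure hW, hc⟩

theorem final {m n : ℕ}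
    (Γ : AddSubgroup ((Fin m → ℝ) × (Fin n → ℝ))) (hΓ : IsLattice Γ)
    (hinj : Set.InjOn Prod.fst (Γ : Set ((Fin m → ℝ) × (Fin n → ℝ))))
    (hdense : Dense (Prod.snd '' (Γ : Set ((Fin m → ℝ) × (Fin n → ℝ)))))
    (W W' : Set (Fin n → ℝ))
    (hWbd : Bornology.IsBounded W) (hW'bd : Bornology.IsBounded W')
    (hWrm : volume (frontier W) = 0) (hW'rm : volume (frontier W') = 0)
    (hW'pos : 0 < volume W')
    (hbde : BDEquiv (modelSet Γ W) (modelSet Γ W')) :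
    EquidecompUpToNullMeasPieces W W'
      (Prod.snd '' (Γ : Set ((Fin m → ℝ) × (Fin n → ℝ)))) := by
  classical
  obtain ⟨T, u, hum, hu, ⟨K, hKb, hK⟩, huW, huW'⟩ :=
    frac_match_lattice Γ hΓ hinj hdense W W' hWbd hW'bd hWrm hW'rm hbde
  obtain ⟨κ, _, b, J, _, _, i, hbΓ, hiΓ, hsplit, hi0⟩ := split_group Γ hΓ
  have hUae := ae_interior W hWrm
  have hUae' := ae_interior W' hW'rm
  have hne : (interior W').Nonempty := by
    by_contra h
    rw [Set.not_nonempty_iff_eq_empty] at h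
    rw [h] at hUae'
    have : volume W' = 0 := by
      rw [measure_eq_zero_iff_ae_notMem]
      filter_upwards [hUae'] with x hx using fun h => (hx.1 h)
    exact hW'pos.ne' this
  have hGs : (fun x y : Fin n → ℝ => x + y ∈ Prod.snd '' (Γ : Set ((Fin m → ℝ) × (Fin n → ℝ)))) =
      fun x y => x + y ∈ Γ.map (AddMonoidHom.snd _ _) := rfl
  -- all floors
  let KK : Set (Fin n → ℝ) := (K ∪ ⋃ d : T, (fun x => x + d.1.1.2) '' K) ∪ (interior W ∪ interior W')
  have hKK : Bornology.IsBounded KK := by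
    refine (hKb.union ?_).union ((hWbd.subset interior_subset).union (hW'bd.subset interior_subset))
    refine Bornology.isBounded_iUnion.2 fun d => ?_
    have : (fun x => x + d.1.1.2) '' K = K + {d.1.1.2} := by rw [Set.add_singleton]
    rw [this]
    exact hKb.add Bornology.isBounded_singleton
  obtain ⟨S, hS, hSK⟩ := floors (b := b) KK hKK
  obtain ⟨φ, hφm, hφb, hφ⟩ := exists_flow (b := b) (i := i) u (fun d => d.1.1.2) hum hu S hS
    (fun d x hx => hSK x (Or.inl (Or.inl (by by_contra h; exact hx (hK d x h)))))
    (fun d x hx => hSK x (Or.inl (Or.inr (Set.mem_iUnion.2 ⟨d, x - d.1.1.2, by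
      by_contra h; exact hx (hK d _ h), sub_add_cancel _ _⟩))))
    (interior W) (interior W') (fun d => hsplit _ ⟨d.1.1, d.1.2, rfl⟩)
    (by
      filter_upwards [huW, hUae] with x h1 h2
      rw [h1]; simp only [Set.indicator_apply, h2])
    (by
      filter_upwards [huW', hUae'] with x h1 h2
      rw [h1]; simp only [Set.indicator_apply, h2])
  obtain ⟨R, hR, hsyn⟩ := syndetic_Om (b := b) (i := i) (interior W') isOpen_interior hne
    (hdense.mono fun x hx => hsplit x hx)
  have hms : ∀ (U : Set (Fin n → ℝ)), IsOpen U → ∀ l : S, MeasurableSet {ω : Om b i | ω.val + l ∈ U} :=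
    fun U hU l => (measurable_val.add_const _) hU.measurableSet
  obtain ⟨B, F, X, hFm, hFB, hXm, hXc, hXi, hbij⟩ := abstract_main
    (fun g => measurable_vadd_Om (b := b) (i := i) g) (hasCol_Om hi0) (nuOm b i) quasi_Om
    (fun l : S => {ω : Om b i | ω.val + l ∈ interior W}) (fun l : S => {ω : Om b i | ω.val + l ∈ interior W'})
    (hms _ isOpen_interior) (hms _ isOpen_interior) φ hφm hφb hφ R hR (by
      intro ω
      obtain ⟨g, hg, z, hz, hU⟩ := hsyn ω
      refine ⟨g, hg, ⟨fl b (i g + ω.val + z), hSK _ (Or.inr (Or.inr hU))⟩, ?_⟩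
      show (g +ᵥ ω).val + fl b (i g + ω.val + z) ∈ interior W'
      have := val_pr_add b i (i g + ω.val + z)
      rw [pr_add _ hz, ← vadd_def] at this
      rwa [this])
  -- the carries
  obtain ⟨Z, hZ, hZK⟩ := floors (b := b) ((i '' (Q J B : Set (J → ℤ))) + ZSpan.fundamentalDomain b)
    ((((Q J B).finite_toSet.image i).isBounded).add (ZSpan.fundamentalDomain_isBounded b))
  let P : (Q J B) × Z × S × S → Set (Fin n → ℝ) := fun k =>
    {w | w ∈ interior W ∧ fl b w = k.2.2.2 ∧ F k.2.2.2 (pr b i w) = (k.1.1, k.2.2.1) ∧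
      fl b (i k.1.1 + (pr b i w).val) = k.2.1}
  let h : (Q J B) × Z × S × S → (Fin n → ℝ) := fun k => i k.1.1 - k.2.1 + k.2.2.1 - k.2.2.2
  -- the image of a point
  have hpt : ∀ k, ∀ w ∈ P k, h k + w = (k.1.1 +ᵥ pr b i w).val + k.2.2.1 := by
    rintro ⟨g, z, l', l⟩ w ⟨_, h2, h3, h4⟩
    simp only at h2 h3 h4
    have a1 := val_pr_add b i w
    have a2 := val_pr_add b i (i g.1 + (pr b i w).val)
    rw [← vadd_def, h4] at a2
    rw [h2] at a1
    have a3 : (g.1 +ᵥ pr b i w).val = i g.1 + (pr b i w).val - z := eq_sub_of_add_eq a2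
    show i g.1 - z + l' - l + w = (g.1 +ᵥ pr b i w).val + l'
    rw [a3]
    nth_rewrite 1 [← a1]
    abel
  have hpr : ∀ k x, pr b i (h k + x) = k.1.1 +ᵥ pr b i x := by
    rintro ⟨g, z, l', l⟩ x
    rw [vadd_pr]
    have : h (g, z, l', l) + x = (i g.1 + x) + (-(z : Fin n → ℝ) + l' - l) := by
      simp only [h]; abel
    rw [this, pr_add]
    exact Submodule.sub_mem _ (Submodule.add_mem _ (Submodule.neg_mem _ (hZ _ z.2)) (hS _ l'.2)) (hS _ l.2)
  have hmemA : ∀ k, ∀ w ∈ P k, pr b i w ∈ X → ((pr b i w, k.2.2.2) : Om b i × S) ∈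
      {q : Om b i × S | q.1 ∈ {ω : Om b i | ω.val + q.2 ∈ interior W} ∧ q.1 ∈ X} := by
    rintro ⟨g, z, l', l⟩ w ⟨h1, h2, h3, h4⟩ hX
    refine ⟨?_, hX⟩
    show (pr b i w).val + l ∈ interior W
    simp only at h2
    rw [← h2, val_pr_add]; exact h1
  refine equidecomp_of W W' (interior W) (interior W') _ {x | pr b i x ∈ X} P h ?_ ?_ hUae hUae' (ae_pull hXc)
    ?_ ?_ ?_ ?_ ?_ ?_ ?_
  · rintro ⟨g, z, l', l⟩
    refine isOpen_interior.measurableSet.inter (MeasurableSet.inter ?_ (MeasurableSet.inter ?_ ?_))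
    · exact measurable_fl (measurableSet_singleton _)
    · exact measurable_pr (hFm l (g.1, l'))
    · exact (measurable_fl.comp ((measurable_val.comp measurable_pr).const_add _)) (measurableSet_singleton _)
  · rintro ⟨g, z, l', l⟩
    let G : AddSubgroup (Fin n → ℝ) := Γ.map (AddMonoidHom.snd _ _)
    have e1 : i g.1 ∈ G := hiΓ g.1
    have e2 : (z : Fin n → ℝ) ∈ G := hbΓ _ (hZ _ z.2)
    have e3 : (l' : Fin n → ℝ) ∈ G := hbΓ _ (hS _ l'.2)
    have e4 : (l : Fin n → ℝ) ∈ G := hbΓ _ (hS _ l.2)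
    exact G.sub_mem (G.add_mem (G.sub_mem e1 e2) e3) e4
  · intro k x
    show pr b i (h k + x) ∈ X ↔ pr b i x ∈ X
    rw [hpr, hXi]
  · intro k w hw; exact hw.1
  · intro w hw
    let l : S := ⟨fl b w, hSK w (Or.inr (Or.inl hw))⟩
    let q := F l (pr b i w)
    exact ⟨(⟨q.1, hFB l _⟩, ⟨fl b (i q.1 + (pr b i w).val), hZK _ ⟨i q.1, ⟨q.1, hFB l _, rfl⟩, _, val_mem _, rfl⟩⟩, q.2, l),
      hw, rfl, rfl, rfl⟩
  · rintro ⟨⟨g, hg⟩, ⟨z, hz⟩, l', ⟨l, hl⟩⟩ ⟨⟨g2, hg2⟩, ⟨z2, hz2⟩, l2', ⟨l2, hl2⟩⟩ w ⟨_, a2, a3, a4⟩ ⟨_, c2, c3, c4⟩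
    simp only at a2 a3 a4 c2 c3 c4
    subst a2
    subst c2
    rw [a3, Prod.mk.injEq] at c3
    obtain ⟨rfl, rfl⟩ := c3
    subst a4
    subst c4
    rfl
  · intro k w hw hX
    rw [hpt k w hw]
    have := (hbij.mapsTo (hmemA k w hw hX)).1
    simp only [hw.2.2.1] at this
    exact this
  · intro k k' w w' hw hw' hX hX' heq
    have key : ((pr b i w, k.2.2.2) : Om b i × S) = (pr b i w', k'.2.2.2) := by
      refine hbij.injOn (hmemA k w hw hX) (hmemA k' w' hw' hX') ?_
      simp only [hw.2.2.1, hw'.2.2.1]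
      have e1 : k.1.1 +ᵥ pr b i w = k'.1.1 +ᵥ pr b i w' := by rw [← hpr, ← hpr, heq]
      rw [e1]
      congr 1
      rw [hpt k w hw, hpt k' w' hw', e1] at heq
      exact Subtype.ext (add_left_cancel heq)
    rw [Prod.mk.injEq] at key
    rw [← val_pr_add b i w, ← val_pr_add b i w', key.1, hw.2.1, hw'.2.1, key.2]
  · intro y hy hX
    have hmem : ((pr b i y, ⟨fl b y, hSK y (Or.inr (Or.inr hy))⟩) : Om b i × S) ∈
        {q : Om b i × S | q.1 ∈ {ω : Om b i | ω.val + q.2 ∈ interior W'} ∧ q.1 ∈ X} := by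
      refine ⟨?_, hX⟩
      show (pr b i y).val + fl b y ∈ interior W'
      rwa [val_pr_add]
    obtain ⟨⟨ω, l⟩, ⟨hω1, hω2⟩, hq⟩ := hbij.surjOn hmem
    simp only [Prod.mk.injEq] at hq
    have hω3 : ω.val + l ∈ interior W := hω1
    have hprw : pr b i (ω.val + l) = ω := by rw [pr_add _ (hS _ l.2), pr_val]
    let q := F l ω
    let k : (Q J B) × Z × S × S := (⟨q.1, hFB l _⟩,
      ⟨fl b (i q.1 + ω.val), hZK _ ⟨i q.1, ⟨q.1, hFB l _, rfl⟩, _, val_mem _, rfl⟩⟩, q.2, l)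
    have hk : ω.val + l ∈ P k := by
      refine ⟨hω3, fl_add_mem ω (hS _ l.2), ?_, ?_⟩
      · rw [hprw]
      · rw [hprw]
    refine ⟨k, ω.val + l, hk, ?_, ?_⟩
    · show pr b i (ω.val + l) ∈ X
      rw [hprw]; exact hω2
    · rw [hpt k _ hk, hprw]
      show (q.1 +ᵥ ω).val + q.2 = y
      rw [hq.1, hq.2, val_pr_add]

end BDE

/-- If `Γ` is a lattice in `ℝ^m × ℝ^n` with `p₁|_Γ` injective and `p₂(Γ)` dense, and
`W, W' ⊆ ℝ^n` are bounded Riemann measurable sets of positive measure whose model sets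
`Λ(Γ, W)` and `Λ(Γ, W')` are bounded distance equivalent, then `W, W'` are equidecomposable
up to measure zero with measurable pieces using translations from `p₂(Γ)`. -/
theorem bde_modelSets_implies_equidecomposable_windows {m n : ℕ}
    (Γ : AddSubgroup ((Fin m → ℝ) × (Fin n → ℝ))) (hΓ : IsLattice Γ)
    (hinj : Set.InjOn Prod.fst (Γ : Set ((Fin m → ℝ) × (Fin n → ℝ))))
    (hdense : Dense (Prod.snd '' (Γ : Set ((Fin m → ℝ) × (Fin n → ℝ)))))
    (W W' : Set (Fin n → ℝ))
    (hWbd : Bornology.IsBounded W) (hW'bd : Bornology.IsBounded W')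
    (hWrm : volume (frontier W) = 0) (hW'rm : volume (frontier W') = 0)
    (hWpos : 0 < volume W) (hW'pos : 0 < volume W')
    (hbde : BDEquiv (modelSet Γ W) (modelSet Γ W')) :
    EquidecompUpToNullMeasPieces W W'
      (Prod.snd '' (Γ : Set ((Fin m → ℝ) × (Fin n → ℝ)))) := by
  exact BDE.final Γ hΓ hinj hdense W W' hWbd hW'bd hWrm hW'rm hW'pos hbde
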